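/- If G is a 2-connected {square, unichord}-free graph, then G is a complete graph, or a sparse graph, or a 2-extension of the Petersen or Heawood graph, or G has a proper 2-cutset. -/

import Mathlib

open SimpleGraph

/-- An edge `e` of `G` is a chord of the cycle `c` if it joins two vertices of `c`
but is not an edge of `c`. -/
def IsChord {V : Type} (G : SimpleGraph V) {v : V} (c : G.Walk v v) (e : Sym2 V) : Prop :=
  e ∈ G.edgeSet ∧ e ∉ c.edges ∧ ∀ x ∈ e, x ∈ c.support

/-- A graph is unichord-free if no cycle has a unique chord. -/
def UnichordFree {V : Type} (G : SimpleGraph V) : Prop :=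
  ∀ (v : V) (c : G.Walk v v), c.IsCycle → ¬ ∃! e : Sym2 V, IsChord G c e

/-- `G` contains a square, i.e. an induced cycle on four vertices. -/
def HasSquare {V : Type} (G : SimpleGraph V) : Prop :=
  ∃ a b c d : V, G.Adj a b ∧ G.Adj b c ∧ G.Adj c d ∧ G.Adj d a ∧
    ¬ G.Adj a c ∧ ¬ G.Adj b d ∧ a ≠ c ∧ b ≠ d

/-- A total colouring: adjacent vertices, adjacent edges, and incident
vertex-edge pairs get different colours. -/
def IsTotalColouring {V α : Type} (G : SimpleGraph V) (fv : V → α) (fe : Sym2 V → α) : Prop :=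
  (∀ u v, G.Adj u v → fv u ≠ fv v) ∧
  (∀ e₁ e₂, e₁ ∈ G.edgeSet → e₂ ∈ G.edgeSet → e₁ ≠ e₂ → (∃ x, x ∈ e₁ ∧ x ∈ e₂) →
    fe e₁ ≠ fe e₂) ∧
  (∀ x e, e ∈ G.edgeSet → x ∈ e → fv x ≠ fe e)

/-- `G` admits a total colouring with `k` colours. -/
def TotalColourable {V : Type} (G : SimpleGraph V) (k : ℕ) : Prop :=
  ∃ (fv : V → Fin k) (fe : Sym2 V → Fin k), IsTotalColouring G fv fe

/-- A proper edge colouring with `k` colours. -/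
def EdgeColourable {V : Type} (G : SimpleGraph V) (k : ℕ) : Prop :=
  ∃ fe : Sym2 V → ℕ, (∀ e ∈ G.edgeSet, fe e < k) ∧
    ∀ e₁ e₂, e₁ ∈ G.edgeSet → e₂ ∈ G.edgeSet → e₁ ≠ e₂ → (∃ x, x ∈ e₁ ∧ x ∈ e₂) →
      fe e₁ ≠ fe e₂

/-- Two-connectivity: at least three vertices and deleting any single vertex
leaves a connected graph. -/
def TwoConnected {V : Type} (G : SimpleGraph V) : Prop :=
  3 ≤ (Set.univ : Set V).ncard ∧ ∀ v : V, (G.induce ({v}ᶜ : Set V)).Connected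

/-- A graph is sparse if its vertices of degree at least 3 form an independent set. -/
def Sparse {V : Type} (G : SimpleGraph V) : Prop :=
  ∀ u v, G.Adj u v → ¬ (3 ≤ (G.neighborSet u).ncard ∧ 3 ≤ (G.neighborSet v).ncard)

/-- `G` is a cycle graph. -/
def IsCycleGraph {V : Type} (G : SimpleGraph V) : Prop :=
  G.Connected ∧ ∀ v : V, (G.neighborSet v).ncard = 2

/-- The Petersen graph: outer 5-cycle `a`, inner pentagram `b`, spokes `aᵢbᵢ`. -/
def petersen : SimpleGraph (Fin 5 ⊕ Fin 5) :=
  SimpleGraph.fromRel (fun x y => match x, y with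
    | Sum.inl i, Sum.inl j => j = i + 1
    | Sum.inr i, Sum.inr j => j = i + 2
    | Sum.inl i, Sum.inr j => i = j
    | Sum.inr _, Sum.inl _ => False)

/-- The Heawood graph: a 14-cycle together with the seven standard chords. -/
def heawood : SimpleGraph (Fin 14) :=
  SimpleGraph.fromRel (fun i j => j = i + 1 ∨
    (i, j) ∈ ([((0 : Fin 14), (9 : Fin 14)), (1, 6), (2, 11), (3, 8), (4, 13), (5, 10),
      (7, 12)] : List (Fin 14 × Fin 14)))

/-- Subdivide the edge `uv` of `G`: the new vertex is `Sum.inr ()`. -/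
def SubdivideEdge {V : Type} (G : SimpleGraph V) (u v : V) : SimpleGraph (V ⊕ Unit) :=
  SimpleGraph.fromRel (fun x y => match x, y with
    | Sum.inl a, Sum.inl b => G.Adj a b ∧ ¬ (s(a, b) = s(u, v))
    | Sum.inl a, Sum.inr _ => a = u ∨ a = v
    | Sum.inr _, Sum.inl _ => False
    | Sum.inr _, Sum.inr _ => False)

/-- `G` is obtained from `H` (up to isomorphism) by repeatedly subdividing edges
incident to at least one vertex of degree 2. -/
inductive IsSubdivisionOf : {W : Type} → SimpleGraph W → {U : Type} → SimpleGraph U → Prop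
  | refl : ∀ {W : Type} (H : SimpleGraph W) {U : Type} (G : SimpleGraph U),
      (G ≃g H) → IsSubdivisionOf H G
  | step : ∀ {W : Type} (H : SimpleGraph W) {U : Type} (G : SimpleGraph U) (u v : U),
      G.Adj u v → ((G.neighborSet u).ncard = 2 ∨ (G.neighborSet v).ncard = 2) →
      IsSubdivisionOf H G → ∀ {U' : Type} (G' : SimpleGraph U'),
      (G' ≃g SubdivideEdge G u v) → IsSubdivisionOf H G'

/-- A 2-extension of `H`: first delete a set `S` of vertices of `H`, then
subdivide edges incident to at least one vertex of degree 2. -/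
def IsTwoExtensionOf {W U : Type} (H : SimpleGraph W) (G : SimpleGraph U) : Prop :=
  ∃ S : Set W, IsSubdivisionOf (H.induce Sᶜ) G

/-- `G'` is the reduced graph of `G`: every branch of `G'` has length at most 2
(no degree-2 vertex has a neighbour of degree 2) and `G` is obtained from `G'`
by subdividing edges incident to degree-2 vertices. -/
def IsReducedGraphOf {W U : Type} (G' : SimpleGraph W) (G : SimpleGraph U) : Prop :=
  (∀ v : W, (G'.neighborSet v).ncard = 2 →
    ∀ w ∈ G'.neighborSet v, 3 ≤ (G'.neighborSet w).ncard) ∧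
  IsSubdivisionOf G' G

/-- There is an `ab`-path of `G` all of whose vertices lie in `S`. -/
def ContainsPathBetween {V : Type} (G : SimpleGraph V) (S : Set V) (a b : V) : Prop :=
  ∃ p : G.Walk a b, p.IsPath ∧ ∀ v ∈ p.support, v ∈ S

/-- The subgraph of `G` induced by `S` is precisely an `ab`-path. -/
def InducedIsPathGraph {V : Type} (G : SimpleGraph V) (S : Set V) (a b : V) : Prop :=
  ∃ p : G.Walk a b, p.IsPath ∧ (∀ v, v ∈ S ↔ v ∈ p.support) ∧
    ∀ u v, u ∈ S → v ∈ S → G.Adj u v → s(u, v) ∈ p.edges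

/-- `(X, Y, a, b)` is a split of a proper 2-cutset of `G`. -/
structure IsProper2CutsetSplit {V : Type} (G : SimpleGraph V) (X Y : Set V) (a b : V) :
    Prop where
  hne : a ≠ b
  hnadj : ¬ G.Adj a b
  hcover : ∀ v, v ∈ X ∨ v ∈ Y ∨ v = a ∨ v = b
  hdisj : Disjoint X Y
  haX : a ∉ X
  haY : a ∉ Y
  hbX : b ∉ X
  hbY : b ∉ Y
  hX2 : 2 ≤ X.ncard
  hY2 : 2 ≤ Y.ncard
  hsep : ∀ x ∈ X, ∀ y ∈ Y, ¬ G.Adj x y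
  hXpath : ContainsPathBetween G (X ∪ {a, b}) a b
  hXnotpath : ¬ InducedIsPathGraph G (X ∪ {a, b}) a b
  hYpath : ContainsPathBetween G (Y ∪ {a, b}) a b
  hYnotpath : ¬ InducedIsPathGraph G (Y ∪ {a, b}) a b

/-- `G` has a proper 2-cutset. -/
def HasProper2Cutset {V : Type} (G : SimpleGraph V) : Prop :=
  ∃ (a b : V) (X Y : Set V), IsProper2CutsetSplit G X Y a b

/-- `G` has a 1-cutset (a cutvertex) with split `(X, Y, v)`. -/
def Has1Cutset {V : Type} (G : SimpleGraph V) : Prop :=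
  ∃ (v : V) (X Y : Set V), X.Nonempty ∧ Y.Nonempty ∧ Disjoint X Y ∧ v ∉ X ∧ v ∉ Y ∧
    (∀ w, w ∈ X ∨ w ∈ Y ∨ w = v) ∧ ∀ x ∈ X, ∀ y ∈ Y, ¬ G.Adj x y

/-- `(X, Y, A, B)` is a split of a proper 1-join of `G`. -/
structure IsProper1JoinSplit {V : Type} (G : SimpleGraph V) (X Y A B : Set V) : Prop where
  hcover : ∀ v, v ∈ X ∨ v ∈ Y
  hdisj : Disjoint X Y
  hAX : A ⊆ X
  hBY : B ⊆ Y
  hA2 : 2 ≤ A.ncard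
  hB2 : 2 ≤ B.ncard
  hAstable : ∀ u ∈ A, ∀ v ∈ A, ¬ G.Adj u v
  hBstable : ∀ u ∈ B, ∀ v ∈ B, ¬ G.Adj u v
  hcomplete : ∀ u ∈ A, ∀ v ∈ B, G.Adj u v
  hother : ∀ u ∈ X, ∀ v ∈ Y, G.Adj u v → u ∈ A ∧ v ∈ B

/-- `G` has a proper 1-join. -/
def HasProper1Join {V : Type} (G : SimpleGraph V) : Prop :=
  ∃ X Y A B : Set V, IsProper1JoinSplit G X Y A B

/-- Some edge of `G` joins `A` to `B`. -/
def Touches {V : Type} (G : SimpleGraph V) (A B : Set V) : Prop :=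
  ∃ a ∈ A, ∃ b ∈ B, G.Adj a b

/-- `A` is nonempty and induces a connected subgraph, phrased through closed subsets. -/
structure ConnSet {V : Type} (G : SimpleGraph V) (A : Set V) : Prop where
  nonempty : A.Nonempty
  subset_of_closed : ∀ X : Set V, (∃ x ∈ A, x ∈ X) →
    (∀ x ∈ A, x ∈ X → ∀ y ∈ A, G.Adj x y → y ∈ X) → A ⊆ X

section ConnSets

variable {V : Type} {G : SimpleGraph V}

theorem Touches.symm {A B : Set V} (h : Touches G A B) : Touches G B A := by
  obtain ⟨a, ha, b, hb, hab⟩ := h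
  exact ⟨b, hb, a, ha, hab.symm⟩

theorem touches_comm {A B : Set V} : Touches G A B ↔ Touches G B A :=
  ⟨Touches.symm, Touches.symm⟩

theorem Touches.mono {A B A' B' : Set V} (h : Touches G A B) (hA : A ⊆ A') (hB : B ⊆ B') :
    Touches G A' B' := by
  obtain ⟨a, ha, b, hb, hab⟩ := h
  exact ⟨a, hA ha, b, hB hb, hab⟩

theorem ConnSet.singleton (v : V) : ConnSet G {v} := by
  refine ⟨⟨v, rfl⟩, ?_⟩
  rintro X ⟨x, rfl, hx⟩ - y rfl
  exact hx

theorem ConnSet.union {A B : Set V} (hA : ConnSet G A) (hB : ConnSet G B)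
    (h : Touches G A B) : ConnSet G (A ∪ B) := by
  obtain ⟨a, ha, b, hb, hab⟩ := h
  refine ⟨⟨a, Or.inl ha⟩, fun X hX hcl => ?_⟩
  have key1 : (∃ x ∈ A, x ∈ X) → A ⊆ X := fun hx =>
    hA.subset_of_closed X hx fun x hxA hxX y hy hxy =>
      hcl x (Or.inl hxA) hxX y (Or.inl hy) hxy
  have key2 : (∃ x ∈ B, x ∈ X) → B ⊆ X := fun hx =>
    hB.subset_of_closed X hx fun x hxA hxX y hy hxy =>
      hcl x (Or.inr hxA) hxX y (Or.inr hy) hxy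
  have hAX : A ⊆ X := by
    obtain ⟨x, hx | hx, hxX⟩ := hX
    · exact key1 ⟨x, hx, hxX⟩
    · have hbX := key2 ⟨x, hx, hxX⟩ hb
      exact key1 ⟨a, ha, hcl b (Or.inr hb) hbX a (Or.inl ha) hab.symm⟩
  have hBX : B ⊆ X := key2 ⟨b, hb, hcl a (Or.inl ha) (hAX ha) b (Or.inr hb) hab⟩
  exact Set.union_subset hAX hBX

theorem ConnSet.insert {A : Set V} {v : V} (hA : ConnSet G A) (h : Touches G {v} A) :
    ConnSet G (insert v A) :=
  (ConnSet.singleton v).union hA h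

/-- A nonempty proper part of a connected set has an edge to the rest of the set. -/
theorem ConnSet.exists_adj {A X : Set V} (hA : ConnSet G A) {x y : V} (hx : x ∈ A)
    (hxX : x ∈ X) (hy : y ∈ A) (hyX : y ∉ X) :
    ∃ a ∈ A, a ∈ X ∧ ∃ b ∈ A, b ∉ X ∧ G.Adj a b := by
  by_contra! hc
  exact hyX (hA.subset_of_closed X ⟨x, hx, hxX⟩
    (fun a ha haX b hb hab => by_contra fun hbX => hc a ha haX b hb hbX hab) hy)

/-- The connected component of `z` inside `O`. -/
theorem exists_component {O : Set V} {z : V} (hz : z ∈ O) :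
    ∃ K, ConnSet G K ∧ z ∈ K ∧ K ⊆ O ∧ ∀ x ∈ K, ∀ y ∈ O, G.Adj x y → y ∈ K := by
  let Cl : Set V → Prop := fun X => z ∈ X ∧ ∀ x ∈ X, ∀ y ∈ O, G.Adj x y → y ∈ X
  let K : Set V := {y | y ∈ O ∧ ∀ X, Cl X → y ∈ X}
  have hzK : z ∈ K := ⟨hz, fun X hX => hX.1⟩
  have hcl : ∀ x ∈ K, ∀ y ∈ O, G.Adj x y → y ∈ K := fun x hx y hy hxy =>
    ⟨hy, fun X hX => hX.2 x (hx.2 X hX) y hy hxy⟩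
  refine ⟨K, ⟨⟨z, hzK⟩, ?_⟩, hzK, fun y hy => hy.1, hcl⟩
  rintro X ⟨x, hxK, hxX⟩ hX
  have hzX : z ∈ X := by
    by_contra hzX
    have : Cl (K \ X) := ⟨⟨hzK, hzX⟩, fun a ha b hb hab =>
      ⟨hcl a ha.1 b hb hab, fun hbX => ha.2 (hX b (hcl a ha.1 b hb hab) hbX a ha.1 hab.symm)⟩⟩
    exact (hxK.2 _ this).2 hxX
  have : Cl (K ∩ X) := ⟨⟨hzK, hzX⟩, fun a ha b hb hab =>
      ⟨hcl a ha.1 b hb hab, hX a ha.1 ha.2 b (hcl a ha.1 b hb hab) hab⟩⟩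
  exact fun y hy => (hy.2 _ this).2

/-- A connected set with a second vertex has a vertex other than `r` whose removal leaves it
connected. -/
theorem ConnSet.exists_diff_singleton [Finite V] {Q : Set V} (hQ : ConnSet G Q) {r r' : V}
    (hr : r ∈ Q) (hr' : r' ∈ Q) (hne : r' ≠ r) :
    ∃ x ∈ Q, x ≠ r ∧ ConnSet G (Q \ {x}) := by
  obtain ⟨R, ⟨hRc, hrR, hRQ, hRne⟩, hmax⟩ := Set.Finite.exists_maximalFor Set.ncard
    {R : Set V | ConnSet G R ∧ r ∈ R ∧ R ⊆ Q ∧ R ≠ Q} (Set.toFinite _)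
    ⟨{r}, ConnSet.singleton r, rfl, by simpa using hr, fun h => hne (by rw [← h] at hr'; exact hr')⟩
  obtain ⟨y, hyQ, hyR⟩ : ∃ y ∈ Q, y ∉ R := by
    by_contra! h
    exact hRne (Set.Subset.antisymm hRQ h)
  obtain ⟨a, haQ, haR, b, hbQ, hbR, hab⟩ := hQ.exists_adj hr hrR hyQ hyR
  have hcon : ConnSet G (Insert.insert b R) := hRc.insert ⟨b, rfl, a, haR, hab.symm⟩
  have hEq : Insert.insert b R = Q := by
    by_contra hne'
    have h1 := hmax ⟨hcon, Or.inr hrR, Set.insert_subset hbQ hRQ, hne'⟩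
    have h2 : (Insert.insert b R).ncard = R.ncard + 1 := Set.ncard_insert_of_notMem hbR
    have := h1 (by omega)
    omega
  refine ⟨b, hbQ, fun h => hbR (h ▸ hrR), ?_⟩
  have hR : Insert.insert b R \ {b} = R := by
    ext z
    simp only [Set.mem_sdiff, Set.mem_insert_iff, Set.mem_singleton_iff]
    exact ⟨fun h => h.1.resolve_left h.2, fun h => ⟨Or.inr h, fun e => hbR (e ▸ h)⟩⟩
  rw [← hEq, hR]
  exact hRc

/-- In a 2-connected graph a nonempty set closed up to a vertex `v` is everything but `v`. -/
theorem TwoConnected.eq_compl (h : TwoConnected G) {K : Set V} {v x : V} (hx : x ∈ K)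
    (hv : v ∉ K) (hcl : ∀ x ∈ K, ∀ y, G.Adj x y → y ≠ v → y ∈ K) {y : V} (hy : y ≠ v) :
    y ∈ K := by
  have hxv : x ≠ v := fun e => hv (e ▸ hx)
  obtain ⟨w⟩ := (h.2 v).preconnected ⟨x, hxv⟩ ⟨y, hy⟩
  have : ∀ {a b : (({v}ᶜ : Set V))}, (G.induce ({v}ᶜ : Set V)).Walk a b → a.1 ∈ K → b.1 ∈ K := by
    intro a b w
    induction w with
    | nil => exact id
    | @cons a b c hab _ ih => exact fun ha => ih (hcl _ ha _ hab fun e => b.2 e)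
  exact this w hx

end ConnSets

/-- `p 0 = s, p 1, …, p n, p (n + 1) = t` is a path of `G` with interior `D` whose only possible
chord is `st`. -/
structure IsArc {V : Type} (G : SimpleGraph V) (D : Set V) (s t : V) (n : ℕ) (p : ℕ → V) :
    Prop where
  pos : 1 ≤ n
  zero : p 0 = s
  last : p (n + 1) = t
  mem_iff : ∀ x, x ∈ D ↔ ∃ i, 1 ≤ i ∧ i ≤ n ∧ p i = x
  inj : ∀ i j, i ≤ n + 1 → j ≤ n + 1 → p i = p j → i = j
  step : ∀ i, i ≤ n → G.Adj (p i) (p (i + 1))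
  adj : ∀ i j, i < j → j ≤ n + 1 → G.Adj (p i) (p j) → j = i + 1 ∨ (i = 0 ∧ j = n + 1)

section Arcs

variable {V : Type} {G : SimpleGraph V}

theorem Walk.dist_getVert_of_length_eq_dist {H : SimpleGraph V} {s t : V} (w : H.Walk s t)
    (hw : w.length = H.dist s t) {i : ℕ} (hi : i ≤ w.length) : H.dist s (w.getVert i) = i := by
  have h1 : H.dist s (w.getVert i) ≤ i := by
    refine (dist_le (w.take i)).trans ?_
    simp
  have h2 : H.dist (w.getVert i) t ≤ w.length - i := by
    refine (dist_le (w.drop i)).trans ?_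
    simp
  have h3 : H.dist s t ≤ H.dist s (w.getVert i) + H.dist (w.getVert i) t :=
    (w.take i).reachable.dist_triangle_left t
  omega

theorem ConnSet.exists_isArc {D : Set V} (hD : ConnSet G D) {s t : V} (hs : s ∉ D) (ht : t ∉ D)
    (hst : s ≠ t) (hsD : Touches G {s} D) (htD : Touches G {t} D) :
    ∃ D' ⊆ D, ∃ n p, IsArc G D' s t n p := by
  let H : SimpleGraph V :=
    { Adj := fun a b => G.Adj a b ∧ (a ∈ D ∨ b ∈ D) ∧ (a ∈ D ∨ a = s ∨ a = t) ∧
        (b ∈ D ∨ b = s ∨ b = t)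
      symm := ⟨fun a b h => ⟨h.1.symm, h.2.1.symm, h.2.2.2, h.2.2.1⟩⟩
      loopless := ⟨fun a h => G.loopless.irrefl a h.1⟩ }
  have hreach : H.Reachable s t := by
    obtain ⟨_, rfl, a, ha, hsa⟩ := hsD
    obtain ⟨_, rfl, b, hb, htb⟩ := htD
    have hab : D ⊆ {x | H.Reachable a x} := hD.subset_of_closed _ ⟨a, ha, Reachable.refl a⟩
      fun x hx hax y hy hxy => Reachable.trans hax (Adj.reachable
        (show H.Adj x y from ⟨hxy, Or.inl hx, Or.inl hx, Or.inl hy⟩))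
    have h1 : H.Adj _ a := ⟨hsa, Or.inr ha, Or.inr (Or.inl rfl), Or.inl ha⟩
    have h2 : H.Adj b _ := ⟨htb.symm, Or.inl hb, Or.inl hb, Or.inr (Or.inr rfl)⟩
    exact h1.reachable.trans ((hab hb).trans h2.reachable)
  obtain ⟨w, hw⟩ := hreach.exists_walk_length_eq_dist
  have hdist : ∀ i, i ≤ w.length → H.dist s (w.getVert i) = i := fun i hi =>
    Walk.dist_getVert_of_length_eq_dist w hw hi
  have hstep : ∀ i, i < w.length → H.Adj (w.getVert i) (w.getVert (i + 1)) :=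
    fun i hi => w.adj_getVert_succ hi
  have hinj : ∀ i j, i ≤ w.length → j ≤ w.length → w.getVert i = w.getVert j → i = j := by
    intro i j hi hj h
    rw [← hdist i hi, ← hdist j hj, h]
  have hadj : ∀ i j, i < j → j ≤ w.length → H.Adj (w.getVert i) (w.getVert j) → j = i + 1 := by
    intro i j hij hj h
    have h1 := hdist i (by omega)
    have h2 := hdist j hj
    have h3 : H.dist s (w.getVert j) ≤ H.dist s (w.getVert i) + H.dist (w.getVert i)
      (w.getVert j) := (w.take i).reachable.dist_triangle_left _
    rw [dist_eq_one_iff_adj.2 h] at h3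
    omega
  have hlen : 2 ≤ w.length := by
    by_contra hlt
    have h0 : w.length ≠ 0 := fun h => hst (Walk.eq_of_length_eq_zero h)
    have h1 : w.length = 1 := by omega
    have := hstep 0 (by omega)
    rw [w.getVert_zero, zero_add, ← h1, w.getVert_length] at this
    exact this.2.1.elim hs ht
  have hint : ∀ i, 1 ≤ i → i < w.length → w.getVert i ∈ D := by
    intro i hi hi'
    rcases (hstep i hi').2.2.1 with h | h | h
    · exact h
    · have := hinj i 0 (by omega) (by omega) (by rw [w.getVert_zero, h])
      omega
    · have := hinj i w.length (by omega) le_rfl (by rw [w.getVert_length, h])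
      omega
  refine ⟨{x | ∃ i, 1 ≤ i ∧ i ≤ w.length - 1 ∧ w.getVert i = x}, ?_, w.length - 1, w.getVert,
    by omega, w.getVert_zero, ?_, fun x => Iff.rfl, ?_, ?_, ?_⟩
  · rintro _ ⟨i, h1, h2, rfl⟩
    exact hint i h1 (by omega)
  · rw [Nat.sub_add_cancel (by omega), w.getVert_length]
  · exact fun i j hi hj => hinj i j (by omega) (by omega)
  · exact fun i hi => (hstep i (by omega)).1
  · intro i j hij hj h
    by_cases hends : i = 0 ∧ j = w.length - 1 + 1
    · exact Or.inr hends
    · refine Or.inl (hadj i j hij (by omega) ⟨h, ?_⟩)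
      have hjm : 1 ≤ i → w.getVert i ∈ D := fun h1 => hint i h1 (by omega)
      have hjm' : j < w.length → w.getVert j ∈ D := fun h1 => hint j (by omega) h1
      have hi0 : i = 0 → w.getVert i = s := fun h0 => by rw [h0, w.getVert_zero]
      have hjl : j = w.length → w.getVert j = t := fun h0 => by rw [h0, w.getVert_length]
      refine ⟨?_, ?_, ?_⟩
      · rcases Nat.eq_zero_or_pos i with h0 | h0
        · exact Or.inr (hjm' (by omega))
        · exact Or.inl (hjm h0)
      · rcases Nat.eq_zero_or_pos i with h0 | h0
        · exact Or.inr (Or.inl (hi0 h0))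
        · exact Or.inl (hjm h0)
      · rcases Nat.lt_or_ge j w.length with h0 | h0
        · exact Or.inl (hjm' h0)
        · exact Or.inr (Or.inr (hjl (by omega)))

namespace IsArc

variable {D : Set V} {s t : V} {n : ℕ} {p : ℕ → V}

theorem reverse (h : IsArc G D s t n p) : IsArc G D t s n fun i => p (n + 1 - i) where
  pos := h.pos
  zero := h.last
  last := by simpa using h.zero
  mem_iff x := by
    rw [h.mem_iff]
    constructor
    · rintro ⟨i, h1, h2, rfl⟩
      exact ⟨n + 1 - i, by omega, by omega, by congr 1; omega⟩
    · rintro ⟨i, h1, h2, rfl⟩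
      exact ⟨n + 1 - i, by omega, by omega, rfl⟩
  inj i j hi hj hij := by
    have := h.inj _ _ (by omega) (by omega) hij
    omega
  step i hi := by
    have := (h.step (n - i) (by omega)).symm
    rwa [show n - i + 1 = n + 1 - i by omega, show n - i = n + 1 - (i + 1) by omega] at this
  adj i j hij hj hadj := by
    have := h.adj (n + 1 - j) (n + 1 - i) (by omega) (by omega) hadj.symm
    omega

theorem mem (h : IsArc G D s t n p) {i : ℕ} (h1 : 1 ≤ i) (h2 : i ≤ n) : p i ∈ D :=
  (h.mem_iff _).2 ⟨i, h1, h2, rfl⟩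

/-- The vertices of the arc with indices from `i` to `j`. -/
theorem connSet_image (h : IsArc G D s t n p) {i j : ℕ} (hij : i ≤ j) (hj : j ≤ n + 1) :
    ConnSet G (p '' Set.Icc i j) := by
  induction j, hij using Nat.le_induction with
  | base => simpa using ConnSet.singleton (p i)
  | succ j hij ih =>
    have hset : p '' Set.Icc i (j + 1) = Insert.insert (p (j + 1)) (p '' Set.Icc i j) := by
      rw [← Set.image_insert_eq]
      congr 1
      ext k
      simp only [Set.mem_Icc, Set.mem_insert_iff]
      omega
    rw [hset]
    exact (ih (by omega)).insert
      ⟨_, rfl, p j, ⟨j, ⟨hij, le_rfl⟩, rfl⟩, (h.step j (by omega)).symm⟩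

theorem eq_image (h : IsArc G D s t n p) : D = p '' Set.Icc 1 n := by
  ext x
  rw [h.mem_iff]
  simp only [Set.mem_image, Set.mem_Icc, and_assoc]

theorem connSet (h : IsArc G D s t n p) : ConnSet G D := by
  rw [h.eq_image]
  exact h.connSet_image h.pos (by omega)

theorem start_notMem (h : IsArc G D s t n p) : s ∉ D := by
  rw [h.mem_iff]
  rintro ⟨i, h1, h2, h3⟩
  have := h.inj i 0 (by omega) (by omega) (by rw [h3, h.zero])
  omega

theorem last_notMem (h : IsArc G D s t n p) : t ∉ D := h.reverse.start_notMem

theorem ne (h : IsArc G D s t n p) : s ≠ t := by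
  intro e
  have := h.inj 0 (n + 1) (by omega) (by omega) (by rw [h.zero, h.last, e])
  omega

theorem ncard_eq (h : IsArc G D s t n p) : D.ncard = n := by
  have hinj : Set.InjOn p (Set.Icc 1 n) := by
    intro i hi j hj hij
    simp only [Set.mem_Icc] at hi hj
    exact h.inj i j (by omega) (by omega) hij
  rw [h.eq_image, hinj.ncard_image, Set.ncard_eq_toFinset_card']
  simp

theorem adj_start_iff (h : IsArc G D s t n p) {i : ℕ} (h1 : 1 ≤ i) (h2 : i ≤ n) :
    G.Adj s (p i) ↔ i = 1 := by
  constructor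
  · intro ha
    rw [← h.zero] at ha
    have := h.adj 0 i (by omega) (by omega) ha
    omega
  · rintro rfl
    have := h.step 0 (by omega)
    rwa [h.zero] at this

theorem adj_last_iff (h : IsArc G D s t n p) {i : ℕ} (h1 : 1 ≤ i) (h2 : i ≤ n) :
    G.Adj t (p i) ↔ i = n := by
  have := h.reverse.adj_start_iff (i := n + 1 - i) (by omega) (by omega)
  simp only [show n + 1 - (n + 1 - i) = i by omega] at this
  rw [this]
  omega

end IsArc

theorem touches_image_iff {p : ℕ → V} {i j : ℕ} {B : Set V} :
    Touches G (p '' Set.Icc i j) B ↔ ∃ k, i ≤ k ∧ k ≤ j ∧ ∃ b ∈ B, G.Adj (p k) b := by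
  simp only [Touches, Set.exists_mem_image, Set.mem_Icc, and_assoc]

end Arcs

/-- No edge `uv` has two disjoint anticomplete connected sets attached to both of its ends. -/
def SplitFree {V : Type} (G : SimpleGraph V) : Prop :=
  ∀ (u v : V) (A B : Set V), G.Adj u v → ConnSet G A → ConnSet G B → u ∉ A → v ∉ A → u ∉ B →
    v ∉ B → Disjoint A B → Touches G {u} A → Touches G {v} A → Touches G {u} B →
    Touches G {v} B → Touches G A B

section SplitFree

variable {V : Type} {G : SimpleGraph V}

theorem exists_walk_of_steps (p : ℕ → V) (k : ℕ) (h : ∀ i, i < k → G.Adj (p i) (p (i + 1))) :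
    ∃ w : G.Walk (p 0) (p k), w.support = (List.range (k + 1)).map p ∧
      w.edges = (List.range k).map fun i => s(p i, p (i + 1)) := by
  induction k with
  | zero => exact ⟨Walk.nil, by simp, by simp⟩
  | succ k ih =>
    obtain ⟨w, hs, he⟩ := ih fun i hi => h i (by omega)
    refine ⟨w.concat (h k (by omega)), ?_, ?_⟩
    · rw [Walk.support_concat, hs, List.range_succ (n := k + 1)]
      simp
    · rw [Walk.edges_concat, he, List.range_succ (n := k)]
      simp

/-- A closed sequence of distinct vertices with consecutive ones adjacent gives a cycle. -/
theorem exists_isCycle_of_steps (p : ℕ → V) (k : ℕ) (hk : 2 ≤ k)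
    (h : ∀ i, i ≤ k → G.Adj (p i) (p (i + 1))) (hclose : p (k + 1) = p 0)
    (hinj : ∀ i j, i ≤ k → j ≤ k → p i = p j → i = j) :
    ∃ c : G.Walk (p k) (p k), c.IsCycle ∧ (∀ x, x ∈ c.support ↔ ∃ i, i ≤ k ∧ p i = x) ∧
      ∀ e, e ∈ c.edges ↔ ∃ i, i ≤ k ∧ s(p i, p (i + 1)) = e := by
  obtain ⟨w, hs, he⟩ := exists_walk_of_steps p k fun i hi => h i (by omega)
  have hkadj : G.Adj (p k) (p 0) := hclose ▸ h k le_rfl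
  have hpath : w.IsPath := by
    rw [Walk.isPath_def, hs]
    refine List.Nodup.map_on ?_ List.nodup_range
    intro i hi j hj hij
    rw [List.mem_range] at hi hj
    exact hinj i j (by omega) (by omega) hij
  have hnot : s(p 0, p k) ∉ w.edges := by
    rw [he]
    simp only [List.mem_map, List.mem_range, not_exists, not_and]
    intro i hi hij
    rcases Sym2.eq_iff.1 hij with ⟨h1, h2⟩ | ⟨h1, h2⟩
    · have e1 := hinj _ _ (by omega) (by omega) h1
      have e2 := hinj _ _ (by omega) (by omega) h2
      omega
    · have e2 := hinj _ _ (by omega) (by omega) h1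
      omega
  have hcyc : (Walk.cons hkadj w).IsCycle :=
    (Walk.cons_isCycle_iff w hkadj).2 ⟨hpath, by rwa [Sym2.eq_swap] at hnot⟩
  have hsup : ∀ x, x ∈ (Walk.cons hkadj w).support ↔ ∃ i, i ≤ k ∧ p i = x := by
    intro x
    rw [Walk.support_cons, hs]
    simp only [List.mem_cons, List.mem_map, List.mem_range, Nat.lt_succ_iff]
    exact ⟨fun hx => hx.elim (fun e => ⟨k, le_rfl, e.symm⟩) id, Or.inr⟩
  have hedge : ∀ e, e ∈ (Walk.cons hkadj w).edges ↔ ∃ i, i ≤ k ∧ s(p i, p (i + 1)) = e := by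
    intro e
    rw [Walk.edges_cons, he]
    simp only [List.mem_cons, List.mem_map, List.mem_range]
    constructor
    · rintro (rfl | ⟨i, hi, rfl⟩)
      · exact ⟨k, le_rfl, by rw [hclose]⟩
      · exact ⟨i, by omega, rfl⟩
    · rintro ⟨i, hi, rfl⟩
      rcases Nat.lt_or_ge i k with h1 | h1
      · exact Or.inr ⟨i, h1, rfl⟩
      · left
        rw [show i = k by omega, hclose]
  exact ⟨Walk.cons hkadj w, hcyc, hsup, hedge⟩

theorem UnichordFree.splitFree (hG : UnichordFree G) : SplitFree G := by
  intro u v A B huv hA hB huA hvA huB hvB hdisj huA' hvA' huB' hvB'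
  by_contra hAB
  obtain ⟨A', hA'A, n, p, hp⟩ := hA.exists_isArc huA hvA huv.ne huA' hvA'
  obtain ⟨B', hB'B, m, q, hq⟩ := hB.exists_isArc hvB huB huv.ne.symm hvB' huB'
  have hpA : ∀ i, 1 ≤ i → i ≤ n → p i ∈ A := fun i h1 h2 => hA'A (hp.mem h1 h2)
  have hqB : ∀ i, 1 ≤ i → i ≤ m → q i ∈ B := fun i h1 h2 => hB'B (hq.mem h1 h2)
  have hn := hp.pos
  have hm := hq.pos
  let c : ℕ → V := fun i => if i ≤ n + 1 then p i else q (i - (n + 1))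
  have hc1 : ∀ i, i ≤ n + 1 → c i = p i := fun i hi => if_pos hi
  have hc2 : ∀ i, c (n + 1 + i) = q i := by
    intro i
    rcases Nat.eq_zero_or_pos i with rfl | h
    · rw [hc1 _ (by omega), add_zero, hp.last, hq.zero]
    · simp only [c]
      rw [if_neg (by omega)]
      congr 1
      omega
  have hsplit : ∀ i, i ≤ n + 1 + m → i ≤ n + 1 ∨ ∃ j, 1 ≤ j ∧ j ≤ m ∧ i = n + 1 + j := by
    intro i hi
    rcases Nat.lt_or_ge (n + 1) i with h | h
    · exact Or.inr ⟨i - (n + 1), by omega, by omega, by omega⟩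
    · exact Or.inl h
  have hpB : ∀ i, i ≤ n + 1 → p i ∉ B := by
    intro i hi hiB
    rcases Nat.eq_zero_or_pos i with rfl | h0
    · exact huB (hp.zero ▸ hiB)
    · rcases Nat.lt_or_ge n i with h1 | h1
      · rw [show i = n + 1 by omega, hp.last] at hiB
        exact hvB hiB
      · exact Set.disjoint_left.1 hdisj (hpA i h0 h1) hiB
  have hstep : ∀ i, i ≤ n + 1 + m → G.Adj (c i) (c (i + 1)) := by
    intro i hi
    rcases Nat.lt_or_ge n i with h | h
    · obtain ⟨j, rfl⟩ := Nat.exists_eq_add_of_le (show n + 1 ≤ i by omega)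
      rw [hc2, show n + 1 + j + 1 = n + 1 + (j + 1) by omega, hc2]
      exact hq.step j (by omega)
    · rw [hc1 _ (by omega), hc1 _ (by omega)]
      exact hp.step i h
  have hclose : c (n + 1 + m + 1) = c 0 := by
    rw [add_assoc, hc2, hq.last, hc1 _ (by omega), hp.zero]
  have hinj : ∀ i j, i ≤ n + 1 + m → j ≤ n + 1 + m → c i = c j → i = j := by
    intro i j hi hj hij
    rcases hsplit i hi with h1 | ⟨i', h1, h1', rfl⟩ <;>
      rcases hsplit j hj with h2 | ⟨j', h2, h2', rfl⟩
    · rw [hc1 i h1, hc1 j h2] at hij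
      exact hp.inj i j h1 h2 hij
    · rw [hc1 i h1, hc2] at hij
      exact absurd (hij ▸ hqB j' h2 h2') (hpB i h1)
    · rw [hc1 j h2, hc2] at hij
      exact absurd (hij ▸ hqB i' h1 h1') (hpB j h2)
    · rw [hc2, hc2] at hij
      rw [hq.inj i' j' (by omega) (by omega) hij]
  obtain ⟨w, hw, hws, hwe⟩ := exists_isCycle_of_steps c (n + 1 + m) (by omega) hstep hclose hinj
  have hu : c 0 = u := by rw [hc1 _ (by omega), hp.zero]
  have hv : c (n + 1) = v := by rw [hc1 _ le_rfl, hp.last]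
  have hnotedge : s(u, v) ∉ w.edges := by
    rw [hwe]
    rintro ⟨i, hi, he⟩
    rw [← hu, ← hv] at he
    have hwrap : i = n + 1 + m → c (i + 1) = c 0 := fun h => by rw [h, hclose]
    rcases Sym2.eq_iff.1 he with ⟨h1, h2⟩ | ⟨h1, h2⟩
    · have e1 := hinj _ _ hi (by omega) h1
      subst e1
      have := hinj _ _ (by omega) (by omega) h2
      omega
    · have e1 := hinj _ _ hi (by omega) h1
      subst e1
      have := hinj _ _ (by omega) (by omega) h2
      omega
  refine hG _ w hw ⟨s(u, v), ⟨huv, hnotedge, ?_⟩, ?_⟩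
  · intro x hx
    rw [hws]
    rcases Sym2.mem_iff.1 hx with rfl | rfl
    · exact ⟨0, by omega, hu⟩
    · exact ⟨n + 1, by omega, hv⟩
  · have key : ∀ i j, i < j → j ≤ n + 1 + m → G.Adj (c i) (c j) → s(c i, c j) ∉ w.edges →
        s(c i, c j) = s(u, v) := by
      intro i j hij hj hadj hne
      have hnotstep : j ≠ i + 1 := by
        rintro rfl
        exact hne ((hwe _).2 ⟨i, by omega, rfl⟩)
      have hnotwrap : ¬ (i = 0 ∧ j = n + 1 + m) := by
        rintro ⟨rfl, rfl⟩
        exact hne ((hwe _).2 ⟨n + 1 + m, le_rfl, by rw [hclose, Sym2.eq_swap]⟩)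
      rcases hsplit i (by omega) with h1 | ⟨i', h1, h1', rfl⟩ <;>
        rcases hsplit j hj with h2 | ⟨j', h2, h2', rfl⟩
      · rw [hc1 i h1, hc1 j h2] at hadj
        rcases hp.adj i j hij h2 hadj with h | ⟨rfl, rfl⟩
        · exact absurd h hnotstep
        · rw [hu, hv]
      · have hadj' := hadj
        rw [hc1 i h1, hc2] at hadj
        rcases Nat.eq_zero_or_pos i with rfl | h0
        · rw [hp.zero, hq.adj_last_iff h2 h2'] at hadj
          omega
        · rcases Nat.lt_or_ge n i with h3 | h3
          · rw [show i = n + 1 by omega, hp.last, hq.adj_start_iff h2 h2'] at hadj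
            omega
          · exact absurd ⟨_, hpA i h0 h3, _, hqB j' h2 h2', hadj⟩ hAB
      · omega
      · rw [hc2, hc2] at hadj
        have := hq.adj i' j' (by omega) (by omega) hadj
        omega
    intro e
    induction e using Sym2.ind with
    | _ x y =>
      rintro ⟨hadj, hne, hsup⟩
      obtain ⟨i, hi, rfl⟩ := (hws x).1 (hsup x (Sym2.mem_mk_left _ _))
      obtain ⟨j, hj, rfl⟩ := (hws y).1 (hsup y (Sym2.mem_mk_right _ _))
      rw [mem_edgeSet] at hadj
      rcases Nat.lt_trichotomy i j with h | rfl | h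
      · exact key i j h hj hadj hne
      · exact absurd hadj (G.loopless.irrefl _)
      · rw [Sym2.eq_swap] at hne ⊢
        exact key j i h hi hadj.symm hne

end SplitFree

section Triangle

variable {V : Type} {G : SimpleGraph V}

/-- Two distinct vertices whose removal, one at a time, leaves a connected set connected. -/
theorem ConnSet.exists_two_diff_singleton [Finite V] {Q : Set V} (hQ : ConnSet G Q) {r r' : V}
    (hr : r ∈ Q) (hr' : r' ∈ Q) (hne : r' ≠ r) :
    ∃ x ∈ Q, ∃ y ∈ Q, x ≠ y ∧ ConnSet G (Q \ {x}) ∧ ConnSet G (Q \ {y}) := by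
  obtain ⟨x, hx, hxr, hxQ⟩ := hQ.exists_diff_singleton hr hr' hne
  obtain ⟨y, hy, hyx, hyQ⟩ := hQ.exists_diff_singleton hx hr hxr.symm
  exact ⟨x, hx, y, hy, hyx.symm, hxQ, hyQ⟩

theorem TwoConnected.eq_top_of_triangle [Finite V] (hT : TwoConnected G) (hU : SplitFree G)
    {a b c : V} (hab : G.Adj a b) (hbc : G.Adj b c) (hac : G.Adj a c) : G = ⊤ := by
  obtain ⟨K, ⟨hK, hK3⟩, hmax⟩ := Set.Finite.exists_maximalFor Set.ncard
    {K : Set V | (∀ x ∈ K, ∀ y ∈ K, x ≠ y → G.Adj x y) ∧ 2 < K.ncard} (Set.toFinite _)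
    ⟨{a, b, c}, by
      constructor
      · rintro x (rfl | rfl | rfl) y (rfl | rfl | rfl) hxy
        all_goals first
          | exact absurd rfl hxy
          | assumption
          | (apply SimpleGraph.Adj.symm; assumption)
      · rw [Set.two_lt_ncard]
        exact ⟨a, by simp, b, by simp, c, by simp, hab.ne, hac.ne, hbc.ne⟩⟩
  by_cases hV : ∀ v, v ∈ K
  · ext x y
    exact ⟨fun h => h.ne, fun h => hK x (hV x) y (hV y) h⟩
  exfalso
  push Not at hV
  obtain ⟨v, hv⟩ := hV
  rw [Set.two_lt_ncard] at hK3
  obtain ⟨a, ha, b, hb, c, hc, hab, hac, hbc⟩ := hK3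
  obtain ⟨C, hC, hvC, hCK, hCcl⟩ := exists_component (G := G) (O := Kᶜ) (z := v) hv
  have htwo : ∃ x ∈ K, ∃ y ∈ K, x ≠ y ∧ Touches G {x} C ∧ Touches G {y} C := by
    by_contra! hcon
    obtain ⟨z, hz, hzt⟩ : ∃ z ∈ K, ∀ y ∈ K, Touches G {y} C → y = z := by
      by_cases h : ∃ z ∈ K, Touches G {z} C
      · obtain ⟨z, hz, hzt⟩ := h
        exact ⟨z, hz, fun y hy hyt => by_contra fun hne => hcon y hy z hz hne hyt hzt⟩
      · exact ⟨a, ha, fun y hy hyt => absurd ⟨y, hy, hyt⟩ h⟩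
    obtain ⟨w, hw, hwz⟩ : ∃ w ∈ K, w ≠ z := by
      by_cases h : a = z
      · exact ⟨b, hb, fun e => hab (h.trans e.symm)⟩
      · exact ⟨a, ha, h⟩
    refine hCK (hT.eq_compl hvC (fun h => hCK h hz) (fun x hx y hxy hyz => ?_) hwz) hw
    by_cases hyK : y ∈ K
    · exact absurd (hzt y hyK ⟨y, rfl, x, hx, hxy.symm⟩) hyz
    · exact hCcl x hx y hyK hxy
  obtain ⟨Q, ⟨hQ, hQK, x, hx, y, hy, hxy, hxQ, hyQ⟩, hmin⟩ :=
    Set.Finite.exists_minimalFor Set.ncard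
      {Q : Set V | ConnSet G Q ∧ Q ⊆ Kᶜ ∧
        ∃ x ∈ K, ∃ y ∈ K, x ≠ y ∧ Touches G {x} Q ∧ Touches G {y} Q} (Set.toFinite _)
      ⟨C, hC, hCK, htwo⟩
  have htouch : ∀ z ∈ K, Touches G {z} Q := by
    intro z hz
    by_cases hzx : z = x
    · exact hzx ▸ hxQ
    by_cases hzy : z = y
    · exact hzy ▸ hyQ
    exact hU x y {z} Q (hK x hx y hy hxy) (ConnSet.singleton z) hQ (Ne.symm hzx) (Ne.symm hzy)
      (fun h => hQK h hx) (fun h => hQK h hy)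
      (Set.disjoint_singleton_left.2 fun h => hQK h hz)
      ⟨x, rfl, z, rfl, hK x hx z hz (Ne.symm hzx)⟩ ⟨y, rfl, z, rfl, hK y hy z hz (Ne.symm hzy)⟩
      hxQ hyQ
  obtain ⟨r, hr⟩ := hQ.nonempty
  by_cases hr' : ∃ r' ∈ Q, r' ≠ r
  · obtain ⟨r', hr', hne⟩ := hr'
    obtain ⟨u, hu, w, hw, huw, hQu, hQw⟩ := hQ.exists_two_diff_singleton hr hr' hne
    have hone : ∀ u ∈ Q, ConnSet G (Q \ {u}) → ∀ x ∈ K, ∀ y ∈ K, Touches G {x} (Q \ {u}) →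
        Touches G {y} (Q \ {u}) → x = y := by
      intro u hu hQu x hx y hy hxu hyu
      by_contra hne
      have h1 := hmin (j := Q \ {u}) ⟨hQu, Set.sdiff_subset.trans hQK, x, hx, y, hy, hne, hxu, hyu⟩
      have h2 := Set.ncard_sdiff_singleton_lt_of_mem hu (Set.toFinite Q)
      have := h1 h2.le
      omega
    have hcov : ∀ z ∈ K, Touches G {z} (Q \ {u}) ∨ Touches G {z} (Q \ {w}) := by
      intro z hz
      obtain ⟨_, rfl, q, hq, hzq⟩ := htouch z hz
      by_cases hqu : q = u
      · exact Or.inr ⟨_, rfl, q, ⟨hq, fun e => huw (hqu.symm.trans e)⟩, hzq⟩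
      · exact Or.inl ⟨_, rfl, q, ⟨hq, hqu⟩, hzq⟩
    rcases hcov a ha with h1 | h1 <;> rcases hcov b hb with h2 | h2 <;>
      rcases hcov c hc with h3 | h3
    · exact hab (hone u hu hQu a ha b hb h1 h2)
    · exact hab (hone u hu hQu a ha b hb h1 h2)
    · exact hac (hone u hu hQu a ha c hc h1 h3)
    · exact hbc (hone w hw hQw b hb c hc h2 h3)
    · exact hbc (hone u hu hQu b hb c hc h2 h3)
    · exact hac (hone w hw hQw a ha c hc h1 h3)
    · exact hab (hone w hw hQw a ha b hb h1 h2)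
    · exact hab (hone w hw hQw a ha b hb h1 h2)
  · push Not at hr'
    have hadj : ∀ z ∈ K, G.Adj z r := by
      intro z hz
      obtain ⟨_, rfl, q, hq, hzq⟩ := htouch z hz
      exact hr' q hq ▸ hzq
    have hrK : r ∉ K := hQK hr
    have h2 : (insert r K).ncard = K.ncard + 1 := Set.ncard_insert_of_notMem hrK
    have h1 := hmax (j := insert r K) ⟨?_, ?_⟩
    · have := h1 (by omega)
      omega
    · rintro s (rfl | hs) t (rfl | ht) hst
      · exact absurd rfl hst
      · exact (hadj t ht).symm
      · exact hadj s hs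
      · exact hK s hs t ht hst
    · rw [h2]
      have : 2 < K.ncard := (Set.two_lt_ncard).2 ⟨a, ha, b, hb, c, hc, hab, hac, hbc⟩
      omega

end Triangle

section Cutset

variable {V : Type} {G : SimpleGraph V}

theorem Walk.exists_getVert_of_mem_edges {u v : V} (w : G.Walk u v) {e : Sym2 V}
    (he : e ∈ w.edges) : ∃ i < w.length, s(w.getVert i, w.getVert (i + 1)) = e := by
  induction w with
  | nil => simp at he
  | cons h w ih =>
    rw [Walk.edges_cons, List.mem_cons] at he
    rcases he with rfl | he
    · exact ⟨0, by simp, by simp⟩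
    · obtain ⟨i, hi, rfl⟩ := ih he
      exact ⟨i + 1, by simpa using hi, by simp⟩

theorem InducedIsPathGraph.exists_isArc {X : Set V} {a b : V} (hab : a ≠ b)
    (hnadj : ¬ G.Adj a b) (haX : a ∉ X) (hbX : b ∉ X)
    (h : InducedIsPathGraph G (X ∪ {a, b}) a b) : ∃ n p, IsArc G X a b n p := by
  obtain ⟨w, hw, hmem, hedge⟩ := h
  have hinj : ∀ i j, i ≤ w.length → j ≤ w.length → w.getVert i = w.getVert j → i = j :=
    fun i j hi hj => hw.getVert_injOn hi hj
  have hlen : 2 ≤ w.length := by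
    by_contra hlt
    have h0 : w.length ≠ 0 := fun h => hab (Walk.eq_of_length_eq_zero h)
    have h1 : w.length = 1 := by omega
    have := w.adj_getVert_succ (i := 0) (by omega)
    rw [w.getVert_zero, zero_add, ← h1, w.getVert_length] at this
    exact hnadj this
  refine ⟨w.length - 1, w.getVert, by omega, w.getVert_zero, ?_, fun x => ?_, ?_, ?_, ?_⟩
  · rw [Nat.sub_add_cancel (by omega), w.getVert_length]
  · constructor
    · intro hx
      obtain ⟨i, hi, hil⟩ := Walk.mem_support_iff_exists_getVert.1 ((hmem x).1 (Or.inl hx))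
      have hi0 : i ≠ 0 := by
        rintro rfl
        rw [w.getVert_zero] at hi
        exact haX (hi ▸ hx)
      have hil' : i ≠ w.length := by
        rintro rfl
        rw [w.getVert_length] at hi
        exact hbX (hi ▸ hx)
      exact ⟨i, by omega, by omega, hi⟩
    · rintro ⟨i, h1, h2, rfl⟩
      rcases (hmem _).2 (w.getVert_mem_support i) with h | h | h
      · exact h
      · have := hinj i 0 (by omega) (by omega) (by rw [h, w.getVert_zero])
        omega
      · have := hinj i w.length (by omega) (by omega) (by rw [w.getVert_length]; exact h)
        omega
  · exact fun i j hi hj => hinj i j (by omega) (by omega)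
  · exact fun i hi => w.adj_getVert_succ (by omega)
  · intro i j hij hj hadj
    obtain ⟨k, hk, he⟩ := Walk.exists_getVert_of_mem_edges w
      (hedge _ _ ((hmem _).2 (w.getVert_mem_support i)) ((hmem _).2 (w.getVert_mem_support j)) hadj)
    left
    rcases Sym2.eq_iff.1 he with ⟨h1, h2⟩ | ⟨h1, h2⟩
    · have := hinj _ _ (by omega) (by omega) h1
      have := hinj _ _ (by omega) (by omega) h2
      omega
    · have := hinj _ _ (by omega) (by omega) h1
      have := hinj _ _ (by omega) (by omega) h2
      omega

theorem TwoConnected.containsPathBetween (hT : TwoConnected G) {X : Set V} {a b : V}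
    (hab : a ≠ b) (haX : a ∉ X) (hbX : b ∉ X) (hX : X.Nonempty)
    (hcl : ∀ x ∈ X, ∀ y, G.Adj x y → y ∈ X ∨ y = a ∨ y = b) :
    ContainsPathBetween G (X ∪ {a, b}) a b := by
  obtain ⟨x, hx⟩ := hX
  obtain ⟨K, hK, hxK, hKX, hKcl⟩ := exists_component (G := G) hx
  have htouch : ∀ a b, a ≠ b → a ∉ X → b ∉ X →
      (∀ x ∈ X, ∀ y, G.Adj x y → y ∈ X ∨ y = a ∨ y = b) → Touches G {a} K := by
    intro a b hab haX hbX hcl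
    by_contra hcon
    refine haX (hKX (hT.eq_compl hxK (fun h => hbX (hKX h)) (fun x hx y hxy hyb => ?_) hab))
    rcases hcl x (hKX hx) y hxy with h | rfl | rfl
    · exact hKcl x hx y h hxy
    · exact absurd ⟨y, rfl, x, hx, hxy.symm⟩ hcon
    · exact absurd rfl hyb
  obtain ⟨D, hDK, n, p, hp⟩ := hK.exists_isArc (fun h => haX (hKX h)) (fun h => hbX (hKX h)) hab
    (htouch a b hab haX hbX hcl)
    (htouch b a hab.symm hbX haX fun x hx y hxy => (hcl x hx y hxy).imp_right Or.symm)
  obtain ⟨w, hw, -⟩ := exists_walk_of_steps p (n + 1) fun i hi => hp.step i (by omega)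
  have hpath : w.IsPath := by
    rw [Walk.isPath_def, hw]
    refine List.Nodup.map_on ?_ List.nodup_range
    intro i hi j hj hij
    rw [List.mem_range] at hi hj
    exact hp.inj i j (by omega) (by omega) hij
  refine ⟨w.copy hp.zero hp.last, by simpa using hpath, ?_⟩
  intro v hv
  rw [Walk.support_copy, hw, List.mem_map] at hv
  obtain ⟨i, hi, rfl⟩ := hv
  rw [List.mem_range] at hi
  rcases Nat.eq_zero_or_pos i with rfl | h0
  · exact Or.inr (Or.inl hp.zero)
  · rcases Nat.lt_or_ge n i with h1 | h1
    · rw [show i = n + 1 by omega]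
      exact Or.inr (Or.inr hp.last)
    · exact Or.inl (hKX (hDK (hp.mem h0 h1)))

/-- One side of a 2-cutset that is not proper is an arc. -/
theorem TwoConnected.exists_isArc_or (hT : TwoConnected G) (hC : ¬ HasProper2Cutset G)
    {a b : V} {X Y : Set V} (hab : a ≠ b) (hnadj : ¬ G.Adj a b)
    (hcover : ∀ v, v ∈ X ∨ v ∈ Y ∨ v = a ∨ v = b) (hdisj : Disjoint X Y)
    (haX : a ∉ X) (haY : a ∉ Y) (hbX : b ∉ X) (hbY : b ∉ Y) (hX : 2 ≤ X.ncard)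
    (hY : 2 ≤ Y.ncard) (hsep : ∀ x ∈ X, ∀ y ∈ Y, ¬ G.Adj x y) :
    (∃ n p, IsArc G X a b n p) ∨ ∃ n p, IsArc G Y a b n p := by
  by_contra! hcon
  refine hC ⟨a, b, X, Y, hab, hnadj, hcover, hdisj, haX, haY, hbX, hbY, hX, hY, hsep,
    ?_, fun h => ?_, ?_, fun h => ?_⟩
  · refine hT.containsPathBetween hab haX hbX (Set.nonempty_of_ncard_ne_zero (by omega)) ?_
    intro x hx y hxy
    rcases hcover y with h | h | h
    · exact Or.inl h
    · exact absurd hxy (hsep x hx y h)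
    · exact Or.inr h
  · obtain ⟨n, p, hp⟩ := h.exists_isArc hab hnadj haX hbX
    exact hcon.1 n p hp
  · refine hT.containsPathBetween hab haY hbY (Set.nonempty_of_ncard_ne_zero (by omega)) ?_
    intro x hx y hxy
    rcases hcover y with h | h | h
    · exact absurd hxy.symm (hsep y h x hx)
    · exact Or.inl h
    · exact Or.inr h
  · obtain ⟨n, p, hp⟩ := h.exists_isArc hab hnadj haY hbY
    exact hcon.2 n p hp

end Cutset

section Bicycle

variable {V : Type} {G : SimpleGraph V}

theorem ConnSet.union_of_mem {A B : Set V} (hA : ConnSet G A) (hB : ConnSet G B) {x : V}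
    (hxA : x ∈ A) (hxB : x ∈ B) : ConnSet G (A ∪ B) := by
  refine ⟨⟨x, Or.inl hxA⟩, fun X hX hcl => ?_⟩
  have key : ∀ C ⊆ A ∪ B, ConnSet G C → (∃ x ∈ C, x ∈ X) → C ⊆ X := fun C hCA hC hx =>
    hC.subset_of_closed X hx fun x hxC hxX y hy hxy => hcl x (hCA hxC) hxX y (hCA hy) hxy
  have hxX : x ∈ X := by
    obtain ⟨y, hy | hy, hyX⟩ := hX
    · exact key A Set.subset_union_left hA ⟨y, hy, hyX⟩ hxA
    · exact key B Set.subset_union_right hB ⟨y, hy, hyX⟩ hxB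
  exact Set.union_subset (key A Set.subset_union_left hA ⟨x, hxA, hxX⟩)
    (key B Set.subset_union_right hB ⟨x, hxB, hxX⟩)

theorem exists_adj_ne_ne [Finite V] {u : V} (h : 3 ≤ (G.neighborSet u).ncard) (x y : V) :
    ∃ z, G.Adj u z ∧ z ≠ x ∧ z ≠ y := by
  by_contra! hcon
  have hsub : G.neighborSet u ⊆ {x, y} := fun z hz => by
    by_cases hzx : z = x
    · exact Or.inl hzx
    · exact Or.inr (hcon z hz hzx)
  have := Set.ncard_le_ncard hsub (Set.toFinite _)
  have := Set.ncard_insert_le x {y}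
  rw [Set.ncard_singleton] at this
  omega

theorem IsArc.adj_iff {D : Set V} {s t : V} {n : ℕ} {p : ℕ → V} (h : IsArc G D s t n p)
    {i j : ℕ} (h1 : 1 ≤ i) (h2 : i ≤ n) (hj : j ≤ n + 1) :
    G.Adj (p i) (p j) ↔ j = i + 1 ∨ j + 1 = i := by
  constructor
  · intro hadj
    rcases Nat.lt_trichotomy i j with hij | rfl | hij
    · have := h.adj i j hij hj hadj
      omega
    · exact absurd hadj (G.loopless.irrefl _)
    · have := h.adj j i hij (by omega) hadj.symm
      omega
  · rintro (rfl | rfl)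
    · exact h.step i h2
    · exact (h.step j (by omega)).symm

private theorem exists_adj_of_cut_aux [Finite V] (hT : TwoConnected G)
    (hC : ¬ HasProper2Cutset G) {u v w : V}
    (hu : 3 ≤ (G.neighborSet u).ncard) (hv : 3 ≤ (G.neighborSet v).ncard)
    (hwu : w ≠ u) (hwv : w ≠ v) (hadj : ¬ G.Adj w u) {K : Set V} (huK : u ∈ K) (hvK : v ∉ K)
    (hwK : w ∉ K) : ∃ x ∈ K, ∃ y, y ∉ K ∧ y ≠ w ∧ G.Adj x y ∧ ¬ (x = u ∧ y = v) := by
  by_contra! hcon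
  have hunbr : ∀ z, G.Adj u z → z ≠ v → z ∈ K := by
    intro z hz hzv
    by_contra hzK
    exact hzv (hcon u huK z hzK (fun e => hadj (e ▸ hz.symm)) hz).2
  have hX : 2 ≤ (K \ {u}).ncard := by
    obtain ⟨z₁, h1, h1v, -⟩ := exists_adj_ne_ne hu v v
    obtain ⟨z₂, h2, h2v, h12⟩ := exists_adj_ne_ne hu v z₁
    exact (Set.one_lt_ncard (Set.toFinite _)).2 ⟨z₁, ⟨hunbr _ h1 h1v, h1.ne.symm⟩,
      z₂, ⟨hunbr _ h2 h2v, h2.ne.symm⟩, h12.symm⟩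
  have hY : 2 ≤ (Kᶜ \ {w}).ncard := by
    obtain ⟨z, h1, h1u, h1w⟩ := exists_adj_ne_ne hv u w
    refine (Set.one_lt_ncard (Set.toFinite _)).2 ⟨v, ⟨hvK, hwv.symm⟩, z, ⟨fun hzK => ?_, h1w⟩,
      h1.ne⟩
    exact h1u (hcon z hzK v hvK hwv.symm h1.symm).1
  rcases hT.exists_isArc_or hC (a := w) (b := u) (X := K \ {u}) (Y := Kᶜ \ {w}) hwu hadj
    (fun x => by
      by_cases h1 : x ∈ K <;> by_cases h2 : x = u <;> by_cases h3 : x = w <;> simp_all)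
    (Set.disjoint_left.2 fun x hx hx' => hx'.1 hx.1) (fun h => hwK h.1) (fun h => h.2 rfl)
    (fun h => h.2 rfl) (fun h => h.1 huK) hX hY
    (fun x hx y hy hxy => hx.2 (hcon x hx.1 y hy.1 hy.2 hxy).1) with ⟨n, p, hp⟩ | ⟨n, p, hp⟩
  · obtain ⟨z, h1, hzv, hzn⟩ := exists_adj_ne_ne hu v (p n)
    obtain ⟨i, hi, hin, rfl⟩ := (hp.mem_iff z).1 ⟨hunbr z h1 hzv, h1.ne.symm⟩
    exact hzn (by rw [(hp.adj_last_iff hi hin).1 h1])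
  · obtain ⟨i, hi, hin, hiv⟩ := (hp.mem_iff v).1 ⟨hvK, hwv.symm⟩
    obtain ⟨z, h1, hz1, hz2⟩ := exists_adj_ne_ne hv (p (i + 1)) (p (i - 1))
    obtain ⟨j, hj, rfl⟩ : ∃ j, j ≤ n + 1 ∧ p j = z := by
      by_cases hzK : z ∈ K
      · exact ⟨n + 1, le_rfl, hp.last.trans (hcon z hzK v hvK hwv.symm h1.symm).1.symm⟩
      by_cases hzw : z = w
      · exact ⟨0, by omega, hp.zero.trans hzw.symm⟩
      · obtain ⟨j, -, hj, rfl⟩ := (hp.mem_iff z).1 ⟨hzK, hzw⟩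
        exact ⟨j, by omega, rfl⟩
    rw [← hiv, hp.adj_iff hi hin hj] at h1
    rcases h1 with rfl | rfl
    · exact hz1 rfl
    · exact hz2 (by rw [Nat.add_sub_cancel])

/-- Deleting a vertex `w` and an edge `uv` between vertices of degree at least 3 does not separate
`u` from `v`. -/
theorem exists_adj_of_cut [Finite V] (hT : TwoConnected G) (hC : ¬ HasProper2Cutset G)
    {u v w : V} (hu : 3 ≤ (G.neighborSet u).ncard)
    (hv : 3 ≤ (G.neighborSet v).ncard) (hwu : w ≠ u) (hwv : w ≠ v)
    (htri : ¬ (G.Adj w u ∧ G.Adj w v)) {K : Set V} (huK : u ∈ K) (hvK : v ∉ K) (hwK : w ∉ K) :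
    ∃ x ∈ K, ∃ y, y ∉ K ∧ y ≠ w ∧ G.Adj x y ∧ ¬ (x = u ∧ y = v) := by
  by_cases hwu' : G.Adj w u
  · obtain ⟨x, ⟨hxK, hxw⟩, y, hy, hyw, hxy, hne⟩ := exists_adj_of_cut_aux hT hC hv hu hwv
      hwu (fun h => htri ⟨hwu', h⟩) (K := Kᶜ \ {w}) ⟨hvK, hwv.symm⟩ (fun h => h.1 huK)
      (fun h => h.2 rfl)
    refine ⟨y, by_contra fun h => hy ⟨h, hyw⟩, x, hxK, hxw, hxy.symm, fun h => hne h.symm⟩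
  · exact exists_adj_of_cut_aux hT hC hu hv hwu hwv hwu' huK hvK hwK

end Bicycle

section Bicycle

variable {V : Type} {G : SimpleGraph V}

/-- A connected set attached to an initial segment of an arc, together with a part of that
segment, is attached to the start of the arc. -/
theorem IsArc.exists_connSet_start {A D : Set V} {u v : V} {n : ℕ} {p : ℕ → V}
    (h : IsArc G A u v n p) (hD : ConnSet G D) {j : ℕ} (hj : j ≤ n)
    (hX : Touches G (p '' Set.Icc 0 j) D) :
    ∃ S, ConnSet G S ∧ D ⊆ S ∧ S ⊆ D ∪ p '' Set.Icc 1 j ∧ Touches G {u} S := by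
  obtain ⟨k, -, hk, d, hd, hkd⟩ := touches_image_iff.1 hX
  rcases Nat.eq_zero_or_pos k with rfl | hk0
  · exact ⟨D, hD, subset_rfl, Set.subset_union_left, u, rfl, d, hd, h.zero ▸ hkd⟩
  · refine ⟨D ∪ p '' Set.Icc 1 j, hD.union (h.connSet_image (by omega) (by omega))
      ⟨d, hd, p k, ⟨k, ⟨hk0, hk⟩, rfl⟩, hkd.symm⟩, Set.subset_union_left, subset_rfl,
      u, rfl, p 1, Or.inr ⟨1, ⟨le_rfl, by omega⟩, rfl⟩, ?_⟩
    have := h.step 0 (by omega)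
    rwa [h.zero] at this

theorem IsArc.exists_reroute {A D : Set V} {u v : V} {n : ℕ} {p : ℕ → V}
    (h : IsArc G A u v n p) (hD : ConnSet G D) {j : ℕ} (h1 : 1 ≤ j) (hj : j ≤ n)
    (huD : u ∉ D) (hvD : v ∉ D)
    (hX : Touches G (p '' Set.Icc 0 (j - 1)) D)
    (hY : Touches G (p '' Set.Icc (j + 1) (n + 1)) D) :
    ∃ A' ⊆ D ∪ A \ {p j}, ∃ m q, IsArc G A' u v m q := by
  have hsub : ∀ i k, 1 ≤ i → k ≤ n → (j < i ∨ k < j) → p '' Set.Icc i k ⊆ A \ {p j} := by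
    rintro i k hi hk hij _ ⟨l, ⟨h2, h3⟩, rfl⟩
    refine ⟨h.mem (by omega) (by omega), fun e => ?_⟩
    have := h.inj l j (by omega) (by omega) e
    omega
  obtain ⟨S, hS, hDS, hSD, huS⟩ := h.exists_connSet_start hD (by omega) hX
  have hY' : Touches G ((fun i => p (n + 1 - i)) '' Set.Icc 0 (n - j)) S := by
    refine hY.mono ?_ hDS
    rintro _ ⟨l, ⟨h2, h3⟩, rfl⟩
    exact ⟨n + 1 - l, ⟨by omega, by omega⟩, by simp only [show n + 1 - (n + 1 - l) = l by omega]⟩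
  obtain ⟨S', hS', hSS', hS'S, hvS'⟩ := h.reverse.exists_connSet_start hS (by omega) hY'
  have hS'sub : S' ⊆ D ∪ A \ {p j} := by
    refine hS'S.trans (Set.union_subset (hSD.trans (Set.union_subset_union_right _
      (hsub 1 (j - 1) le_rfl (by omega) (by omega)))) (Set.subset_union_of_subset_right ?_ _))
    refine subset_trans ?_ (hsub (j + 1) n (by omega) le_rfl (by omega))
    rintro _ ⟨l, ⟨h2, h3⟩, rfl⟩
    exact ⟨n + 1 - l, ⟨by omega, by omega⟩, rfl⟩
  have hnot : ∀ x, x ∉ D → x ∉ A → x ∉ S' := fun x h1 h2 h3 =>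
    (hS'sub h3).elim h1 fun h => h2 h.1
  obtain ⟨A', hA', m, q, hq⟩ := hS'.exists_isArc (hnot u huD h.start_notMem)
    (hnot v hvD h.last_notMem) h.ne (huS.mono subset_rfl hSS') hvS'
  exact ⟨A', hA'.trans hS'sub, m, q, hq⟩

/-- An edge between two vertices of degree at least 3 is a common chord of two paths. -/
theorem exists_two_connSets [Finite V] (hT : TwoConnected G)
    (hC : ¬ HasProper2Cutset G) (hTF : ∀ a b c, G.Adj a b → G.Adj b c → ¬ G.Adj a c)
    {u v : V} (huv : G.Adj u v) (hu : 3 ≤ (G.neighborSet u).ncard)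
    (hv : 3 ≤ (G.neighborSet v).ncard) :
    ∃ A B, ConnSet G A ∧ ConnSet G B ∧ u ∉ A ∧ v ∉ A ∧ u ∉ B ∧ v ∉ B ∧ Disjoint A B ∧
      Touches G {u} A ∧ Touches G {v} A ∧ Touches G {u} B ∧ Touches G {v} B := by
  have hstart : ∃ A, ∃ n p, IsArc G A u v n p ∧ ∃ B, ConnSet G B ∧ u ∉ B ∧ v ∉ B ∧
      Disjoint A B ∧ Touches G {u} B := by
    obtain ⟨z, huz, hzv, -⟩ := exists_adj_ne_ne hu v v
    obtain ⟨K, hK, hzK, hKO, hKcl⟩ := exists_component (G := G) (O := {u, v}ᶜ) (z := z)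
      (by rintro (h | h); exacts [huz.ne h.symm, hzv h])
    have huK : u ∉ K := fun h => hKO h (Or.inl rfl)
    have hvK : v ∉ K := fun h => hKO h (Or.inr rfl)
    have hvt : Touches G {v} K := by
      by_contra hcon
      refine hvK (hT.eq_compl hzK huK (fun x hx y hxy hyu => ?_) huv.ne.symm)
      refine hKcl x hx y ?_ hxy
      rintro (h | h)
      · exact hyu h
      · exact hcon ⟨v, rfl, x, hx, by rw [← show y = v from h]; exact hxy.symm⟩
    obtain ⟨A, -, n, p, hp⟩ := hK.exists_isArc huK hvK huv.ne ⟨u, rfl, z, hzK, huz⟩ hvt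
    obtain ⟨b, hub, hbv, hbp⟩ := exists_adj_ne_ne hu v (p 1)
    refine ⟨A, n, p, hp, {b}, ConnSet.singleton b, hub.ne, fun h => hbv h.symm,
      Set.disjoint_singleton_right.2 fun hb => ?_, u, rfl, b, rfl, hub⟩
    obtain ⟨i, h1, h2, rfl⟩ := (hp.mem_iff b).1 hb
    rw [hp.adj_start_iff h1 h2] at hub
    exact hbp (by rw [hub])
  obtain ⟨B, ⟨A, n, p, hp, hB, huB, hvB, hAB, huB'⟩, hmax⟩ := Set.Finite.exists_maximalFor
    Set.ncard {B : Set V | ∃ A n p, IsArc G A u v n p ∧ ConnSet G B ∧ u ∉ B ∧ v ∉ B ∧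
      Disjoint A B ∧ Touches G {u} B} (Set.toFinite _)
    (by obtain ⟨A, n, p, hp, B, h⟩ := hstart; exact ⟨B, A, n, p, hp, h⟩)
  have huA := hp.start_notMem
  have hvA := hp.last_notMem
  have hgrow : ∀ A' m q, IsArc G A' u v m q → ∀ x, x ∉ B → x ≠ u → x ≠ v → Touches G {x} B →
      Disjoint A' (insert x B) → False := by
    intro A' m q hq x hxB hxu hxv hx hdis
    have h1 := hmax (j := insert x B) ⟨A', m, q, hq, hB.insert hx,
      by rintro (h | h); exacts [hxu h.symm, huB h], by rintro (h | h); exacts [hxv h.symm, hvB h],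
      hdis, huB'.mono subset_rfl (Set.subset_insert x B)⟩
    have h2 : (insert x B).ncard = B.ncard + 1 := Set.ncard_insert_of_notMem hxB
    have := h1 (by omega)
    omega
  have hpu : ∀ i, 1 ≤ i → i ≤ n → p i ≠ u := fun i h1 h2 h => huA (h ▸ hp.mem h1 h2)
  have hpv : ∀ i, 1 ≤ i → i ≤ n → p i ≠ v := fun i h1 h2 h => hvA (h ▸ hp.mem h1 h2)
  have hout : ∀ x ∈ B, ∀ y, G.Adj x y → y ∉ A → y ≠ u → y ≠ v → y ∈ B := by
    intro x hx y hxy hyA hyu hyv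
    by_contra hyB
    exact hgrow A n p hp y hyB hyu hyv ⟨y, rfl, x, hx, hxy.symm⟩
      (Set.disjoint_insert_right.2 ⟨hyA, hAB⟩)
  by_cases hvB' : Touches G {v} B
  · refine ⟨A, B, hp.connSet, hB, huA, hvA, huB, hvB, hAB, ?_, ?_, huB', hvB'⟩
    · exact ⟨u, rfl, p 1, hp.mem le_rfl hp.pos, (hp.adj_start_iff le_rfl hp.pos).2 rfl⟩
    · exact ⟨v, rfl, p n, hp.mem hp.pos le_rfl, (hp.adj_last_iff hp.pos le_rfl).2 rfl⟩
  exfalso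
  -- the last vertex of the arc with a neighbour in `B`
  obtain ⟨j, ⟨hj1, hjn, hjB⟩, hjmax⟩ : ∃ j, (1 ≤ j ∧ j ≤ n ∧ Touches G {p j} B) ∧
      ∀ k, 1 ≤ k → k ≤ n → Touches G {p k} B → k ≤ j := by
    have hne : ∃ j, 1 ≤ j ∧ j ≤ n ∧ Touches G {p j} B := by
      by_contra! hcon
      obtain ⟨b, hb⟩ := hB.nonempty
      refine hvB (hT.eq_compl hb huB (fun x hx y hxy hyu => ?_) huv.ne.symm)
      refine hout x hx y hxy (fun hyA => ?_) hyu ?_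
      · obtain ⟨i, h1, h2, rfl⟩ := (hp.mem_iff y).1 hyA
        exact hcon i h1 h2 ⟨_, rfl, x, hx, hxy.symm⟩
      · rintro rfl
        exact hvB' ⟨_, rfl, x, hx, hxy.symm⟩
    obtain ⟨j, hj, hmax⟩ := Set.Finite.exists_maximalFor id
      {j | 1 ≤ j ∧ j ≤ n ∧ Touches G {p j} B} ((Set.finite_Iic n).subset fun j h => h.2.1) hne
    exact ⟨j, hj, fun k h1 h2 h3 => by
      by_contra hlt
      exact hlt (hmax (j := k) ⟨h1, h2, h3⟩ (by simp only [id]; omega))⟩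
  set X : Set V := p '' Set.Icc 0 (j - 1) with hX
  set Y : Set V := p '' Set.Icc (j + 1) (n + 1) with hY
  let O : Set V := {x | x ∉ A ∧ x ≠ u ∧ x ≠ v}
  have hcases : ∀ y, y ∈ X ∨ y = p j ∨ y ∈ Y ∨ y ∈ O := by
    intro y
    by_cases hyO : y ∈ O
    · exact Or.inr (Or.inr (Or.inr hyO))
    obtain ⟨i, hi, rfl⟩ : ∃ i, i ≤ n + 1 ∧ p i = y := by
      by_cases hyA : y ∈ A
      · obtain ⟨i, -, h2, h3⟩ := (hp.mem_iff y).1 hyA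
        exact ⟨i, by omega, h3⟩
      by_cases hyu : y = u
      · exact ⟨0, by omega, hp.zero.trans hyu.symm⟩
      by_cases hyv : y = v
      · exact ⟨n + 1, le_rfl, hp.last.trans hyv.symm⟩
      exact absurd ⟨hyA, hyu, hyv⟩ hyO
    rcases Nat.lt_trichotomy i j with h | rfl | h
    · exact Or.inl ⟨i, ⟨by omega, by omega⟩, rfl⟩
    · exact Or.inr (Or.inl rfl)
    · exact Or.inr (Or.inr (Or.inl ⟨i, ⟨h, hi⟩, rfl⟩))
  have hnotO : ∀ i, i ≤ n + 1 → p i ∉ O := by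
    rintro i hi ⟨h1, h2, h3⟩
    rcases Nat.eq_zero_or_pos i with rfl | h0
    · exact h2 hp.zero
    rcases Nat.lt_or_ge n i with h | h
    · exact h3 (by rw [show i = n + 1 by omega, hp.last])
    · exact h1 (hp.mem h0 h)
  have hXO : ∀ x ∈ X, x ∉ O := by
    rintro _ ⟨i, ⟨-, hi⟩, rfl⟩
    exact hnotO i (by omega)
  have hYO : ∀ x ∈ Y, x ∉ O := by
    rintro _ ⟨i, ⟨-, hi⟩, rfl⟩
    exact hnotO i (by omega)
  have hXY : ∀ x ∈ X, x ∉ Y := by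
    rintro _ ⟨i, ⟨-, hi⟩, rfl⟩ ⟨k, ⟨hk, hk'⟩, he⟩
    have := hp.inj k i hk' (by omega) he
    omega
  have hBO : B ⊆ O := fun x hx => ⟨Set.disjoint_right.1 hAB hx, fun h => huB (h ▸ hx),
    fun h => hvB (h ▸ hx)⟩
  have hBY : ¬ Touches G B Y := by
    rintro ⟨b, hb, _, ⟨k, ⟨hk, hk'⟩, rfl⟩, hbk⟩
    rcases Nat.lt_or_ge n k with h | h
    · rw [show k = n + 1 by omega, hp.last] at hbk
      exact hvB' ⟨_, rfl, b, hb, hbk.symm⟩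
    · have := hjmax k (by omega) h ⟨_, rfl, b, hb, hbk.symm⟩
      omega
  obtain ⟨D, hD, hDO, hDcl, hDX, hDY⟩ : ∃ D, ConnSet G D ∧ D ⊆ O ∧
      (∀ x ∈ D, ∀ y ∈ O, G.Adj x y → y ∈ D) ∧ Touches G X D ∧ Touches G Y D := by
    let K : Set V := X ∪ {x | ∃ C, ConnSet G C ∧ x ∈ C ∧ C ⊆ O ∧
      (∀ x ∈ C, ∀ y ∈ O, G.Adj x y → y ∈ C) ∧ ¬ Touches G Y C}
    have huX : u ∈ X := ⟨0, ⟨le_rfl, by omega⟩, hp.zero⟩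
    have hvY : v ∈ Y := ⟨n + 1, ⟨by omega, le_rfl⟩, hp.last⟩
    obtain ⟨x, hx, y, hyK, hyj, hxy, hne⟩ := exists_adj_of_cut hT hC hu hv (hpu j hj1 hjn)
      (hpv j hj1 hjn) (fun h => hTF _ _ _ h.1 huv h.2) (K := K) (Or.inl huX)
      (by
        rintro (h | ⟨C, -, hvC, hCO, -⟩)
        · exact hXY v h hvY
        · exact (hCO hvC).2.2 rfl)
      (by
        rintro (⟨i, ⟨-, hi⟩, he⟩ | ⟨C, -, hC, hCO, -⟩)
        · have := hp.inj i j (by omega) (by omega) he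
          omega
        · exact hnotO j (by omega) (hCO hC))
    rcases hx with hx | ⟨C, hC, hxC, hCO, hCcl, hCY⟩
    · rcases hcases y with h | h | h | h
      · exact absurd (Or.inl h) hyK
      · exact absurd h hyj
      · exfalso
        obtain ⟨i, ⟨-, hi⟩, rfl⟩ := hx
        obtain ⟨k, ⟨hk, hk'⟩, rfl⟩ := h
        rcases hp.adj i k (by omega) hk' hxy with h | ⟨rfl, rfl⟩
        · omega
        · exact hne ⟨hp.zero, hp.last⟩
      · obtain ⟨D, hD, hyD, hDO, hDcl⟩ := exists_component (G := G) h
        exact ⟨D, hD, hDO, hDcl, ⟨x, hx, y, hyD, hxy⟩, by_contra fun hDY =>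
          hyK (Or.inr ⟨D, hD, hyD, hDO, hDcl, hDY⟩)⟩
    · rcases hcases y with h | h | h | h
      · exact absurd (Or.inl h) hyK
      · exact absurd h hyj
      · exact absurd ⟨y, h, x, hxC, hxy.symm⟩ hCY
      · exact absurd (Or.inr ⟨C, hC, hCcl x hxC y h hxy, hCO, hCcl, hCY⟩) hyK
  have hDB : Disjoint D B := by
    rw [Set.disjoint_left]
    intro x hxD hxB
    have hBD : D ⊆ B := hD.subset_of_closed B ⟨x, hxD, hxB⟩ fun x _ hxB y hy hxy =>
      hout x hxB y hxy (hDO hy).1 (hDO hy).2.1 (hDO hy).2.2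
    exact hBY (hDY.symm.mono hBD subset_rfl)
  obtain ⟨A', hA', m, q, hq⟩ := hp.exists_reroute hD hj1 hjn (fun h => (hDO h).2.1 rfl)
    (fun h => (hDO h).2.2 rfl) hDX hDY
  refine hgrow A' m q hq (p j) (Set.disjoint_left.1 hAB (hp.mem hj1 hjn)) (hpu j hj1 hjn)
    (hpv j hj1 hjn) hjB (Set.disjoint_left.2 fun x hx hx' => ?_)
  rcases hA' hx with h | h
  · rcases hx' with rfl | hx'
    · exact hnotO j (by omega) (hDO h)
    · exact Set.disjoint_left.1 hDB h hx'
  · rcases hx' with rfl | hx'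
    · exact h.2 rfl
    · exact Set.disjoint_left.1 hAB h.1 hx'

end Bicycle

section Bicycle

variable {V : Type} {G : SimpleGraph V}

/-- An edge `uv` with two disjoint connected sets attached to both of its ends. -/
structure IsTheta (G : SimpleGraph V) (u v : V) (A B : Set V) : Prop where
  adj : G.Adj u v
  connA : ConnSet G A
  connB : ConnSet G B
  uA : u ∉ A
  vA : v ∉ A
  uB : u ∉ B
  vB : v ∉ B
  disj : Disjoint A B
  touch_uA : Touches G {u} A
  touch_vA : Touches G {v} A
  touch_uB : Touches G {u} B
  touch_vB : Touches G {v} B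

/-- A smallest theta, whose two sets are arcs. -/
structure IsMinTheta (G : SimpleGraph V) (u v : V) (A B : Set V) (n m : ℕ) (p q : ℕ → V) :
    Prop where
  adj : G.Adj u v
  arcA : IsArc G A u v n p
  arcB : IsArc G B u v m q
  disj : Disjoint A B
  min : ∀ x y A' B', IsTheta G x y A' B' → n + m ≤ A'.ncard + B'.ncard

theorem IsTheta.exists_isMinTheta [Finite V] {u v : V} {A B : Set V} (h : IsTheta G u v A B) :
    ∃ u v A B n m p q, IsMinTheta G u v A B n m p q := by
  obtain ⟨⟨⟨u, v⟩, A, B⟩, h, hmin⟩ := Set.Finite.exists_minimalFor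
    (fun T : (V × V) × Set V × Set V => T.2.1.ncard + T.2.2.ncard)
    {T | IsTheta G T.1.1 T.1.2 T.2.1 T.2.2} (Set.toFinite _) ⟨⟨⟨u, v⟩, A, B⟩, h⟩
  have hmin' : ∀ x y A' B', IsTheta G x y A' B' → A.ncard + B.ncard ≤ A'.ncard + B'.ncard := by
    intro x y A' B' h'
    have h1 := hmin (j := ⟨⟨x, y⟩, A', B'⟩) h'
    simp only at h1
    omega
  simp only [Set.mem_ofPred_eq] at h
  obtain ⟨A', hA', n, p, hp⟩ := h.connA.exists_isArc h.uA h.vA h.adj.ne h.touch_uA h.touch_vA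
  obtain ⟨B', hB', m, q, hq⟩ := h.connB.exists_isArc h.uB h.vB h.adj.ne h.touch_uB h.touch_vB
  refine ⟨u, v, A', B', n, m, p, q, h.adj, hp, hq, h.disj.mono hA' hB', fun x y A'' B'' h' => ?_⟩
  have := hmin' x y A'' B'' h'
  have := Set.ncard_le_ncard hA' (Set.toFinite _)
  have := Set.ncard_le_ncard hB' (Set.toFinite _)
  have := hp.ncard_eq
  have := hq.ncard_eq
  omega

namespace IsMinTheta

variable {u v : V} {A B : Set V} {n m : ℕ} {p q : ℕ → V}

theorem swap (h : IsMinTheta G u v A B n m p q) : IsMinTheta G u v B A m n q p :=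
  ⟨h.adj, h.arcB, h.arcA, h.disj.symm, fun x y A' B' h' => by
    have := h.min x y A' B' h'
    omega⟩

theorem reverse (h : IsMinTheta G u v A B n m p q) :
    IsMinTheta G v u A B n m (fun i => p (n + 1 - i)) (fun i => q (m + 1 - i)) :=
  ⟨h.adj.symm, h.arcA.reverse, h.arcB.reverse, h.disj, h.min⟩

theorem ne (h : IsMinTheta G u v A B n m p q) {k l : ℕ} (hk : k ≤ n + 1) (h1 : 1 ≤ l)
    (h2 : l ≤ m) : p k ≠ q l := by
  intro e
  rcases Nat.eq_zero_or_pos k with rfl | h0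
  · exact h.arcB.start_notMem (h.arcA.zero ▸ e ▸ h.arcB.mem h1 h2)
  rcases Nat.lt_or_ge n k with h3 | h3
  · obtain rfl : k = n + 1 := by omega
    exact h.arcB.last_notMem (h.arcA.last ▸ e ▸ h.arcB.mem h1 h2)
  · exact Set.disjoint_left.1 h.disj (h.arcA.mem h0 h3) (e ▸ h.arcB.mem h1 h2)

theorem notMem_image (h : IsMinTheta G u v A B n m p q) {i a b : ℕ} (hi : i ≤ n + 1)
    (hb : b ≤ n + 1) (hab : i < a ∨ b < i) : p i ∉ p '' Set.Icc a b := by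
  rintro ⟨k, ⟨h1, h2⟩, he⟩
  have := h.arcA.inj k i (by omega) hi he
  omega

theorem notMem_image' (h : IsMinTheta G u v A B n m p q) {i a b : ℕ} (hi : 1 ≤ i)
    (him : i ≤ m) (hb : b ≤ n + 1) : q i ∉ p '' Set.Icc a b := by
  rintro ⟨k, ⟨h1, h2⟩, he⟩
  exact h.ne (by omega) hi him he

theorem ncard_image_le (f : ℕ → V) (a b : ℕ) : (f '' Set.Icc a b).ncard ≤ b + 1 - a := by
  refine (Set.ncard_image_le (Set.finite_Icc a b)).trans ?_
  rw [Set.ncard_eq_toFinset_card']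
  simp

theorem eq_of_le_of_le (h : IsMinTheta G u v A B n m p q) {i j k l : ℕ} (hi : 1 ≤ i)
    (hj : 1 ≤ j) (hik : i ≤ k) (hjl : j ≤ l) (hk : k ≤ n) (hl : l ≤ m)
    (hij : G.Adj (p i) (q j)) (hkl : G.Adj (p k) (q l)) : i = k ∧ j = l := by
  by_contra hne
  have hp := h.arcA
  have hq := h.arcB
  have hs := h.swap
  obtain ⟨S, hS, hSsub, hSp, hSq, hScard⟩ : ∃ S, ConnSet G S ∧
      S ⊆ p '' Set.Icc (i + 1) k ∪ q '' Set.Icc (j + 1) l ∧ Touches G {p i} S ∧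
      Touches G {q j} S ∧ S.ncard ≤ (k - i) + (l - j) := by
    have hcp : i < k → ConnSet G (p '' Set.Icc (i + 1) k) := fun h1 =>
      hp.connSet_image (by omega) (by omega)
    have hcq : j < l → ConnSet G (q '' Set.Icc (j + 1) l) := fun h1 =>
      hq.connSet_image (by omega) (by omega)
    have hkmem : i < k → p k ∈ p '' Set.Icc (i + 1) k := fun h1 => ⟨k, ⟨by omega, le_rfl⟩, rfl⟩
    have hlmem : j < l → q l ∈ q '' Set.Icc (j + 1) l := fun h1 => ⟨l, ⟨by omega, le_rfl⟩, rfl⟩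
    have hpt : i < k → Touches G {p i} (p '' Set.Icc (i + 1) k) := fun h1 =>
      ⟨_, rfl, p (i + 1), ⟨i + 1, ⟨le_rfl, h1⟩, rfl⟩, hp.step i (by omega)⟩
    have hqt : j < l → Touches G {q j} (q '' Set.Icc (j + 1) l) := fun h1 =>
      ⟨_, rfl, q (j + 1), ⟨j + 1, ⟨le_rfl, h1⟩, rfl⟩, hq.step j (by omega)⟩
    have hpn := ncard_image_le p (i + 1) k
    have hqn := ncard_image_le q (j + 1) l
    rcases Nat.lt_or_ge i k with h1 | h1 <;> rcases Nat.lt_or_ge j l with h2 | h2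
    · refine ⟨_, (hcp h1).union (hcq h2) ⟨_, hkmem h1, _, hlmem h2, hkl⟩, subset_rfl,
        (hpt h1).mono subset_rfl Set.subset_union_left,
        (hqt h2).mono subset_rfl Set.subset_union_right, ?_⟩
      have := Set.ncard_union_le (p '' Set.Icc (i + 1) k) (q '' Set.Icc (j + 1) l)
      omega
    · obtain rfl : j = l := by omega
      exact ⟨_, hcp h1, Set.subset_union_left, hpt h1, ⟨_, rfl, _, hkmem h1, hkl.symm⟩, by omega⟩
    · obtain rfl : i = k := by omega
      exact ⟨_, hcq h2, Set.subset_union_right, ⟨_, rfl, _, hlmem h2, hkl⟩, hqt h2, by omega⟩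
    · omega
  have hT : IsTheta G (p i) (q j) S (p '' Set.Icc 0 (i - 1) ∪ q '' Set.Icc 1 (j - 1)) := by
    have hq0 : p '' Set.Icc 0 (i - 1) ∪ q '' Set.Icc 1 (j - 1) =
        p '' Set.Icc 0 (i - 1) ∪ q '' Set.Icc 0 (j - 1) := by
      refine Set.Subset.antisymm (Set.union_subset_union_right _ (Set.image_mono
        (Set.Icc_subset_Icc_left (by omega)))) (Set.union_subset Set.subset_union_left ?_)
      rintro _ ⟨t, ⟨h1, h2⟩, rfl⟩
      rcases Nat.eq_zero_or_pos t with rfl | h0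
      · exact Or.inl ⟨0, ⟨le_rfl, by omega⟩, hp.zero.trans hq.zero.symm⟩
      · exact Or.inr ⟨t, ⟨h0, h2⟩, rfl⟩
    refine ⟨hij, hS, ?_, ?_, ?_, ?_, ?_, ?_, hSp, hSq, ?_, ?_⟩
    · rw [hq0]
      exact (hp.connSet_image (by omega) (by omega)).union_of_mem
        (hq.connSet_image (by omega) (by omega)) (x := u) ⟨0, ⟨le_rfl, by omega⟩, hp.zero⟩
        ⟨0, ⟨le_rfl, by omega⟩, hq.zero⟩
    · exact fun hm => (hSsub hm).elim (h.notMem_image (by omega) (by omega) (by omega))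
        (hs.notMem_image' hi (by omega) (by omega))
    · exact fun hm => (hSsub hm).elim (h.notMem_image' hj (by omega) (by omega))
        (hs.notMem_image (by omega) (by omega) (by omega))
    · exact fun hm => hm.elim (h.notMem_image (by omega) (by omega) (by omega))
        (hs.notMem_image' hi (by omega) (by omega))
    · exact fun hm => hm.elim (h.notMem_image' hj (by omega) (by omega))
        (hs.notMem_image (by omega) (by omega) (by omega))
    · rw [Set.disjoint_left]
      intro x hx hx'
      rcases hSsub hx with ⟨a, ⟨ha, ha'⟩, rfl⟩ | ⟨a, ⟨ha, ha'⟩, rfl⟩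
      · rcases hx' with hx' | hx'
        · exact h.notMem_image (by omega) (by omega) (by omega) hx'
        · exact hs.notMem_image' (by omega) (by omega) (by omega) hx'
      · rcases hx' with hx' | hx'
        · exact h.notMem_image' (by omega) (by omega) (by omega) hx'
        · exact hs.notMem_image (by omega) (by omega) (by omega) hx'
    · refine ⟨_, rfl, p (i - 1), Or.inl ⟨i - 1, ⟨by omega, le_rfl⟩, rfl⟩, ?_⟩
      exact (hp.adj_iff hi (by omega) (by omega)).2 (by omega)
    · rw [hq0]
      refine ⟨_, rfl, q (j - 1), Or.inr ⟨j - 1, ⟨by omega, le_rfl⟩, rfl⟩, ?_⟩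
      exact (hq.adj_iff hj (by omega) (by omega)).2 (by omega)
  have h1 := h.min _ _ _ _ hT
  have h2 := Set.ncard_union_le (p '' Set.Icc 0 (i - 1)) (q '' Set.Icc 1 (j - 1))
  have h3 := ncard_image_le p 0 (i - 1)
  have h4 := ncard_image_le q 1 (j - 1)
  omega

theorem eq_of_lt_of_lt (h : IsMinTheta G u v A B n m p q) {i j k l : ℕ} (hi : 1 ≤ i)
    (hl : 1 ≤ l) (hik : i < k) (hlj : l < j) (hk : k ≤ n) (hj : j ≤ m)
    (hij : G.Adj (p i) (q j)) (hkl : G.Adj (p k) (q l)) : k = n ∧ l = 1 := by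
  have hp := h.arcA
  have hq := h.arcB
  have hs := h.swap
  have hT : IsTheta G (p i) (q j) (p '' Set.Icc (i + 1) k ∪ q '' Set.Icc l (j - 1))
      (p '' Set.Icc 0 (i - 1) ∪ q '' Set.Icc (j + 1) (m + 1)) := by
    refine ⟨hij, ?_, ?_, ?_, ?_, ?_, ?_, ?_, ?_, ?_, ?_, ?_⟩
    · exact (hp.connSet_image (by omega) (by omega)).union (hq.connSet_image (by omega) (by omega))
        ⟨p k, ⟨k, ⟨by omega, le_rfl⟩, rfl⟩, q l, ⟨l, ⟨le_rfl, by omega⟩, rfl⟩, hkl⟩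
    · exact (hp.connSet_image (by omega) (by omega)).union (hq.connSet_image (by omega) (by omega))
        ⟨u, ⟨0, ⟨le_rfl, by omega⟩, hp.zero⟩, v, ⟨m + 1, ⟨by omega, le_rfl⟩, hq.last⟩, h.adj⟩
    · exact fun hm => hm.elim (h.notMem_image (by omega) (by omega) (by omega))
        (hs.notMem_image' hi (by omega) (by omega))
    · exact fun hm => hm.elim (h.notMem_image' (by omega) (by omega) (by omega))
        (hs.notMem_image (by omega) (by omega) (by omega))
    · exact fun hm => hm.elim (h.notMem_image (by omega) (by omega) (by omega))
        (hs.notMem_image' hi (by omega) (by omega))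
    · exact fun hm => hm.elim (h.notMem_image' (by omega) (by omega) (by omega))
        (hs.notMem_image (by omega) (by omega) (by omega))
    · rw [Set.disjoint_left]
      intro x hx hx'
      rcases hx with ⟨a, ⟨ha, ha'⟩, rfl⟩ | ⟨a, ⟨ha, ha'⟩, rfl⟩
      · rcases hx' with hx' | hx'
        · exact h.notMem_image (by omega) (by omega) (by omega) hx'
        · exact hs.notMem_image' (by omega) (by omega) (by omega) hx'
      · rcases hx' with hx' | hx'
        · exact h.notMem_image' (by omega) (by omega) (by omega) hx'
        · exact hs.notMem_image (by omega) (by omega) (by omega) hx'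
    · exact ⟨_, rfl, p (i + 1), Or.inl ⟨i + 1, ⟨le_rfl, hik⟩, rfl⟩, hp.step i (by omega)⟩
    · exact ⟨_, rfl, q (j - 1), Or.inr ⟨j - 1, ⟨by omega, le_rfl⟩, rfl⟩,
        (hq.adj_iff (by omega) (by omega) (by omega)).2 (by omega)⟩
    · exact ⟨_, rfl, p (i - 1), Or.inl ⟨i - 1, ⟨by omega, le_rfl⟩, rfl⟩,
        (hp.adj_iff hi (by omega) (by omega)).2 (by omega)⟩
    · exact ⟨_, rfl, q (j + 1), Or.inr ⟨j + 1, ⟨le_rfl, by omega⟩, rfl⟩, hq.step j (by omega)⟩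
  have h1 := h.min _ _ _ _ hT
  have h2 := Set.ncard_union_le (p '' Set.Icc 0 (i - 1)) (q '' Set.Icc (j + 1) (m + 1))
  have h3 := ncard_image_le p 0 (i - 1)
  have h4 := ncard_image_le q (j + 1) (m + 1)
  have h5 := Set.ncard_union_le (p '' Set.Icc (i + 1) k) (q '' Set.Icc l (j - 1))
  have h6 := ncard_image_le p (i + 1) k
  have h7 := ncard_image_le q l (j - 1)
  omega

theorem two_le (hTF : ∀ a b c, G.Adj a b → G.Adj b c → ¬ G.Adj a c)
    (h : IsMinTheta G u v A B n m p q) : 2 ≤ n := by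
  by_contra hn
  have h1 := h.arcA.pos
  obtain rfl : n = 1 := by omega
  have h2 := h.arcA.step 0 (by omega)
  have h3 := h.arcA.step 1 (by omega)
  have h4 := h.arcA.last
  rw [h.arcA.zero, zero_add] at h2
  rw [h4] at h3
  exact hTF _ _ _ h2 h3 h.adj

theorem not_adj_one_last (hTF : ∀ a b c, G.Adj a b → G.Adj b c → ¬ G.Adj a c)
    (hSF : ¬ HasSquare G) (h : IsMinTheta G u v A B n m p q) : ¬ G.Adj (p 1) (q m) := by
  intro hadj
  have hn := h.two_le hTF
  have hm := h.swap.two_le hTF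
  have h1 := (h.arcA.adj_start_iff (i := 1) le_rfl (by omega)).2 rfl
  have h2 := (h.arcB.adj_last_iff (i := m) (by omega) le_rfl).2 rfl
  refine hSF ⟨u, p 1, q m, v, h1, hadj, h2.symm, h.adj.symm, ?_, ?_, ?_, ?_⟩
  · rw [h.arcB.adj_start_iff (by omega) le_rfl]
    omega
  · intro h3
    have := (h.arcA.adj_last_iff (by omega) (by omega)).1 h3.symm
    omega
  · exact fun e => h.arcB.start_notMem (e ▸ h.arcB.mem (by omega) le_rfl)
  · exact fun e => h.arcA.last_notMem (e ▸ h.arcA.mem le_rfl (by omega))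

theorem adj_unique (hTF : ∀ a b c, G.Adj a b → G.Adj b c → ¬ G.Adj a c)
    (hSF : ¬ HasSquare G) (h : IsMinTheta G u v A B n m p q) {i j k l : ℕ} (hi : 1 ≤ i)
    (hj : 1 ≤ j) (hk : 1 ≤ k) (hl : 1 ≤ l) (hin : i ≤ n) (hjm : j ≤ m) (hkn : k ≤ n)
    (hlm : l ≤ m) (hij : G.Adj (p i) (q j)) (hkl : G.Adj (p k) (q l)) : k = i ∧ l = j := by
  have hcross : ∀ i j k l, 1 ≤ i → 1 ≤ l → i < k → l < j → k ≤ n → j ≤ m →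
      G.Adj (p i) (q j) → G.Adj (p k) (q l) → False := by
    intro i j k l hi hl hik hlj hk hj hij hkl
    obtain ⟨rfl, rfl⟩ := h.eq_of_lt_of_lt hi hl hik hlj hk hj hij hkl
    obtain ⟨rfl, rfl⟩ := h.swap.eq_of_lt_of_lt hl hi hlj hik hj hk hkl.symm hij.symm
    exact h.not_adj_one_last hTF hSF hij
  rcases Nat.le_total i k with h1 | h1 <;> rcases Nat.le_total j l with h2 | h2
  · have := h.eq_of_le_of_le hi hj h1 h2 hkn hlm hij hkl
    omega
  · rcases h1.eq_or_lt with rfl | h1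
    · have := h.eq_of_le_of_le hk hl le_rfl h2 hkn hjm hkl hij
      omega
    · rcases h2.eq_or_lt with rfl | h2
      · have := h.eq_of_le_of_le hi hj h1.le le_rfl hkn hlm hij hkl
        omega
      · exact (hcross i j k l hi hl h1 h2 hkn hjm hij hkl).elim
  · rcases h1.eq_or_lt with rfl | h1
    · have := h.eq_of_le_of_le hi hj le_rfl h2 hkn hlm hij hkl
      omega
    · rcases h2.eq_or_lt with rfl | h2
      · have := h.eq_of_le_of_le hk hl h1.le le_rfl hin hjm hkl hij
        omega
      · exact (hcross k l i j hk hj h1 h2 hin hlm hkl hij).elim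
  · have := h.eq_of_le_of_le hk hl h1 h2 hin hjm hkl hij
    omega

theorem ne_one (hTF : ∀ a b c, G.Adj a b → G.Adj b c → ¬ G.Adj a c)
    (hSF : ¬ HasSquare G) (hU : SplitFree G) (h : IsMinTheta G u v A B n m p q) {i j : ℕ}
    (hj : 1 ≤ j) (hjm : j ≤ m) (hij : G.Adj (p i) (q j)) : i ≠ 1 := by
  rintro rfl
  have hn := h.two_le hTF
  have hp := h.arcA
  have hq := h.arcB
  have hjm' : j < m := by
    rcases hjm.eq_or_lt with rfl | h1
    · exact absurd hij (h.not_adj_one_last hTF hSF)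
    · exact h1
  have hu1 := (hp.adj_start_iff (i := 1) le_rfl (by omega)).2 rfl
  obtain ⟨_, ⟨k, ⟨hk, hk'⟩, rfl⟩, _, ⟨l, ⟨hl, hl'⟩, rfl⟩, hkl⟩ := hU u (p 1)
    (p '' Set.Icc 2 (n + 1)) (q '' Set.Icc 1 j) hu1
    (hp.connSet_image (by omega) le_rfl) (hq.connSet_image hj (by omega))
    (by rw [← hp.zero]; exact h.notMem_image (by omega) (by omega) (by omega))
    (h.notMem_image (by omega) (by omega) (by omega))
    (by rw [← hq.zero]; exact h.swap.notMem_image (by omega) (by omega) (by omega))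
    (h.swap.notMem_image' (by omega) (by omega) (by omega))
    (Set.disjoint_left.2 (by
      rintro _ h1 ⟨l, ⟨hl, hl'⟩, rfl⟩
      exact h.notMem_image' hl (by omega) (by omega) h1))
    ⟨u, rfl, v, ⟨n + 1, ⟨by omega, le_rfl⟩, hp.last⟩, h.adj⟩
    ⟨_, rfl, p 2, ⟨2, ⟨le_rfl, by omega⟩, rfl⟩, hp.step 1 (by omega)⟩
    ⟨u, rfl, q 1, ⟨1, ⟨le_rfl, hj⟩, rfl⟩, (hq.adj_start_iff le_rfl (by omega)).2 rfl⟩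
    ⟨_, rfl, q j, ⟨j, ⟨hj, le_rfl⟩, rfl⟩, hij⟩
  rcases Nat.lt_or_ge n k with h1 | h1
  · rw [show k = n + 1 by omega, hp.last, hq.adj_last_iff hl (by omega)] at hkl
    omega
  · have := h.adj_unique hTF hSF le_rfl hj (by omega) hl (by omega) hjm h1 (by omega) hij hkl
    omega

end IsMinTheta

/-- An edge between two vertices of degree at least 3 leads to two arcs with common ends,
joined by a single edge in their interiors. -/
theorem exists_bicycle [Finite V] (hT : TwoConnected G) (hC : ¬ HasProper2Cutset G)
    (hTF : ∀ a b c, G.Adj a b → G.Adj b c → ¬ G.Adj a c) (hSF : ¬ HasSquare G)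
    (hU : SplitFree G) (hsp : ¬ Sparse G) :
    ∃ u v A B n m p q i j, G.Adj u v ∧ IsArc G A u v n p ∧ IsArc G B u v m q ∧ Disjoint A B ∧
      2 ≤ i ∧ i < n ∧ 2 ≤ j ∧ j < m ∧ G.Adj (p i) (q j) ∧
      ∀ k l, 1 ≤ k → k ≤ n → 1 ≤ l → l ≤ m → G.Adj (p k) (q l) → k = i ∧ l = j := by
  simp only [Sparse, not_forall, not_not] at hsp
  obtain ⟨u, v, huv, hu, hv⟩ := hsp
  obtain ⟨A, B, h1, h2, h3, h4, h5, h6, h7, h8, h9, h10, h11⟩ :=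
    exists_two_connSets hT hC hTF huv hu hv
  obtain ⟨u, v, A, B, n, m, p, q, h⟩ :=
    (IsTheta.mk huv h1 h2 h3 h4 h5 h6 h7 h8 h9 h10 h11).exists_isMinTheta
  have hp := h.arcA
  have hq := h.arcB
  have hn := h.two_le hTF
  have hm := h.swap.two_le hTF
  obtain ⟨_, ha, _, hb, hadj⟩ := hU u v A B h.adj hp.connSet hq.connSet hp.start_notMem
    hp.last_notMem hq.start_notMem hq.last_notMem h.disj
    ⟨u, rfl, p 1, hp.mem le_rfl (by omega), (hp.adj_start_iff le_rfl (by omega)).2 rfl⟩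
    ⟨v, rfl, p n, hp.mem (by omega) le_rfl, (hp.adj_last_iff (by omega) le_rfl).2 rfl⟩
    ⟨u, rfl, q 1, hq.mem le_rfl (by omega), (hq.adj_start_iff le_rfl (by omega)).2 rfl⟩
    ⟨v, rfl, q m, hq.mem (by omega) le_rfl, (hq.adj_last_iff (by omega) le_rfl).2 rfl⟩
  obtain ⟨i, hi, hin, rfl⟩ := (hp.mem_iff _).1 ha
  obtain ⟨j, hj, hjm, rfl⟩ := (hq.mem_iff _).1 hb
  have hi1 := h.ne_one hTF hSF hU hj hjm hadj
  have hj1 := h.swap.ne_one hTF hSF hU hi hin hadj.symm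
  have hrev : G.Adj (p (n + 1 - (n + 1 - i))) (q (m + 1 - (m + 1 - j))) := by
    rwa [show n + 1 - (n + 1 - i) = i by omega, show m + 1 - (m + 1 - j) = j by omega]
  have hi2 := h.reverse.ne_one hTF hSF hU (i := n + 1 - i) (j := m + 1 - j) (by omega) (by omega)
    hrev
  have hj2 := h.reverse.swap.ne_one hTF hSF hU (i := m + 1 - j) (j := n + 1 - i) (by omega)
    (by omega) hrev.symm
  exact ⟨u, v, A, B, n, m, p, q, i, j, h.adj, hp, hq, h.disj, by omega, by omega, by omega,
    by omega, hadj, fun k l hk hkn hl hlm hkl =>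
      h.adj_unique hTF hSF hi hj hk hl hin hjm hkn hlm hadj hkl⟩

end Bicycle

/-- A pattern: a finite graph on natural numbers some of whose nodes are marked as points. -/
structure Pat where
  nodes : List ℕ
  isPt : ℕ → Bool
  adj : ℕ → ℕ → Bool

namespace Pat

/-- Add a node `q` whose neighbours are the bits of `N`. -/
def addNode (F : Pat) (q : ℕ) (pt : Bool) (N : ℕ) : Pat where
  nodes := q :: F.nodes
  isPt k := bif k.beq q then pt else F.isPt k
  adj a b := bif a.beq q then N.testBit b else bif b.beq q then N.testBit a else F.adj a b

/-- Turn the node `d`, lying between `s` and `t`, into a point adjacent to `q`. If `l` then a new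
node `z` appears between `s` and `d`, and if `r` then a new node `z + 1` appears between `d`
and `t`. -/
def split (F : Pat) (d s t q z : ℕ) (l r : Bool) : Pat where
  nodes := (bif l then [z] else []) ++ ((bif r then [z + 1] else []) ++ F.nodes)
  isPt k := k.beq d || (!(k.beq z) && (!(k.beq (z + 1)) && F.isPt k))
  adj a b :=
    bif a.beq z then b.beq s || b.beq d
    else bif b.beq z then a.beq s || a.beq d
    else bif a.beq (z + 1) then b.beq t || b.beq d
    else bif b.beq (z + 1) then a.beq t || a.beq d
    else bif a.beq d then bif b.beq s then !l else bif b.beq t then !r else b.beq q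
    else bif b.beq d then bif a.beq s then !l else bif a.beq t then !r else a.beq q
    else F.adj a b

/-- Every element of the list but the last one is adjacent to a later element. -/
def conn (F : Pat) : List ℕ → Bool
  | [] => false
  | [_] => true
  | a :: b :: l => (b :: l).any (fun c => F.adj a c && !(a.beq c)) && F.conn (b :: l)

end Pat

theorem natBeq_eq (a b : ℕ) : Nat.beq a b = (a == b) := by
  rw [Bool.eq_iff_iff, Nat.beq_eq, beq_iff_eq]

/-- The nodes of the pattern `F` are realized by disjoint connected sets of vertices of `G`, points
being realized by single vertices, with edges exactly between sets realizing adjacent nodes. -/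
structure Model {V : Type} (G : SimpleGraph V) (F : Pat) (f : ℕ → Set V) : Prop where
  conn : ∀ i ∈ F.nodes, ConnSet G (f i)
  disj : ∀ i ∈ F.nodes, ∀ j ∈ F.nodes, i ≠ j → Disjoint (f i) (f j)
  pt : ∀ i ∈ F.nodes, F.isPt i = true → (f i).Subsingleton
  adj : ∀ i ∈ F.nodes, ∀ j ∈ F.nodes, i ≠ j → (F.adj i j = true ↔ Touches G (f i) (f j))

/-- The node `a.1` is realized by an arc between the vertices realizing `a.2.1` and `a.2.2`. -/
def ArcNode {V : Type} (G : SimpleGraph V) (f : ℕ → Set V) (a : ℕ × ℕ × ℕ) : Prop :=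
  ∃ x y n p, f a.2.1 = {x} ∧ f a.2.2 = {y} ∧ IsArc G (f a.1) x y n p

/-- The arc realizing `a.1` is attached to the set realizing `q` at a single vertex. -/
structure Ready {V : Type} (G : SimpleGraph V) (F : Pat) (f : ℕ → Set V) (q : ℕ)
    (a : ℕ × ℕ × ℕ) : Prop where
  mem : a.1 ∈ F.nodes ∧ a.2.1 ∈ F.nodes ∧ a.2.2 ∈ F.nodes ∧ q ∈ F.nodes
  pt : F.isPt a.1 = false ∧ F.isPt a.2.1 = true ∧ F.isPt a.2.2 = true
  ne : a.1 ≠ q ∧ a.2.1 ≠ q ∧ a.2.2 ≠ q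
  arc : ArcNode G f a
  touches : Touches G (f a.1) (f q)
  unique : ∀ x ∈ f a.1, ∀ y ∈ f a.1, Touches G {x} (f q) → Touches G {y} (f q) → x = y
  nbr : ∀ k ∈ F.nodes, k ≠ a.1 → Touches G (f a.1) (f k) → k = a.2.1 ∨ k = a.2.2 ∨ k = q

section Model

variable {V : Type} {G : SimpleGraph V} {F : Pat} {f : ℕ → Set V}

theorem Model.connSet_iUnion (h : Model G F f) (l : List ℕ) (hl : ∀ i ∈ l, i ∈ F.nodes)
    (hc : F.conn l = true) : ConnSet G {x | ∃ i ∈ l, x ∈ f i} := by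
  induction l with
  | nil => simp [Pat.conn] at hc
  | cons a l ih =>
    cases l with
    | nil => simpa using h.conn a (hl a (by simp))
    | cons b l =>
      simp only [Pat.conn, natBeq_eq, Bool.and_eq_true, List.any_eq_true, Bool.not_eq_true',
        beq_eq_false_iff_ne] at hc
      obtain ⟨⟨c, hcl, hadj, hac⟩, hc⟩ := hc
      have h1 := ih (fun i hi => hl i (List.mem_cons_of_mem _ hi)) hc
      have h2 := (h.conn a (hl a (by simp))).union h1 (((h.adj a (hl a (by simp)) c
        (hl c (List.mem_cons_of_mem _ hcl)) hac).1 hadj).mono subset_rfl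
          (fun x hx => ⟨c, hcl, hx⟩))
      convert h2 using 1
      ext x
      simp [List.mem_cons]

theorem Model.exists_eq_singleton (h : Model G F f) {i : ℕ} (hi : i ∈ F.nodes)
    (hp : F.isPt i = true) : ∃ x, f i = {x} := by
  obtain ⟨x, hx⟩ := (h.conn i hi).nonempty
  exact ⟨x, (h.pt i hi hp).eq_singleton_of_mem hx⟩

theorem touches_singleton_singleton {x y : V} : Touches G {x} {y} ↔ G.Adj x y := by
  simp [Touches]

theorem Model.split (h : Model G F f) {q d s t z : ℕ} (hr : Ready G F f q (d, s, t))
    (hz : ∀ k ∈ F.nodes, k < z) :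
    ∃ l r g, Model G (F.split d s t q z l r) g ∧ ∀ k ∈ F.nodes, k ≠ d → g k = f k := by
  obtain ⟨⟨hd, hs, ht, hq⟩, ⟨hdp, hsp, htp⟩, ⟨hdq, hsq, htq⟩, ⟨x, y, n, p, hx, hy, hp⟩,
    htouch, huniq, hnbr⟩ := hr
  simp only at *
  obtain ⟨_, hw, w, hwq, hadj⟩ := htouch
  obtain ⟨i, hi, hin, rfl⟩ := (hp.mem_iff _).1 hw
  have hds : d ≠ s := by rintro rfl; simp [hdp] at hsp
  have hdt : d ≠ t := by rintro rfl; simp [hdp] at htp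
  have hst : s ≠ t := by
    rintro rfl
    rw [hx, Set.singleton_eq_singleton_iff] at hy
    exact hp.ne hy
  have hdz := hz d hd
  have hsz := hz s hs
  have htz := hz t ht
  have hqz := hz q hq
  have hpq : ∀ k, 1 ≤ k → k ≤ n → Touches G {p k} (f q) → k = i := fun k h1 h2 h3 =>
    hp.inj k i (by omega) (by omega) (huniq _ (hp.mem h1 h2) _ (hp.mem hi hin) h3
      ⟨_, rfl, w, hwq, hadj⟩)
  let g : ℕ → Set V := fun k => if k = d then {p i} else if k = z then p '' Set.Icc 1 (i - 1)
    else if k = z + 1 then p '' Set.Icc (i + 1) n else f k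
  have hgd : g d = {p i} := by simp [g]
  have hgz : g z = p '' Set.Icc 1 (i - 1) := by simp [g, hdz.ne']
  have hgz' : g (z + 1) = p '' Set.Icc (i + 1) n := by
    simp [g, (show z + 1 ≠ d by omega)]
  have hgk : ∀ k ∈ F.nodes, k ≠ d → g k = f k := by
    intro k hk hkd
    have := hz k hk
    simp [g, hkd, this.ne, (show k ≠ z + 1 by omega)]
  have hsub : ∀ a b, 1 ≤ a → b ≤ n → p '' Set.Icc a b ⊆ f d := by
    rintro a b ha hb _ ⟨k, ⟨h1, h2⟩, rfl⟩
    exact hp.mem (by omega) (by omega)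
  have hzsub : g z ⊆ f d := hgz ▸ hsub 1 (i - 1) le_rfl (by omega)
  have hz'sub : g (z + 1) ⊆ f d := hgz' ▸ hsub (i + 1) n (by omega) le_rfl
  have hdsub : g d ⊆ f d := by rw [hgd]; exact Set.singleton_subset_iff.2 hw
  -- adjacencies of the pieces
  have tzs : 1 < i → Touches G (g z) (f s) := fun h1 => by
    rw [hgz, hx]
    exact ⟨p 1, ⟨1, ⟨le_rfl, by omega⟩, rfl⟩, x, rfl,
      ((hp.adj_start_iff le_rfl (by omega)).2 rfl).symm⟩
  have tzd : 1 < i → Touches G (g z) (g d) := fun h1 => by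
    rw [hgz, hgd]
    exact ⟨p (i - 1), ⟨i - 1, ⟨by omega, le_rfl⟩, rfl⟩, _, rfl,
      (hp.adj_iff (by omega) (by omega) (by omega)).2 (by omega)⟩
  have tzt : ¬ Touches G (g z) (f t) := by
    rw [hgz, hy]
    rintro ⟨_, ⟨k, ⟨h1, h2⟩, rfl⟩, _, rfl, h3⟩
    have := (hp.adj_last_iff h1 (by omega)).1 h3.symm
    omega
  have tzq : ¬ Touches G (g z) (f q) := by
    rw [hgz]
    rintro ⟨_, ⟨k, ⟨h1, h2⟩, rfl⟩, b, hb, h3⟩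
    have := hpq k h1 (by omega) ⟨_, rfl, b, hb, h3⟩
    omega
  have tzz : ¬ Touches G (g z) (g (z + 1)) := by
    rw [hgz, hgz']
    rintro ⟨_, ⟨k, ⟨h1, h2⟩, rfl⟩, _, ⟨m, ⟨h4, h5⟩, rfl⟩, h3⟩
    have := (hp.adj_iff h1 (by omega) (by omega)).1 h3
    omega
  have tz't : i < n → Touches G (g (z + 1)) (f t) := fun h1 => by
    rw [hgz', hy]
    exact ⟨p n, ⟨n, ⟨by omega, le_rfl⟩, rfl⟩, y, rfl,
      ((hp.adj_last_iff (by omega) le_rfl).2 rfl).symm⟩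
  have tz'd : i < n → Touches G (g (z + 1)) (g d) := fun h1 => by
    rw [hgz', hgd]
    exact ⟨p (i + 1), ⟨i + 1, ⟨le_rfl, by omega⟩, rfl⟩, _, rfl,
      (hp.adj_iff (by omega) (by omega) (by omega)).2 (by omega)⟩
  have tz's : ¬ Touches G (g (z + 1)) (f s) := by
    rw [hgz', hx]
    rintro ⟨_, ⟨k, ⟨h1, h2⟩, rfl⟩, _, rfl, h3⟩
    have := (hp.adj_start_iff (by omega) h2).1 h3.symm
    omega
  have tz'q : ¬ Touches G (g (z + 1)) (f q) := by
    rw [hgz']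
    rintro ⟨_, ⟨k, ⟨h1, h2⟩, rfl⟩, b, hb, h3⟩
    have := hpq k (by omega) h2 ⟨_, rfl, b, hb, h3⟩
    omega
  have tds : Touches G (g d) (f s) ↔ ¬ 1 < i := by
    rw [hgd, hx, touches_singleton_singleton, G.adj_comm, hp.adj_start_iff hi hin]
    omega
  have tdt : Touches G (g d) (f t) ↔ ¬ i < n := by
    rw [hgd, hy, touches_singleton_singleton, G.adj_comm, hp.adj_last_iff hi hin]
    omega
  have tdq : Touches G (g d) (f q) := by
    rw [hgd]
    exact ⟨_, rfl, w, hwq, hadj⟩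
  have hother : ∀ S ⊆ f d, ∀ k ∈ F.nodes, k ≠ d → Touches G S (f k) → k = s ∨ k = t ∨ k = q :=
    fun S hS k hk hkd hSk => hnbr k hk hkd (hSk.mono hS subset_rfl)
  have rz : 1 < i → ∀ k ∈ F.nodes, k ≠ d → (Touches G (g z) (f k) ↔ k = s) := by
    intro h1 k hk hkd
    constructor
    · intro h2
      rcases hother _ hzsub k hk hkd h2 with rfl | rfl | rfl
      · rfl
      · exact absurd h2 tzt
      · exact absurd h2 tzq
    · rintro rfl
      exact tzs h1
  have rz' : i < n → ∀ k ∈ F.nodes, k ≠ d → (Touches G (g (z + 1)) (f k) ↔ k = t) := by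
    intro h1 k hk hkd
    constructor
    · intro h2
      rcases hother _ hz'sub k hk hkd h2 with rfl | rfl | rfl
      · exact absurd h2 tz's
      · rfl
      · exact absurd h2 tz'q
    · rintro rfl
      exact tz't h1
  have rd : ∀ k ∈ F.nodes, k ≠ d → (Touches G (g d) (f k) ↔
      (if k == s then !(decide (1 < i)) else if k == t then !(decide (i < n)) else k == q) =
        true) := by
    intro k hk hkd
    by_cases hks : k = s
    · subst hks
      simp [tds]
    by_cases hkt : k = t
    · subst hkt
      simp [tdt, hst.symm]
    simp only [beq_iff_eq, hks, hkt, if_false]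
    constructor
    · intro h2
      rcases hother _ hdsub k hk hkd h2 with h3 | h3 | h3
      · exact absurd h3 hks
      · exact absurd h3 hkt
      · exact h3
    · rintro rfl
      exact tdq
  have hmem : ∀ k, k ∈ (F.split d s t q z (decide (1 < i)) (decide (i < n))).nodes →
      (k = z ∧ 1 < i) ∨ (k = z + 1 ∧ i < n) ∨ k = d ∨ (k ∈ F.nodes ∧ k ≠ d) := by
    intro k hk
    simp only [Pat.split, natBeq_eq, cond_eq_ite, List.mem_append] at hk
    rcases hk with hk | hk | hk
    · by_cases h1 : 1 < i <;> simp [h1] at hk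
      exact Or.inl ⟨hk, h1⟩
    · by_cases h1 : i < n <;> simp [h1] at hk
      exact Or.inr (Or.inl ⟨hk, h1⟩)
    · by_cases h1 : k = d
      · exact Or.inr (Or.inr (Or.inl h1))
      · exact Or.inr (Or.inr (Or.inr ⟨hk, h1⟩))
  have dzz : Disjoint (g z) (g (z + 1)) := by
    rw [hgz, hgz', Set.disjoint_left]
    rintro _ ⟨k, ⟨h1, h2⟩, rfl⟩ ⟨m, ⟨h3, h4⟩, h5⟩
    have := hp.inj _ _ (by omega) (by omega) h5
    omega
  have dzd : Disjoint (g z) (g d) := by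
    rw [hgz, hgd, Set.disjoint_singleton_right]
    rintro ⟨k, ⟨h1, h2⟩, h3⟩
    have := hp.inj _ _ (by omega) (by omega) h3
    omega
  have dz'd : Disjoint (g (z + 1)) (g d) := by
    rw [hgz', hgd, Set.disjoint_singleton_right]
    rintro ⟨k, ⟨h1, h2⟩, h3⟩
    have := hp.inj _ _ (by omega) (by omega) h3
    omega
  have dk : ∀ S ⊆ f d, ∀ k ∈ F.nodes, k ≠ d → Disjoint S (f k) := fun S hS k hk hkd =>
    (h.disj d hd k hk hkd.symm).mono_left hS
  refine ⟨decide (1 < i), decide (i < n), g, ⟨?_, ?_, ?_, ?_⟩, hgk⟩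
  · intro k hk
    rcases hmem k hk with ⟨rfl, h1⟩ | ⟨rfl, h1⟩ | rfl | ⟨hk, hkd⟩
    · rw [hgz]
      exact hp.connSet_image (by omega) (by omega)
    · rw [hgz']
      exact hp.connSet_image (by omega) (by omega)
    · rw [hgd]
      exact ConnSet.singleton _
    · rw [hgk k hk hkd]
      exact h.conn k hk
  · intro k hk m hm hkm
    rcases hmem k hk with ⟨rfl, h1⟩ | ⟨rfl, h1⟩ | rfl | ⟨hk', hkd⟩ <;>
      rcases hmem m hm with ⟨rfl, h2⟩ | ⟨rfl, h2⟩ | rfl | ⟨hm', hmd⟩ <;>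
      first
      | exact absurd rfl hkm
      | exact dzz
      | exact dzz.symm
      | exact dzd
      | exact dzd.symm
      | exact dz'd
      | exact dz'd.symm
      | (rw [hgk m hm' hmd]; first
        | exact dk _ hzsub m hm' hmd
        | exact dk _ hz'sub m hm' hmd
        | exact dk _ hdsub m hm' hmd
        | (rw [hgk k hk' hkd]; exact h.disj k hk' m hm' hkm))
      | (rw [hgk k hk' hkd]; first
        | exact (dk _ hzsub k hk' hkd).symm
        | exact (dk _ hz'sub k hk' hkd).symm
        | exact (dk _ hdsub k hk' hkd).symm)
  · intro k hk hkp
    rcases hmem k hk with ⟨rfl, h1⟩ | ⟨rfl, h1⟩ | rfl | ⟨hk', hkd⟩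
    · simp [Pat.split, natBeq_eq, cond_eq_ite, hdz.ne'] at hkp
    · simp [Pat.split, natBeq_eq, cond_eq_ite, (show z + 1 ≠ d by omega)] at hkp
    · rw [hgd]
      exact Set.subsingleton_singleton
    · rw [hgk k hk' hkd]
      simp only [Pat.split, natBeq_eq, cond_eq_ite, Bool.or_eq_true, beq_iff_eq,
        Bool.and_eq_true] at hkp
      exact h.pt k hk' (hkp.resolve_left hkd).2.2
  · have hlt : ∀ k ∈ F.nodes, k ≠ z ∧ k ≠ z + 1 := fun k hk => by
      have := hz k hk
      omega
    have hdz1 := hlt d hd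
    have key : ∀ k m, k ∈ F.nodes → k ≠ d → ((m = z ∧ 1 < i) ∨ (m = z + 1 ∧ i < n) ∨ m = d) →
        ((F.split d s t q z (decide (1 < i)) (decide (i < n))).adj m k = true ↔
          Touches G (g m) (f k)) ∧
        ((F.split d s t q z (decide (1 < i)) (decide (i < n))).adj k m = true ↔
          Touches G (g m) (f k)) := by
      intro k m hk hkd hm
      have hk1 := hlt k hk
      rcases hm with ⟨rfl, h1⟩ | ⟨rfl, h1⟩ | rfl
      · rw [rz h1 k hk hkd]
        simp [Pat.split, natBeq_eq, cond_eq_ite, hk1, hkd]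
      · rw [rz' h1 k hk hkd]
        simp [Pat.split, natBeq_eq, cond_eq_ite, hk1, hkd]
      · rw [rd k hk hkd]
        simp [Pat.split, natBeq_eq, cond_eq_ite, hk1, hkd, hdz1]
    intro k hk m hm hkm
    rcases hmem k hk with ⟨rfl, h1⟩ | ⟨rfl, h1⟩ | rfl | ⟨hk', hkd⟩ <;>
      rcases hmem m hm with ⟨rfl, h2⟩ | ⟨rfl, h2⟩ | rfl | ⟨hm', hmd⟩
    · exact absurd rfl hkm
    · simp [Pat.split, natBeq_eq, cond_eq_ite, tzz, (show k + 1 ≠ s by omega),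
        (show k + 1 ≠ d by omega)]
    · simp [Pat.split, natBeq_eq, cond_eq_ite, tzd h1]
    · rw [hgk m hm' hmd]
      exact (key m k hm' hmd (Or.inl ⟨rfl, h1⟩)).1
    · rw [touches_comm]
      simp [Pat.split, natBeq_eq, cond_eq_ite, tzz, (show m + 1 ≠ s by omega),
        (show m + 1 ≠ d by omega)]
    · exact absurd rfl hkm
    · simp [Pat.split, natBeq_eq, cond_eq_ite, tz'd h1, hdz1]
    · rw [hgk m hm' hmd]
      exact (key m (z + 1) hm' hmd (Or.inr (Or.inl ⟨rfl, h1⟩))).1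
    · rw [touches_comm]
      simp [Pat.split, natBeq_eq, cond_eq_ite, tzd h2, hdz1]
    · rw [touches_comm]
      simp [Pat.split, natBeq_eq, cond_eq_ite, tz'd h2, hdz1]
    · exact absurd rfl hkm
    · rw [hgk m hm' hmd]
      exact (key m k hm' hmd (Or.inr (Or.inr rfl))).1
    · rw [hgk k hk' hkd, touches_comm]
      exact (key k m hk' hkd (Or.inl ⟨rfl, h2⟩)).2
    · rw [hgk k hk' hkd, touches_comm]
      exact (key k (z + 1) hk' hkd (Or.inr (Or.inl ⟨rfl, h2⟩))).2
    · rw [hgk k hk' hkd, touches_comm]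
      exact (key k m hk' hkd (Or.inr (Or.inr rfl))).2
    · rw [hgk k hk' hkd, hgk m hm' hmd, ← h.adj k hk' m hm' hkm]
      simp [Pat.split, natBeq_eq, cond_eq_ite, hlt k hk', hlt m hm', hkd, hmd]

end Model

/-- A certificate that a graph modelling a pattern is excluded or models a larger pattern: a cycle
with a unique chord, a triangle, a square, a case distinction on the position of the neighbour of
`q` inside an arc, a case distinction on an adjacency of `q`, or an isomorphism with a known
pattern. -/
inductive Cert
  | viol (u v : ℕ) (A B : List ℕ)
  | tri (u v w : ℕ)
  | sq (a b c d : ℕ)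
  | split (d s t : ℕ) (c₀ c₁ c₂ c₃ : Cert)
  | branch (p : ℕ) (c₀ c₁ : Cert)
  | iso (k : ℕ) (perm : List ℕ)

namespace Cert

/-- Membership in a list of natural numbers. -/
def mem (a : ℕ) (l : List ℕ) : Bool :=
  l.any a.beq

/-- Check the validity of a certificate; `R` is a list of arcs that can be split and all nodes are
smaller than `z`. -/
def check (tgts : List Pat) (q : ℕ) : Cert → Pat → List (ℕ × ℕ × ℕ) → ℕ → Bool
  | viol u v A B, F, _, _ =>
    F.adj u v && A.any (F.adj u) && A.any (F.adj v) && B.any (F.adj u) && B.any (F.adj v) &&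
    A.all (fun a => B.all fun b => !(F.adj a b) && !(a.beq b)) && F.conn A && F.conn B &&
    F.isPt u && F.isPt v && !(u.beq v) &&
    A.all (fun a => !(u.beq a) && !(v.beq a) && mem a F.nodes) &&
    B.all (fun a => !(u.beq a) && !(v.beq a) && mem a F.nodes) &&
    mem u F.nodes && mem v F.nodes
  | tri u v w, F, _, _ =>
    F.adj u v && F.adj v w && F.adj u w && F.isPt u && F.isPt v && F.isPt w &&
    !(u.beq v) && !(v.beq w) && !(u.beq w) && mem u F.nodes && mem v F.nodes && mem w F.nodes
  | sq a b c d, F, _, _ =>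
    F.adj a b && F.adj b c && F.adj c d && F.adj d a && !(F.adj a c) && !(F.adj b d) &&
    F.isPt a && F.isPt b && F.isPt c && F.isPt d && !(a.beq b) && !(b.beq c) && !(c.beq d) &&
    !(d.beq a) && !(a.beq c) && !(b.beq d) &&
    mem a F.nodes && mem b F.nodes && mem c F.nodes && mem d F.nodes
  | split d s t c₀ c₁ c₂ c₃, F, R, z =>
    R.any (fun a => a.1.beq d && a.2.1.beq s && a.2.2.beq t) &&
    (check tgts q c₀ (F.split d s t q z false false) (R.filter fun a => !(a.1.beq d)) (z + 2) &&
    (check tgts q c₁ (F.split d s t q z true false) (R.filter fun a => !(a.1.beq d)) (z + 2) &&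
    (check tgts q c₂ (F.split d s t q z false true) (R.filter fun a => !(a.1.beq d)) (z + 2) &&
    check tgts q c₃ (F.split d s t q z true true) (R.filter fun a => !(a.1.beq d)) (z + 2))))
  | branch p c₀ c₁, F, R, z =>
    bif F.adj q p then check tgts q c₁ F R z else check tgts q c₀ F R z
  | iso k perm, F, _, _ =>
    (tgts[k]?).any fun H => H.nodes.all fun i =>
      mem (perm.getD i 0) F.nodes && (!(H.isPt i) || F.isPt (perm.getD i 0)) &&
      H.nodes.all fun j => i.beq j ||
        (!((perm.getD i 0).beq (perm.getD j 0)) &&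
          F.adj (perm.getD i 0) (perm.getD j 0) == H.adj i j)

theorem mem_iff {a : ℕ} {l : List ℕ} : mem a l = true ↔ a ∈ l := by
  simp [mem, natBeq_eq]

end Cert

section Cert

variable {V : Type} {G : SimpleGraph V} {F : Pat} {f : ℕ → Set V}

theorem Model.adj_of_eq (h : Model G F f) {i j : ℕ} {x y : V} (hi : i ∈ F.nodes)
    (hj : j ∈ F.nodes) (hij : i ≠ j) (hx : f i = {x}) (hy : f j = {y}) :
    F.adj i j = true ↔ G.Adj x y := by
  rw [h.adj i hi j hj hij, hx, hy, touches_singleton_singleton]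

theorem Model.ne_of_eq (h : Model G F f) {i j : ℕ} {x y : V} (hi : i ∈ F.nodes)
    (hj : j ∈ F.nodes) (hij : i ≠ j) (hx : f i = {x}) (hy : f j = {y}) : x ≠ y := by
  have := h.disj i hi j hj hij
  rw [hx, hy, Set.disjoint_singleton] at this
  exact this

/-- After splitting the arc at one node, the other arcs can still be split. -/
theorem Ready.split {q d s t z : ℕ} {l r : Bool} {g : ℕ → Set V} {a : ℕ × ℕ × ℕ}
    (hz : ∀ k ∈ F.nodes, k < z) (hg : ∀ k ∈ F.nodes, k ≠ d → g k = f k)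
    (hM : Model G (F.split d s t q z l r) g)
    (hd : Ready G F f q (d, s, t)) (ha : Ready G F f q a) (had : a.1 ≠ d) :
    Ready G (F.split d s t q z l r) g q a := by
  obtain ⟨⟨m1, m2, m3, m4⟩, ⟨p1, p2, p3⟩, ⟨n1, n2, n3⟩, harc, htouch, huniq, hnbr⟩ := ha
  have hdp := hd.pt.1
  have hdm := hd.mem.1
  simp only at hdp hdm
  have hmem : ∀ k ∈ F.nodes, k ∈ (F.split d s t q z l r).nodes := fun k hk => by
    simp [Pat.split, natBeq_eq, cond_eq_ite, hk]
  have h2 : a.2.1 ≠ d := by rintro h; simp [h, hdp] at p2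
  have h3 : a.2.2 ≠ d := by rintro h; simp [h, hdp] at p3
  have hq : q ≠ d := fun h => hd.ne.1 h.symm
  have hpt : ∀ k ∈ F.nodes, k ≠ d → (F.split d s t q z l r).isPt k = F.isPt k := by
    intro k hk hkd
    have := hz k hk
    simp [Pat.split, natBeq_eq, cond_eq_ite, beq_eq_false_iff_ne.2 hkd,
      beq_eq_false_iff_ne.2 this.ne,
      beq_eq_false_iff_ne.2 (show k ≠ z + 1 by omega)]
  refine ⟨⟨hmem _ m1, hmem _ m2, hmem _ m3, hmem _ m4⟩, ⟨?_, ?_, ?_⟩, ⟨n1, n2, n3⟩, ?_, ?_, ?_, ?_⟩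
  · rw [hpt _ m1 had, p1]
  · rw [hpt _ m2 h2, p2]
  · rw [hpt _ m3 h3, p3]
  · unfold ArcNode
    rw [hg _ m1 had, hg _ m2 h2, hg _ m3 h3]
    exact harc
  · rwa [hg _ m1 had, hg _ m4 hq]
  · rw [hg _ m1 had, hg _ m4 hq]
    exact huniq
  · intro k hk hka hT
    have ha1 := hz _ m1
    have h2' := hz _ m2
    have h3' := hz _ m3
    by_cases hkd : k = d
    · subst hkd
      have := (hM.adj a.1 (hmem _ m1) k hk had).2 hT
      simp only [Pat.split, natBeq_eq, cond_eq_ite, beq_iff_eq, ha1.ne,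
        (show a.1 ≠ z + 1 by omega), (hz _ hdm).ne,
        (show k ≠ z + 1 by have := hz _ hdm; omega), had, if_false, if_true] at this
      have hds := hd.pt.2.1
      have hdt := hd.pt.2.2
      simp only at hds hdt
      have e1 : a.1 ≠ s := by rintro h; simp [← h, p1] at hds
      have e2 : a.1 ≠ t := by rintro h; simp [← h, p1] at hdt
      simp [e1, e2, n1] at this
    · have hk' : k = z ∨ k = z + 1 ∨ k ∈ F.nodes := by
        simp only [Pat.split, natBeq_eq, cond_eq_ite, List.mem_append] at hk
        rcases hk with hk | hk | hk
        · cases l <;> simp at hk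
          exact Or.inl hk
        · cases r <;> simp at hk
          exact Or.inr (Or.inl hk)
        · exact Or.inr (Or.inr hk)
      have hds := hd.pt.2.1
      have hdt := hd.pt.2.2
      simp only at hds hdt
      have e1 : a.1 ≠ s := by rintro h; simp [← h, p1] at hds
      have e2 : a.1 ≠ t := by rintro h; simp [← h, p1] at hdt
      rcases hk' with rfl | rfl | hk'
      · have := (hM.adj a.1 (hmem _ m1) k hk hka.symm).2 hT
        simp [Pat.split, natBeq_eq, cond_eq_ite, ha1.ne, e1, had] at this
      · have := (hM.adj a.1 (hmem _ m1) (z + 1) hk hka.symm).2 hT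
        simp [Pat.split, natBeq_eq, cond_eq_ite, ha1.ne, (show a.1 ≠ z + 1 by omega), e2,
          had] at this
      · rw [hg _ m1 had, hg _ hk' hkd] at hT
        exact hnbr k hk' hka hT

theorem Cert.sound (hTF : ∀ a b c, G.Adj a b → G.Adj b c → ¬ G.Adj a c) (hSF : ¬ HasSquare G)
    (hU : SplitFree G) {tgts : List Pat} {q : ℕ} (c : Cert) :
    ∀ (F : Pat) (R : List (ℕ × ℕ × ℕ)) (z : ℕ) (f : ℕ → Set V), Model G F f →
      (∀ a ∈ R, Ready G F f q a) → (∀ k ∈ F.nodes, k < z) → c.check tgts q F R z = true →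
      ∃ H ∈ tgts, ∃ g, Model G H g := by
  induction c with
  | viol u v A B =>
    intro F R z f h hR hz hc
    exfalso
    simp only [check, Bool.and_eq_true, List.any_eq_true, List.all_eq_true, Bool.not_eq_true',
      natBeq_eq, beq_eq_false_iff_ne, mem_iff] at hc
    obtain ⟨⟨⟨⟨⟨⟨⟨⟨⟨⟨⟨⟨⟨⟨huv, ⟨a1, ha1, hua1⟩⟩, ⟨a2, ha2, hva2⟩⟩, ⟨b1, hb1, hub1⟩⟩,
      ⟨b2, hb2, hvb2⟩⟩, hAB⟩, hA⟩, hB⟩, hup⟩, hvp⟩, huv'⟩, hAn⟩, hBn⟩, hun⟩, hvn⟩ := hc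
    obtain ⟨x, hx⟩ := h.exists_eq_singleton hun hup
    obtain ⟨y, hy⟩ := h.exists_eq_singleton hvn hvp
    have hAs : ∀ a ∈ A, f a ⊆ {x | ∃ i ∈ A, x ∈ f i} := fun a ha x hx => ⟨a, ha, hx⟩
    have hBs : ∀ a ∈ B, f a ⊆ {x | ∃ i ∈ B, x ∈ f i} := fun a ha x hx => ⟨a, ha, hx⟩
    have hnot : ∀ w k, w ∈ F.nodes → k ∈ F.nodes → w ≠ k → ∀ x, f w = {x} → x ∉ f k := by
      intro w k hw hk hwk x hx hxk
      exact Set.disjoint_left.1 (h.disj w hw k hk hwk) (hx ▸ rfl) hxk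
    have key := hU x y {x | ∃ i ∈ A, x ∈ f i} {x | ∃ i ∈ B, x ∈ f i}
      ((h.adj_of_eq hun hvn huv' hx hy).1 huv)
      (h.connSet_iUnion A (fun i hi => (hAn i hi).2) hA)
      (h.connSet_iUnion B (fun i hi => (hBn i hi).2) hB)
      (by rintro ⟨i, hi, hxi⟩
          exact hnot u i hun (hAn i hi).2 (hAn i hi).1.1 x hx hxi)
      (by rintro ⟨i, hi, hxi⟩
          exact hnot v i hvn (hAn i hi).2 (hAn i hi).1.2 y hy hxi)
      (by rintro ⟨i, hi, hxi⟩
          exact hnot u i hun (hBn i hi).2 (hBn i hi).1.1 x hx hxi)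
      (by rintro ⟨i, hi, hxi⟩
          exact hnot v i hvn (hBn i hi).2 (hBn i hi).1.2 y hy hxi)
      (by rw [Set.disjoint_left]
          rintro w ⟨i, hi, hwi⟩ ⟨j, hj, hwj⟩
          exact Set.disjoint_left.1 (h.disj i (hAn i hi).2 j (hBn j hj).2 (hAB i hi j hj).2) hwi
            hwj)
      (hx ▸ ((h.adj u hun a1 (hAn _ ha1).2 (hAn _ ha1).1.1).1 hua1).mono subset_rfl (hAs _ ha1))
      (hy ▸ ((h.adj v hvn a2 (hAn _ ha2).2 (hAn _ ha2).1.2).1 hva2).mono subset_rfl (hAs _ ha2))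
      (hx ▸ ((h.adj u hun b1 (hBn _ hb1).2 (hBn _ hb1).1.1).1 hub1).mono subset_rfl (hBs _ hb1))
      (hy ▸ ((h.adj v hvn b2 (hBn _ hb2).2 (hBn _ hb2).1.2).1 hvb2).mono subset_rfl (hBs _ hb2))
    obtain ⟨w, ⟨i, hi, hwi⟩, w', ⟨j, hj, hwj⟩, hww⟩ := key
    have := (h.adj i (hAn i hi).2 j (hBn j hj).2 (hAB i hi j hj).2).2 ⟨w, hwi, w', hwj, hww⟩
    simp [(hAB i hi j hj).1] at this
  | tri u v w =>
    intro F R z f h hR hz hc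
    exfalso
    simp only [check, Bool.and_eq_true, Bool.not_eq_true', natBeq_eq, beq_eq_false_iff_ne,
      mem_iff] at hc
    obtain ⟨⟨⟨⟨⟨⟨⟨⟨⟨⟨⟨huv, hvw⟩, huw⟩, pu⟩, pv⟩, pw⟩, euv⟩, evw⟩, euw⟩, nu⟩, nv⟩, nw⟩ := hc
    obtain ⟨x, hx⟩ := h.exists_eq_singleton nu pu
    obtain ⟨y, hy⟩ := h.exists_eq_singleton nv pv
    obtain ⟨z, hz⟩ := h.exists_eq_singleton nw pw
    exact hTF x y z ((h.adj_of_eq nu nv euv hx hy).1 huv) ((h.adj_of_eq nv nw evw hy hz).1 hvw)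
      ((h.adj_of_eq nu nw euw hx hz).1 huw)
  | sq a b c d =>
    intro F R z f h hR hz hc
    exfalso
    simp only [check, Bool.and_eq_true, natBeq_eq, beq_eq_false_iff_ne, mem_iff,
      Bool.not_eq_true'] at hc
    obtain ⟨⟨⟨⟨⟨⟨⟨⟨⟨⟨⟨⟨⟨⟨⟨⟨⟨⟨⟨hab, hbc⟩, hcd⟩, hda⟩, hac⟩, hbd⟩, pa⟩, pb⟩, pc⟩, pd⟩, eab⟩, ebc⟩,
      ecd⟩, eda⟩, eac⟩, ebd⟩, na⟩, nb⟩, nc⟩, nd⟩ := hc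
    obtain ⟨x, hx⟩ := h.exists_eq_singleton na pa
    obtain ⟨y, hy⟩ := h.exists_eq_singleton nb pb
    obtain ⟨z, hz⟩ := h.exists_eq_singleton nc pc
    obtain ⟨w, hw⟩ := h.exists_eq_singleton nd pd
    refine hSF ⟨x, y, z, w, (h.adj_of_eq na nb eab hx hy).1 hab,
      (h.adj_of_eq nb nc ebc hy hz).1 hbc, (h.adj_of_eq nc nd ecd hz hw).1 hcd,
      (h.adj_of_eq nd na eda hw hx).1 hda, ?_, ?_, h.ne_of_eq na nc eac hx hz,
      h.ne_of_eq nb nd ebd hy hw⟩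
    · rw [← h.adj_of_eq na nc eac hx hz, hac]
      simp
    · rw [← h.adj_of_eq nb nd ebd hy hw, hbd]
      simp
  | split d s t c₀ c₁ c₂ c₃ ih₀ ih₁ ih₂ ih₃ =>
    intro F R z f h hR hz hc
    simp only [check, Bool.and_eq_true, List.any_eq_true, natBeq_eq, beq_iff_eq] at hc
    obtain ⟨⟨⟨d', s', t'⟩, hd, ⟨rfl, rfl⟩, rfl⟩, h₀, h₁, h₂, h₃⟩ := hc
    have hd' := hR _ hd
    obtain ⟨l, r, g, hM, hg⟩ := h.split hd' hz
    have hR' : ∀ a ∈ R.filter fun a => !(a.1 == d'), Ready G (F.split d' s' t' q z l r) g q a := by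
      intro a ha
      simp only [List.mem_filter, Bool.not_eq_true', beq_eq_false_iff_ne] at ha
      exact Ready.split hz hg hM hd' (hR a ha.1) ha.2
    have hz' : ∀ k ∈ (F.split d' s' t' q z l r).nodes, k < z + 2 := by
      intro k hk
      simp only [Pat.split, natBeq_eq, cond_eq_ite, List.mem_append] at hk
      rcases hk with hk | hk | hk
      · cases l <;> simp at hk
        omega
      · cases r <;> simp at hk
        omega
      · have := hz k hk
        omega
    cases l <;> cases r
    · exact ih₀ _ _ _ g hM hR' hz' h₀
    · exact ih₂ _ _ _ g hM hR' hz' h₂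
    · exact ih₁ _ _ _ g hM hR' hz' h₁
    · exact ih₃ _ _ _ g hM hR' hz' h₃
  | branch p c₀ c₁ ih₀ ih₁ =>
    intro F R z f h hR hz hc
    rw [check] at hc
    cases hp : F.adj q p
    · rw [hp] at hc
      exact ih₀ F R z f h hR hz hc
    · rw [hp] at hc
      exact ih₁ F R z f h hR hz hc
  | iso k perm =>
    intro F R z f h hR hz hc
    simp only [check, Option.any_eq_true] at hc
    obtain ⟨H, hH, hc⟩ := hc
    simp only [Bool.and_eq_true, List.all_eq_true, mem_iff, Bool.or_eq_true,
      Bool.not_eq_true', natBeq_eq, beq_eq_false_iff_ne, beq_iff_eq] at hc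
    refine ⟨H, List.mem_of_getElem? hH, fun i => f (perm.getD i 0), ?_, ?_, ?_, ?_⟩
    · exact fun i hi => h.conn _ (hc i hi).1.1
    · intro i hi j hj hij
      exact h.disj _ (hc i hi).1.1 _ (hc j hj).1.1 (((hc i hi).2 j hj).resolve_left hij).1
    · intro i hi hp
      exact h.pt _ (hc i hi).1.1 ((hc i hi).1.2.resolve_left (by simp [hp]))
    · intro i hi j hj hij
      rw [← (((hc i hi).2 j hj).resolve_left hij).2]
      exact h.adj _ (hc i hi).1.1 _ (hc j hj).1.1 (((hc i hi).2 j hj).resolve_left hij).1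

end Cert

/-- An induced subgraph of a host graph given by adjacency masks. Its nodes of degree two are
listed in `arcs` together with their neighbours. -/
structure Canon where
  masks : List ℕ
  nodes : List ℕ
  arcs : List (ℕ × ℕ × ℕ)
  conf : List ℕ

namespace Canon

/-- The pattern whose points are the nodes that are not in the middle of an arc. -/
def pat (C : Canon) : Pat where
  nodes := C.nodes
  isPt k := !(C.arcs.any fun a => a.1.beq k)
  adj i j := (C.masks.getD i 0).testBit j

/-- The bits of `N` are bits of `M`. -/
def sub (N M : ℕ) : Bool :=
  (N ||| M).beq M

/-- The bits of `N` other than those of `e` lie at one node or on one arc. -/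
def isLocal (C : Canon) (e N : ℕ) : Bool :=
  C.nodes.any (fun i => sub N (1 <<< i ||| e)) ||
  C.arcs.any fun a => sub N (1 <<< a.1 ||| (1 <<< a.2.1 ||| (1 <<< a.2.2 ||| e)))

/-- Check `leaf` on all masks obtained from `N` by adding nodes of the list, skipping the additions
that are `bad`. -/
def enum (bad : ℕ → ℕ → Bool) (leaf : ℕ → Bool) : List ℕ → ℕ → Bool
  | [], N => leaf N
  | p :: l, N => enum bad leaf l N && (bad p N || enum bad leaf l (N ||| 1 <<< p))

/-- The neighbourhood `N` of an additional node is local or handled by the certificate. -/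
def leaf (C : Canon) (tgts : List Pat) (cert : Cert) (pt : Bool) (N : ℕ) : Bool :=
  C.isLocal 0 N || cert.check tgts 16 (C.pat.addNode 16 pt N)
    (C.arcs.filter fun a => N.testBit a.1) 17

/-- All possible additions of a point are local or handled by the certificate. -/
def pointCheck (C : Canon) (tgts : List Pat) (cert : Cert) : Bool :=
  enum (fun p N => !((C.conf.getD p 0 &&& N).beq 0)) (C.leaf tgts cert true) C.nodes 0

/-- All possible additions of a blob are local or handled by the certificate. -/
def blobCheck (C : Canon) (tgts : List Pat) (cert : Cert) : Bool :=
  C.nodes.all fun i => C.nodes.all fun j => Nat.ble j i ||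
    enum (fun p N => !(C.isLocal (1 <<< i) (N ||| 1 <<< p) && C.isLocal (1 <<< j) (N ||| 1 <<< p)))
      (C.leaf tgts cert false) (C.nodes.filter fun p => !(p.beq i) && !(p.beq j))
      (1 <<< i ||| 1 <<< j)

end Canon

/-- The adjacency masks of the Petersen graph. -/
def petMasks : List ℕ :=
  [50, 69, 138, 276, 521, 385, 770, 548, 104, 208]

/-- The adjacency masks of the Heawood graph. -/
def heaMasks : List ℕ :=
  [8706, 69, 2058, 276, 8232, 1104, 162, 4416, 648, 1281, 2592, 5124, 10368, 4113]

/-- The subgraph of the Petersen graph induced by its last 8 vertices. -/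
def pet₈ : Canon where
  masks := petMasks
  nodes := [2, 3, 4, 5, 6, 7, 8, 9]
  arcs := [(2, 3, 7), (4, 3, 9), (5, 7, 8), (6, 8, 9)]
  conf := [0, 0, 0, 256, 0, 0, 0, 512, 8, 128]

/-- The subgraph of the Petersen graph induced by its last 9 vertices. -/
def pet₉ : Canon where
  masks := petMasks
  nodes := [1, 2, 3, 4, 5, 6, 7, 8, 9]
  arcs := [(1, 2, 6), (4, 3, 9), (5, 7, 8)]
  conf := [0, 0, 904, 452, 0, 0, 904, 588, 588, 452]

/-- The subgraph of the Petersen graph induced by its last 10 vertices. -/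
def pet₁₀ : Canon where
  masks := petMasks
  nodes := [0, 1, 2, 3, 4, 5, 6, 7, 8, 9]
  arcs := []
  conf := [1022, 1021, 1019, 1015, 1007, 991, 959, 895, 767, 511]

/-- The subgraph of the Heawood graph induced by its last 11 vertices. -/
def hea₁₁ : Canon where
  masks := heaMasks
  nodes := [3, 4, 5, 6, 7, 8, 9, 10, 11, 12, 13]
  arcs := [(3, 4, 8), (6, 5, 7), (9, 8, 10), (11, 10, 12), (13, 4, 12)]
  conf := [0, 0, 0, 0, 1056, 1040, 0, 4352, 4224, 0, 48, 0, 384, 0]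

/-- The subgraph of the Heawood graph induced by its last 12 vertices. -/
def hea₁₂ : Canon where
  masks := heaMasks
  nodes := [2, 3, 4, 5, 6, 7, 8, 9, 10, 11, 12, 13]
  arcs := [(2, 3, 11), (6, 5, 7), (9, 8, 10), (13, 4, 12)]
  conf := [0, 0, 0, 432, 1320, 3096, 0, 6408, 4248, 0, 6192, 5280, 3456, 0]

/-- The subgraph of the Heawood graph induced by its last 13 vertices. -/
def hea₁₃ : Canon where
  masks := heaMasks
  nodes := [1, 2, 3, 4, 5, 6, 7, 8, 9, 10, 11, 12, 13]
  arcs := [(1, 2, 6), (9, 8, 10), (13, 4, 12)]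
  conf := [0, 0, 7448, 2484, 1388, 3288, 5552, 6504, 4316, 0, 6260, 5292, 3524, 0]

/-- The subgraph of the Heawood graph induced by its last 14 vertices. -/
def hea₁₄ : Canon where
  masks := heaMasks
  nodes := [0, 1, 2, 3, 4, 5, 6, 7, 8, 9, 10, 11, 12, 13]
  arcs := []
  conf := [14166, 10989, 7515, 11190, 13677, 11994, 5559, 15210, 5853, 11691, 7029, 13998,
    11733, 6843]

/-- A certificate for adding a point to `pet₈`. -/
def pet₈PointCert : Cert :=
  .branch 3 (.branch 2 (.branch 6 (.branch 9 (.branch 7 (.branch 5 (.viol 3 8 [4, 16] [2, 7, 5])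
    (.branch 8 (.split 4 3 9 (.split 5 7 8 (.iso 0 [0, 16, 4, 3, 2, 6, 5, 9, 8, 7]) (.viol 3 4 [2,
    7, 9] [8, 5, 16]) (.viol 4 9 [3, 8, 6] [16, 5, 7]) (.viol 3 4 [2, 7, 9] [8, 20, 5, 16]))
    (.split 5 7 8 (.viol 5 7 [8, 3, 2] [16, 4, 9]) (.iso 1 [0, 0, 0, 19, 5, 8, 6, 9, 7, 2, 3, 17,
    4, 16]) (.viol 4 9 [17, 3, 8, 6] [16, 5, 7]) (.viol 4 9 [17, 3, 8, 6] [16, 5, 19, 7])) (.split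
    5 7 8 (.viol 5 8 [7, 9, 6] [16, 4, 3]) (.viol 3 4 [2, 7, 9, 18] [8, 5, 16]) (.iso 1 [0, 0, 0,
    20, 5, 7, 2, 3, 8, 6, 9, 18, 4, 16]) (.viol 3 4 [2, 7, 9, 18] [8, 20, 5, 16])) (.split 5 7 8
    (.viol 5 7 [8, 3, 2] [16, 4, 18, 9]) (.viol 3 8 [2, 7, 9, 6] [17, 4, 16, 5]) (.viol 5 7 [20, 8,
    3, 2] [16, 4, 18, 9]) (.viol 3 8 [2, 7, 9, 6] [17, 4, 16, 5, 20]))) (.viol 8 16 [5] [3, 4,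
    9]))) (.branch 5 (.branch 8 (.viol 7 9 [5, 8, 6] [16, 4]) (.viol 7 16 [5, 8] [9, 4])) (.viol 7
    16 [5, 8] [9, 4]))) (.branch 4 (.viol 7 9 [5, 16] [2, 3, 4]) (.viol 9 16 [7, 5, 8] [4])))
    (.branch 4 (.branch 7 (.viol 7 9 [5, 16, 6] [2, 3, 4]) (.viol 7 9 [2, 3, 4] [16, 6])) (.branch
    5 (.branch 7 (.viol 3 8 [4, 16, 6] [2, 7, 5]) (.split 4 3 9 (.sq 4 9 7 16) (.sq 4 9 7 16)
    (.viol 7 16 [2, 3, 4] [9, 6]) (.viol 7 16 [2, 3, 17, 4] [9, 6]))) (.split 6 8 9 (.viol 6 16 [9,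
    4] [8, 5]) (.viol 6 16 [9, 4] [17, 8, 5]) (.viol 6 16 [18, 9, 4] [8, 5]) (.viol 6 16 [18, 9, 4]
    [17, 8, 5]))))) (.branch 4 (.branch 5 (.branch 8 (.branch 9 (.branch 7 (.split 2 3 7 (.split 6
    8 9 (.iso 0 [0, 16, 2, 3, 4, 5, 6, 7, 8, 9]) (.viol 2 7 [3, 8, 5] [16, 6, 9]) (.viol 2 3 [7, 9,
    4] [16, 6, 8]) (.viol 2 3 [7, 9, 4] [16, 6, 19, 8])) (.split 6 8 9 (.viol 6 9 [8, 3, 4] [16, 2,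
    7]) (.viol 2 7 [17, 3, 8, 5] [16, 6, 9]) (.iso 1 [0, 0, 0, 20, 6, 8, 5, 7, 9, 4, 3, 17, 2, 16])
    (.viol 2 7 [17, 3, 8, 5] [16, 6, 20, 9])) (.split 6 8 9 (.viol 6 8 [9, 7, 5] [16, 2, 3]) (.iso
    1 [0, 0, 0, 19, 6, 9, 4, 3, 8, 5, 7, 18, 2, 16]) (.viol 2 3 [18, 7, 9, 4] [16, 6, 8]) (.viol 2
    3 [18, 7, 9, 4] [16, 6, 19, 8])) (.split 6 8 9 (.viol 6 8 [9, 7, 5] [16, 2, 17, 3]) (.viol 6 9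
    [19, 8, 3, 4] [16, 2, 18, 7]) (.viol 3 8 [4, 9, 7, 5] [17, 2, 16, 6]) (.viol 3 8 [4, 9, 7, 5]
    [17, 2, 16, 6, 19]))) (.viol 7 16 [2, 3] [9, 6])) (.branch 6 (.viol 7 9 [5, 8, 6] [2, 16])
    (.viol 9 16 [7, 2, 3] [6]))) (.branch 6 (.branch 9 (.viol 3 8 [4, 9, 6] [2, 16]) (.viol 8 16
    [6, 9] [3, 2])) (.viol 8 16 [6] [3, 2, 7]))) (.branch 6 (.branch 9 (.viol 3 8 [4, 9, 6] [2, 16,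
    5]) (.split 2 3 7 (.sq 2 7 9 16) (.sq 2 7 9 16) (.viol 9 16 [7, 5] [4, 3, 2]) (.viol 9 16 [7,
    5] [4, 3, 17, 2]))) (.split 5 7 8 (.viol 5 16 [7, 2] [8, 6]) (.viol 5 16 [8, 6] [17, 7, 2])
    (.viol 5 16 [7, 2] [18, 8, 6]) (.viol 5 16 [18, 8, 6] [17, 7, 2])))) (.branch 5 (.branch 6
    (.branch 8 (.viol 7 9 [5, 8, 6] [2, 16, 4]) (.split 2 3 7 (.sq 2 3 8 16) (.viol 8 16 [5, 7, 2]
    [3, 4]) (.sq 2 3 8 16) (.viol 8 16 [5, 7, 18, 2] [3, 4]))) (.split 4 3 9 (.viol 4 16 [3, 2] [9,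
    6]) (.viol 4 16 [9, 6] [17, 3, 2]) (.viol 4 16 [3, 2] [18, 9, 6]) (.viol 4 16 [18, 9, 6] [17,
    3, 2]))) (.split 2 3 7 (.viol 2 16 [7, 5] [3, 4]) (.viol 2 16 [7, 5] [17, 3, 4]) (.viol 2 16
    [3, 4] [18, 7, 5]) (.viol 2 16 [18, 7, 5] [17, 3, 4]))))) (.branch 6 (.branch 4 (.branch 9
    (.viol 3 8 [4, 9, 6] [16, 5]) (.branch 2 (.viol 3 16 [4, 9] [8, 5]) (.viol 3 16 [4, 9] [2])))
    (.viol 3 16 [4] [2, 7, 5])) (.branch 5 (.branch 2 (.branch 7 (.viol 3 8 [2, 7, 5] [16, 6])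
    (.viol 3 16 [2, 7] [8, 6])) (.viol 3 16 [2, 7] [8, 6])) (.split 5 7 8 (.sq 3 8 5 16) (.sq 3 8 5
    16) (.viol 3 16 [2, 7, 5] [8, 6]) (.viol 3 16 [2, 7, 17, 5] [8, 6]))))

theorem pet₈_point :
    pet₈.pointCheck [pet₉.pat, hea₁₁.pat] pet₈PointCert = true := by
  decide +kernel

/-- A certificate for adding a blob to `pet₈`. -/
def pet₈BlobCert : Cert :=
  .branch 2 (.branch 6 (.branch 4 (.branch 3 (.branch 5 (.viol 7 9 [2, 3, 4] [16]) (.viol 7 9 [5,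
    16] [2, 3, 4])) (.branch 8 (.branch 5 (.viol 7 9 [5, 8, 6] [16]) (.viol 3 8 [4, 9, 6] [16, 5]))
    (.branch 7 (.viol 3 8 [2, 7, 5] [16]) (.viol 3 8 [4, 9, 6] [16])))) (.branch 7 (.branch 5
    (.viol 3 8 [4, 16] [2, 7, 5]) (.split 4 3 9 (.split 5 7 8 (.iso 0 [0, 16, 4, 3, 2, 6, 5, 9, 8,
    7]) (.viol 3 4 [2, 7, 9] [8, 5, 16]) (.viol 4 9 [3, 8, 6] [16, 5, 7]) (.viol 3 4 [2, 7, 9] [8,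
    20, 5, 16])) (.split 5 7 8 (.viol 5 7 [8, 3, 2] [16, 4, 9]) (.iso 1 [0, 0, 0, 19, 5, 8, 6, 9,
    7, 2, 3, 17, 4, 16]) (.viol 4 9 [17, 3, 8, 6] [16, 5, 7]) (.viol 4 9 [17, 3, 8, 6] [16, 5, 19,
    7])) (.split 5 7 8 (.viol 5 8 [7, 9, 6] [16, 4, 3]) (.viol 3 4 [2, 7, 9, 18] [8, 5, 16]) (.iso
    1 [0, 0, 0, 20, 5, 7, 2, 3, 8, 6, 9, 18, 4, 16]) (.viol 3 4 [2, 7, 9, 18] [8, 20, 5, 16]))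
    (.split 5 7 8 (.viol 5 7 [8, 3, 2] [16, 4, 18, 9]) (.viol 3 8 [2, 7, 9, 6] [17, 4, 16, 5])
    (.viol 5 7 [20, 8, 3, 2] [16, 4, 18, 9]) (.viol 3 8 [2, 7, 9, 6] [17, 4, 16, 5, 20])))) (.viol
    7 9 [5, 8, 6] [16, 4]))) (.branch 3 (.branch 4 (.branch 5 (.viol 7 9 [2, 3, 4] [16, 6]) (.viol
    7 9 [5, 16, 6] [2, 3, 4])) (.viol 3 8 [4, 16, 6] [2, 7, 5])) (.viol 3 8 [2, 7, 5] [16, 6])))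
    (.branch 4 (.branch 5 (.branch 8 (.branch 6 (.viol 7 9 [5, 8, 6] [2, 16]) (.split 2 3 7 (.split
    6 8 9 (.iso 0 [0, 16, 2, 3, 4, 5, 6, 7, 8, 9]) (.viol 2 7 [3, 8, 5] [16, 6, 9]) (.viol 2 3 [7,
    9, 4] [16, 6, 8]) (.viol 2 3 [7, 9, 4] [16, 6, 19, 8])) (.split 6 8 9 (.viol 6 9 [8, 3, 4] [16,
    2, 7]) (.viol 2 7 [17, 3, 8, 5] [16, 6, 9]) (.iso 1 [0, 0, 0, 20, 6, 8, 5, 7, 9, 4, 3, 17, 2,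
    16]) (.viol 2 7 [17, 3, 8, 5] [16, 6, 20, 9])) (.split 6 8 9 (.viol 6 8 [9, 7, 5] [16, 2, 3])
    (.iso 1 [0, 0, 0, 19, 6, 9, 4, 3, 8, 5, 7, 18, 2, 16]) (.viol 2 3 [18, 7, 9, 4] [16, 6, 8])
    (.viol 2 3 [18, 7, 9, 4] [16, 6, 19, 8])) (.split 6 8 9 (.viol 6 8 [9, 7, 5] [16, 2, 17, 3])
    (.viol 6 9 [19, 8, 3, 4] [16, 2, 18, 7]) (.viol 3 8 [4, 9, 7, 5] [17, 2, 16, 6]) (.viol 3 8 [4,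
    9, 7, 5] [17, 2, 16, 6, 19])))) (.viol 3 8 [4, 9, 6] [2, 16])) (.viol 3 8 [4, 9, 6] [2, 16,
    5])) (.viol 7 9 [5, 8, 6] [2, 16, 4]))

theorem pet₈_blob :
    pet₈.blobCheck [pet₉.pat, hea₁₁.pat] pet₈BlobCert = true := by
  decide +kernel

/-- A certificate for adding a point to `pet₉`. -/
def pet₉PointCert : Cert :=
  .branch 2 (.branch 1 (.branch 3 (.branch 5 (.branch 7 (.branch 6 (.viol 3 8 [4, 16] [2, 7, 5])
    (.viol 3 8 [4, 16, 6] [2, 7, 5])) (.viol 7 9 [2, 1, 6] [16, 4])) (.branch 6 (.branch 9 (.viol 3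
    8 [4, 16, 5] [2, 1, 6]) (.viol 6 8 [9, 16, 5] [1, 2, 3])) (.viol 6 8 [16, 5] [1, 2, 3])))
    (.viol 3 8 [2, 1, 6] [16, 5])) (.branch 3 (.branch 4 (.branch 7 (.branch 8 (.branch 9 (.viol 2
    7 [3, 4, 9] [1, 16, 5]) (.viol 6 9 [1, 16] [8, 3, 4])) (.viol 2 3 [7, 9, 4] [1, 16, 8])) (.viol
    2 7 [3, 4, 9] [1, 16])) (.branch 7 (.branch 6 (.branch 8 (.branch 5 (.viol 2 3 [7, 5, 8] [1,
    16, 4]) (.branch 9 (.split 1 2 6 (.split 4 3 9 (.split 5 7 8 (.iso 0 [16, 1, 2, 3, 4, 5, 6, 7,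
    8, 9]) (.viol 1 6 [2, 7, 9] [16, 5, 8]) (.viol 1 2 [6, 8, 3] [16, 5, 7]) (.viol 1 2 [6, 8, 3]
    [16, 5, 21, 7])) (.viol 1 6 [2, 3, 8] [16, 4, 9]) (.viol 1 2 [6, 9, 7] [16, 4, 3]) (.viol 1 2
    [6, 9, 7] [16, 4, 19, 3])) (.split 4 3 9 (.viol 4 9 [3, 2, 7] [16, 1, 6]) (.viol 1 6 [17, 2, 3,
    8] [16, 4, 9]) (.split 5 7 8 (.viol 5 8 [7, 2, 3] [16, 1, 6]) (.viol 1 6 [17, 2, 7, 9] [16, 5,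
    8]) (.iso 1 [0, 22, 5, 16, 1, 6, 8, 3, 4, 20, 9, 7, 2, 17]) (.viol 1 6 [17, 2, 7, 9] [16, 5,
    22, 8])) (.viol 1 6 [17, 2, 3, 8] [16, 4, 20, 9])) (.split 4 3 9 (.viol 3 4 [2, 1, 16] [8, 6,
    9]) (.split 5 7 8 (.viol 5 7 [8, 6, 9] [16, 1, 2]) (.iso 1 [0, 21, 5, 16, 1, 2, 7, 9, 4, 19, 3,
    8, 6, 18]) (.viol 1 2 [18, 6, 8, 3] [16, 5, 7]) (.viol 1 2 [18, 6, 8, 3] [16, 5, 21, 7]))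
    (.viol 1 2 [18, 6, 9, 7] [16, 4, 3]) (.viol 1 2 [18, 6, 9, 7] [16, 4, 19, 3])) (.split 4 3 9
    (.viol 3 4 [2, 17, 1, 16] [8, 6, 9]) (.viol 4 9 [19, 3, 2, 7] [16, 1, 18, 6]) (.viol 2 3 [7, 9,
    6, 8] [17, 1, 16, 4]) (.viol 2 3 [7, 9, 6, 8] [17, 1, 16, 4, 19]))) (.viol 9 16 [7, 5] [4])))
    (.viol 8 16 [6, 1] [3, 4])) (.viol 6 16 [9, 4] [1, 2])) (.viol 7 16 [2, 1] [9, 4]))) (.branch 5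
    (.viol 2 3 [7, 5, 8] [1, 16]) (.viol 3 16 [2, 1] [8, 5])))) (.branch 4 (.viol 2 7 [3, 4, 9]
    [16, 5]) (.branch 5 (.viol 2 3 [7, 5, 8] [16, 4]) (.viol 2 16 [7, 5] [3, 4])))

theorem pet₉_point :
    pet₉.pointCheck [pet₁₀.pat, hea₁₃.pat] pet₉PointCert = true := by
  decide +kernel

/-- A certificate for adding a blob to `pet₉`. -/
def pet₉BlobCert : Cert :=
  .branch 1 (.branch 2 (.branch 6 (.branch 3 (.branch 4 (.branch 5 (.branch 7 (.viol 6 8 [9, 16]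
    [1, 2, 3]) (.viol 7 9 [5, 8, 6] [16])) (.viol 6 8 [9, 16, 5] [1, 2, 3])) (.branch 5 (.branch 7
    (.viol 3 8 [4, 16] [2, 7, 5]) (.viol 2 3 [7, 16, 4] [1, 6, 8])) (.viol 3 8 [4, 16, 5] [2, 1,
    6]))) (.branch 5 (.branch 7 (.viol 3 8 [4, 9, 7, 5] [16]) (.viol 2 3 [7, 16] [1, 6, 8])) (.viol
    2 7 [3, 16, 5] [1, 6, 9]))) (.branch 3 (.branch 4 (.branch 5 (.branch 7 (.branch 8 (.viol 6 9
    [16] [1, 2, 7]) (.viol 6 8 [16] [9, 7, 5])) (.viol 6 9 [16, 7] [8, 3, 4])) (.viol 6 8 [16, 5]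
    [9, 4, 3])) (.viol 3 8 [4, 16, 6] [2, 7, 5])) (.viol 3 8 [2, 7, 5] [16, 6]))) (.branch 3
    (.branch 4 (.branch 5 (.branch 7 (.branch 8 (.viol 2 7 [3, 8, 5] [16, 9]) (.viol 2 3 [7, 9, 4]
    [16, 8])) (.viol 2 7 [3, 4, 9] [16])) (.viol 2 7 [3, 4, 9] [16, 5])) (.viol 2 3 [7, 5, 8] [16,
    4])) (.viol 2 3 [7, 5, 8] [16]))) (.branch 3 (.branch 4 (.branch 5 (.branch 7 (.branch 8 (.viol
    2 7 [3, 8, 5] [1, 16, 9]) (.viol 2 3 [7, 9, 4] [1, 16, 8])) (.viol 2 7 [3, 4, 9] [1, 16]))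
    (.viol 2 7 [3, 4, 9] [1, 16, 5])) (.viol 2 3 [7, 5, 8] [1, 16, 4])) (.viol 2 3 [7, 5, 8] [1,
    16]))

theorem pet₉_blob :
    pet₉.blobCheck [pet₁₀.pat, hea₁₃.pat] pet₉BlobCert = true := by
  decide +kernel

theorem pet₁₀_point :
    pet₁₀.pointCheck [] (.tri 0 0 0) = true := by
  decide +kernel

/-- A certificate for adding a blob to `pet₁₀`. -/
def pet₁₀BlobCert : Cert :=
  .branch 0 (.branch 1 (.branch 2 (.branch 3 (.branch 4 (.branch 5 (.branch 6 (.branch 7 (.viol 3 4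
    [2, 1, 0] [8, 16, 9]) (.branch 8 (.viol 7 9 [5, 8, 6] [16]) (.viol 2 3 [7, 16, 8] [1, 0, 4])))
    (.branch 7 (.branch 8 (.viol 6 9 [16] [1, 2, 7]) (.viol 6 8 [16] [9, 7, 5])) (.viol 1 2 [6, 16,
    7] [0, 4, 3]))) (.branch 6 (.branch 7 (.branch 8 (.viol 0 4 [5, 16, 9] [1, 2, 3]) (.viol 5 8
    [7, 2, 3] [16])) (.viol 5 7 [16] [8, 6, 9])) (.viol 0 1 [5, 16, 6] [4, 3, 2]))) (.branch 5
    (.branch 6 (.branch 7 (.branch 8 (.viol 4 9 [16] [3, 2, 7]) (.viol 0 5 [4, 16, 8] [1, 2, 7]))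
    (.viol 0 5 [4, 16, 7] [1, 6, 8])) (.viol 0 1 [5, 7, 2] [4, 16, 6])) (.viol 0 4 [5, 16] [1, 6,
    9]))) (.branch 4 (.branch 5 (.branch 6 (.branch 7 (.branch 8 (.viol 2 7 [3, 16, 9] [1, 0, 5])
    (.viol 3 8 [4, 9, 7, 5] [16])) (.viol 2 3 [7, 16] [1, 6, 8])) (.viol 1 2 [6, 16, 3] [0, 5, 7]))
    (.viol 0 4 [5, 16, 3] [1, 6, 9])) (.viol 3 4 [2, 7, 5, 0] [16]))) (.branch 3 (.branch 4
    (.branch 5 (.branch 6 (.branch 7 (.branch 8 (.viol 1 6 [2, 16, 9] [0, 5, 8]) (.viol 1 6 [2, 16,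
    8] [0, 4, 9])) (.viol 2 7 [3, 4, 9] [16])) (.viol 1 2 [6, 16] [0, 5, 7])) (.viol 0 1 [5, 16, 2]
    [4, 9, 6])) (.viol 0 1 [5, 8, 6] [4, 16, 2])) (.viol 2 3 [7, 5, 8] [16]))) (.branch 2 (.branch
    3 (.branch 4 (.branch 5 (.branch 6 (.branch 7 (.branch 8 (.viol 0 4 [5, 8, 3] [1, 16, 9])
    (.viol 0 5 [4, 9, 7] [1, 16, 8])) (.viol 0 5 [4, 3, 8] [1, 16, 7])) (.viol 1 6 [2, 7, 5, 8]
    [16])) (.viol 0 1 [5, 16] [4, 3, 2])) (.viol 0 1 [5, 7, 2] [4, 16])) (.viol 0 4 [5, 7, 9] [1,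
    16, 3])) (.viol 1 2 [6, 9, 7] [16]))) (.branch 1 (.branch 2 (.branch 3 (.branch 4 (.branch 5
    (.branch 6 (.branch 7 (.branch 8 (.viol 0 4 [5, 8, 3] [16, 9]) (.viol 0 5 [4, 9, 7] [16, 8]))
    (.viol 0 5 [4, 3, 8] [16, 7])) (.viol 0 1 [5, 7, 2] [16, 6])) (.viol 0 5 [4, 3, 2, 7] [16]))
    (.viol 0 4 [5, 7, 2, 3] [16])) (.viol 0 4 [5, 7, 9] [16, 3])) (.viol 0 1 [5, 8, 6] [16, 2]))
    (.viol 0 1 [5, 7, 2] [16]))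

theorem pet₁₀_blob :
    pet₁₀.blobCheck [] pet₁₀BlobCert = true := by
  decide +kernel

/-- A certificate for adding a point to `hea₁₁`. -/
def hea₁₁PointCert : Cert :=
  .branch 6 (.branch 5 (.branch 7 (.branch 4 (.branch 8 (.branch 12 (.branch 3 (.branch 13 (.viol 7
    8 [6, 5, 4, 3] [12, 11, 16, 9]) (.branch 10 (.branch 11 (.split 9 8 10 (.split 13 4 12 (.iso 0
    [0, 0, 16, 9, 8, 7, 6, 5, 10, 11, 12, 13, 4, 3]) (.viol 7 8 [6, 5, 4, 3] [12, 13, 16, 9])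
    (.viol 5 10 [6, 7, 12, 11] [4, 13, 16, 9]) (.viol 5 10 [6, 7, 12, 11] [4, 19, 13, 16, 9]))
    (.viol 4 5 [3, 8, 7, 6] [13, 16, 9, 10]) (.viol 7 12 [6, 5, 10, 11] [8, 9, 16, 13]) (.viol 4 5
    [3, 8, 7, 6] [13, 16, 9, 18, 10])) (.viol 4 5 [3, 8, 7, 6] [13, 16, 11, 10])) (.viol 4 5 [3, 8,
    7, 6] [13, 16, 11, 10]))) (.branch 13 (.branch 9 (.branch 10 (.split 3 4 8 (.split 11 10 12
    (.iso 0 [0, 0, 16, 3, 4, 5, 6, 7, 8, 9, 10, 11, 12, 13]) (.viol 3 4 [8, 9, 10, 5] [16, 11, 12,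
    13]) (.viol 3 4 [8, 7, 12, 13] [16, 11, 10, 5]) (.viol 3 4 [8, 7, 12, 13] [16, 11, 19, 10, 5]))
    (.viol 7 12 [6, 5, 4, 13] [8, 3, 16, 11]) (.viol 5 10 [6, 7, 8, 9] [4, 3, 16, 11]) (.viol 5 10
    [6, 7, 8, 9] [4, 17, 3, 16, 11])) (.viol 4 5 [3, 16, 10] [13, 12, 7, 6])) (.viol 4 5 [3, 16, 9,
    10] [13, 12, 7, 6])) (.branch 10 (.branch 9 (.viol 7 8 [6, 5, 10, 9] [12, 13, 16, 3]) (.split 3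
    4 8 (.viol 3 16 [4, 13] [8, 9]) (.viol 3 16 [8, 9] [17, 4, 13]) (.viol 3 16 [4, 13] [18, 8, 9])
    (.viol 3 16 [18, 8, 9] [17, 4, 13]))) (.viol 10 16 [11, 12, 13] [9, 8, 3])))) (.branch 13
    (.branch 10 (.branch 9 (.viol 7 8 [6, 5, 10, 9] [12, 16, 3]) (.viol 7 12 [6, 5, 4, 13] [8, 9,
    16])) (.viol 10 16 [11, 12, 13] [9, 8, 3])) (.viol 12 16 [13] [11, 10, 9, 8, 3]))) (.branch 3
    (.branch 10 (.branch 11 (.viol 7 12 [6, 5, 10, 11] [8, 16, 13]) (.viol 7 8 [6, 5, 4, 3] [12,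
    11, 16])) (.viol 10 16 [11, 12, 13] [9, 8])) (.viol 8 16 [3] [9, 10, 11, 12, 13]))) (.branch 3
    (.branch 13 (.branch 8 (.branch 12 (.branch 9 (.viol 4 5 [3, 8, 7, 6] [16, 11, 10]) (.viol 4 5
    [13, 12, 7, 6] [16, 9, 10])) (.viol 12 16 [13, 4] [11, 10, 9])) (.viol 8 16 [3, 4, 13] [9, 10,
    11])) (.viol 4 16 [3, 8, 9, 10, 11] [13])) (.viol 4 16 [3] [13, 12, 11, 10, 9]))) (.branch 13
    (.branch 11 (.branch 3 (.branch 4 (.viol 7 8 [12, 13, 4, 3] [16, 10, 9]) (.branch 9 (.viol 7 8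
    [12, 11, 10, 9] [16, 4, 3]) (.viol 7 16 [6, 5, 4, 13] [8, 9]))) (.branch 9 (.branch 10 (.viol 7
    8 [12, 11, 10, 9] [16, 4, 3]) (.viol 7 16 [6, 5, 10, 11] [8, 3])) (.split 3 4 8 (.sq 3 8 7 16)
    (.sq 3 8 7 16) (.viol 7 16 [6, 5, 4, 3] [8, 9]) (.viol 7 16 [6, 5, 4, 17, 3] [8, 9]))))
    (.branch 4 (.viol 7 12 [6, 5, 4, 13] [16, 11]) (.viol 7 16 [12, 11] [8, 3, 4, 5]))) (.branch 11
    (.branch 10 (.viol 7 12 [6, 5, 10, 11] [16, 13]) (.viol 7 16 [6, 5, 10] [12, 13])) (.split 11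
    10 12 (.sq 7 12 11 16) (.sq 7 12 11 16) (.viol 7 16 [6, 5, 10, 11] [12, 13]) (.viol 7 16 [6, 5,
    10, 17, 11] [12, 13]))))) (.branch 3 (.branch 13 (.branch 9 (.branch 8 (.viol 5 10 [4, 3, 8, 9]
    [16, 12, 11]) (.branch 11 (.viol 4 5 [3, 8, 16] [13, 12, 11, 10]) (.viol 5 16 [6, 7, 8] [10,
    11]))) (.branch 11 (.branch 12 (.viol 5 10 [4, 13, 12, 11] [16, 9]) (.viol 5 16 [6, 7, 12, 13]
    [10, 9])) (.split 9 8 10 (.sq 5 10 9 16) (.sq 5 10 9 16) (.viol 5 16 [6, 7, 8, 9] [10, 11])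
    (.viol 5 16 [6, 7, 8, 17, 9] [10, 11])))) (.branch 9 (.branch 8 (.viol 4 5 [3, 8, 9, 10] [13,
    16]) (.viol 5 16 [6, 7, 8, 9] [4, 13])) (.viol 5 16 [6, 7, 12, 13] [10, 9]))) (.branch 13
    (.branch 11 (.branch 12 (.viol 4 5 [3, 16] [13, 12, 11, 10]) (.viol 5 16 [6, 7, 12] [4, 3]))
    (.viol 5 16 [4, 3, 8] [10, 11])) (.split 3 4 8 (.sq 3 4 5 16) (.viol 5 16 [6, 7, 8, 3] [4, 13])
    (.sq 3 4 5 16) (.viol 5 16 [6, 7, 8, 18, 3] [4, 13]))))) (.branch 9 (.branch 8 (.branch 10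
    (.branch 3 (.branch 4 (.branch 13 (.viol 5 10 [6, 16, 12, 11] [4, 3, 8, 9]) (.viol 4 5 [3, 8,
    9, 10] [13, 16, 6])) (.viol 4 5 [3, 8, 9, 10] [16, 6])) (.branch 11 (.branch 12 (.viol 7 8 [6,
    16, 4, 3] [12, 11, 10, 9]) (.viol 7 12 [6, 16] [8, 9, 10, 11])) (.split 6 5 7 (.viol 6 16 [7,
    12, 11] [5, 4, 3]) (.viol 6 16 [7, 12, 11] [17, 5, 4, 3]) (.viol 6 16 [5, 4, 3] [18, 7, 12,
    11]) (.viol 6 16 [18, 7, 12, 11] [17, 5, 4, 3])))) (.branch 3 (.viol 5 10 [6, 16] [4, 3, 8, 9])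
    (.viol 10 16 [5, 6] [9, 8, 3]))) (.branch 11 (.branch 10 (.viol 7 8 [6, 16] [12, 11, 10, 9])
    (.viol 8 16 [7, 6] [9, 10, 11])) (.viol 8 16 [7, 6] [9, 10, 11]))) (.branch 3 (.branch 13
    (.branch 4 (.branch 12 (.viol 7 8 [6, 16, 10, 9] [12, 13, 4, 3]) (.viol 7 12 [6, 16] [8, 3, 4,
    13])) (.viol 4 16 [5, 6] [3, 8, 9])) (.split 6 5 7 (.viol 6 16 [7, 12, 13] [5, 10, 9]) (.viol 6
    16 [7, 12, 13] [17, 5, 10, 9]) (.viol 6 16 [5, 4, 13] [18, 7, 8, 9]) (.viol 6 16 [18, 7, 12,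
    13] [17, 5, 10, 9]))) (.split 3 4 8 (.viol 3 16 [4, 5, 6] [8, 9]) (.viol 3 16 [8, 9] [17, 4, 5,
    6]) (.viol 3 16 [4, 5, 6] [18, 8, 9]) (.viol 3 16 [18, 8, 9] [17, 4, 5, 6]))))

theorem hea₁₁_point :
    hea₁₁.pointCheck [hea₁₂.pat] hea₁₁PointCert = true := by
  decide +kernel

/-- A certificate for adding a blob to `hea₁₁`. -/
def hea₁₁BlobCert : Cert :=
  .branch 3 (.branch 5 (.branch 6 (.branch 7 (.branch 13 (.branch 4 (.branch 8 (.branch 11 (.viol 7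
    8 [6, 5, 4, 3] [12, 16, 9]) (.viol 7 8 [6, 5, 4, 3] [12, 11, 16, 9])) (.branch 11 (.viol 7 8
    [6, 5, 4, 3] [12, 16]) (.viol 7 8 [6, 5, 4, 3] [12, 11, 16]))) (.branch 8 (.branch 9 (.viol 4 5
    [3, 8, 7, 6] [16, 11, 10]) (.viol 4 5 [13, 12, 7, 6] [16, 9, 10])) (.branch 12 (.viol 4 5 [13,
    12, 7, 6] [16, 9, 10]) (.viol 7 8 [6, 5, 10, 9] [12, 16])))) (.branch 8 (.branch 9 (.viol 4 5
    [3, 8, 7, 6] [13, 16, 11, 10]) (.split 9 8 10 (.split 13 4 12 (.iso 0 [0, 0, 16, 9, 8, 7, 6, 5,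
    10, 11, 12, 13, 4, 3]) (.viol 7 8 [6, 5, 4, 3] [12, 13, 16, 9]) (.viol 5 10 [6, 7, 12, 11] [4,
    13, 16, 9]) (.viol 5 10 [6, 7, 12, 11] [4, 19, 13, 16, 9])) (.viol 4 5 [3, 8, 7, 6] [13, 16, 9,
    10]) (.viol 7 12 [6, 5, 10, 11] [8, 9, 16, 13]) (.viol 4 5 [3, 8, 7, 6] [13, 16, 9, 18, 10])))
    (.viol 7 8 [6, 5, 10, 9] [12, 13, 16]))) (.branch 8 (.branch 9 (.branch 12 (.branch 4 (.branch
    13 (.viol 7 12 [16, 10, 11] [8, 3, 4, 13]) (.viol 7 12 [16, 4, 13] [8, 9, 10, 11])) (.viol 7 8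
    [12, 11, 10, 9] [16, 4, 3])) (.viol 7 12 [6, 5, 4, 13] [16])) (.viol 7 8 [6, 5, 4, 3] [16, 9]))
    (.viol 7 8 [6, 5, 4, 3] [16]))) (.branch 8 (.branch 4 (.branch 13 (.branch 9 (.branch 10 (.viol
    5 10 [6, 16, 12, 11] [4, 3, 8, 9]) (.viol 5 10 [6, 16] [4, 3, 8, 9])) (.viol 5 10 [6, 16, 8, 9]
    [4, 13, 12, 11])) (.viol 7 12 [6, 16, 4, 13] [8, 9, 10, 11])) (.viol 4 5 [3, 8, 9, 10] [16,
    6])) (.viol 4 5 [3, 8, 16, 6] [13, 12, 11, 10]))) (.branch 4 (.branch 10 (.branch 13 (.branch 8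
    (.branch 9 (.viol 5 10 [4, 3, 8, 9] [16, 12, 11]) (.viol 5 10 [4, 13, 12, 11] [16, 8, 9]))
    (.viol 4 5 [3, 8, 16] [13, 12, 11, 10])) (.viol 4 5 [3, 8, 7, 6] [13, 16])) (.viol 5 10 [6, 7,
    12, 11] [16])) (.viol 4 5 [3, 8, 7, 6] [16]))) (.branch 12 (.branch 13 (.branch 5 (.branch 6
    (.branch 7 (.branch 11 (.viol 4 5 [3, 16, 9, 10] [13, 12, 7, 6]) (.split 3 4 8 (.split 11 10 12
    (.iso 0 [0, 0, 16, 3, 4, 5, 6, 7, 8, 9, 10, 11, 12, 13]) (.viol 3 4 [8, 9, 10, 5] [16, 11, 12,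
    13]) (.viol 3 4 [8, 7, 12, 13] [16, 11, 10, 5]) (.viol 3 4 [8, 7, 12, 13] [16, 11, 19, 10, 5]))
    (.viol 7 12 [6, 5, 4, 13] [8, 3, 16, 11]) (.viol 5 10 [6, 7, 8, 9] [4, 3, 16, 11]) (.viol 5 10
    [6, 7, 8, 9] [4, 17, 3, 16, 11]))) (.viol 7 8 [6, 5, 10, 9] [16, 3])) (.viol 4 5 [3, 16, 6]
    [13, 12, 11, 10])) (.viol 4 5 [3, 16] [13, 12, 7, 6])) (.viol 7 8 [6, 5, 10, 9] [12, 13, 16,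
    3])) (.viol 7 8 [6, 5, 10, 9] [12, 16, 3]))

theorem hea₁₁_blob :
    hea₁₁.blobCheck [hea₁₂.pat] hea₁₁BlobCert = true := by
  decide +kernel

/-- A certificate for adding a point to `hea₁₂`. -/
def hea₁₂PointCert : Cert :=
  .branch 5 (.branch 10 (.branch 11 (.branch 3 (.branch 4 (.branch 2 (.branch 8 (.branch 12
    (.branch 13 (.viol 11 12 [10, 9, 16, 6, 7] [2, 3, 4, 13]) (.branch 6 (.branch 7 (.split 9 8 10
    (.split 13 4 12 (.iso 0 [0, 16, 9, 8, 3, 4, 13, 12, 7, 6, 5, 10, 11, 2]) (.viol 7 8 [6, 5, 4,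
    3] [12, 13, 16, 9]) (.viol 3 8 [4, 13, 16, 9] [2, 11, 12, 7]) (.viol 3 8 [4, 19, 13, 16, 9] [2,
    11, 12, 7])) (.viol 4 5 [3, 8, 7, 6] [13, 16, 9, 10]) (.viol 3 4 [2, 11, 10, 5] [8, 9, 16, 13])
    (.viol 3 4 [2, 11, 10, 5] [8, 17, 9, 16, 13])) (.viol 3 4 [2, 11, 10, 5] [8, 7, 16, 13]))
    (.viol 4 5 [3, 2, 11, 10] [13, 16, 7, 6]))) (.branch 6 (.viol 7 8 [6, 5, 4, 3] [12, 16, 9])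
    (.viol 7 12 [6, 16] [8, 3, 2, 11]))) (.branch 6 (.viol 3 4 [2, 11, 10, 5] [8, 16, 13]) (.viol 7
    8 [6, 16] [12, 11, 2, 3]))) (.branch 9 (.branch 7 (.branch 8 (.branch 12 (.branch 13 (.split 2
    3 11 (.split 6 5 7 (.iso 0 [0, 16, 2, 3, 4, 5, 6, 7, 8, 9, 10, 11, 12, 13]) (.viol 2 3 [11, 10,
    5, 4] [16, 6, 7, 8]) (.viol 2 3 [11, 12, 7, 8] [16, 6, 5, 4]) (.viol 2 3 [11, 12, 7, 8] [16, 6,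
    19, 5, 4])) (.viol 5 10 [6, 16, 2, 11] [4, 3, 8, 9]) (.viol 4 5 [3, 2, 16, 6] [13, 12, 11, 10])
    (.viol 4 5 [3, 17, 2, 16, 6] [13, 12, 11, 10])) (.viol 3 4 [2, 16, 13] [8, 9, 10, 5])) (.viol 3
    4 [2, 16, 12, 13] [8, 9, 10, 5])) (.viol 3 8 [4, 5, 10, 9] [2, 16])) (.viol 3 8 [4, 5, 10, 9]
    [2, 16, 12, 7])) (.branch 13 (.branch 12 (.viol 10 11 [5, 4, 13, 12] [9, 16, 2]) (.viol 11 12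
    [10, 5, 4, 13] [2, 16])) (.split 2 3 11 (.viol 2 16 [3, 4, 13] [11, 10, 9]) (.viol 2 16 [11,
    12, 13] [17, 3, 8, 9]) (.viol 2 16 [3, 4, 13] [18, 11, 10, 9]) (.viol 2 16 [18, 11, 12, 13]
    [17, 3, 8, 9]))))) (.branch 2 (.branch 9 (.viol 4 5 [3, 2, 11, 10] [16, 7, 6]) (.branch 13
    (.branch 12 (.viol 3 4 [2, 11, 12, 13] [8, 9, 16]) (.viol 12 16 [7, 8, 9] [13, 4, 5])) (.viol 4
    16 [3, 8, 9, 10, 11] [13]))) (.branch 9 (.viol 3 4 [2, 16] [8, 9, 10, 5]) (.viol 4 16 [5, 10,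
    9] [3, 2])))) (.branch 9 (.branch 2 (.branch 6 (.viol 3 4 [16, 12, 13] [8, 9, 10, 5]) (.viol 3
    8 [2, 11, 10, 9] [16, 6, 7])) (.viol 3 16 [4, 13, 12, 7, 6] [2])) (.branch 6 (.viol 3 8 [4, 5,
    6, 7] [16, 9]) (.viol 3 16 [4, 5, 6] [8, 9])))) (.branch 9 (.branch 6 (.branch 8 (.viol 11 12
    [10, 9, 8, 7] [16, 4, 13]) (.viol 3 8 [4, 5, 6, 7] [2, 11, 16])) (.branch 2 (.branch 3 (.branch
    8 (.viol 10 11 [5, 6, 16] [9, 8, 3, 2]) (.viol 8 16 [7, 6] [3, 2, 11])) (.viol 11 16 [10, 5, 6]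
    [2, 3, 8])) (.viol 11 16 [10, 5, 6] [2, 3, 8]))) (.branch 6 (.viol 10 11 [5, 6, 7, 12] [9, 16])
    (.viol 11 16 [12, 7, 6] [10, 9])))) (.branch 6 (.branch 3 (.branch 2 (.branch 7 (.branch 8
    (.viol 4 5 [3, 8, 7, 6] [13, 16, 11, 10]) (.viol 8 16 [3, 4, 13] [9, 10, 11])) (.viol 5 10 [6,
    7, 16] [4, 3, 2, 11])) (.branch 13 (.viol 10 11 [5, 4, 13, 12] [16, 2]) (.viol 10 16 [5, 4, 13]
    [11, 2]))) (.viol 5 10 [6, 7, 12, 11] [4, 3, 16])) (.branch 13 (.viol 5 10 [6, 16] [4, 13, 12,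
    11]) (.viol 10 16 [5, 6] [11, 12, 13])))) (.branch 13 (.branch 2 (.branch 12 (.viol 5 10 [4,
    13, 12, 11] [16, 8, 9]) (.viol 7 12 [6, 5, 16] [8, 3, 2, 11])) (.branch 7 (.branch 6 (.branch
    12 (.viol 4 5 [3, 2, 16] [13, 12, 7, 6]) (.viol 12 16 [13, 4, 5, 6] [11, 2])) (.viol 5 16 [6]
    [4, 3, 2, 11, 12])) (.viol 7 16 [6, 5, 10] [8, 3, 2]))) (.branch 2 (.viol 4 5 [3, 2, 11, 10]
    [13, 16]) (.viol 5 16 [4, 13] [10, 11, 2])))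

theorem hea₁₂_point :
    hea₁₂.pointCheck [hea₁₃.pat] hea₁₂PointCert = true := by
  decide +kernel

/-- A certificate for adding a blob to `hea₁₂`. -/
def hea₁₂BlobCert : Cert :=
  .branch 3 (.branch 4 (.branch 5 (.branch 6 (.branch 8 (.branch 9 (.branch 7 (.branch 10 (.branch
    2 (.branch 12 (.viol 11 12 [10, 9, 8, 7] [16, 4, 13]) (.viol 11 12 [10, 5, 6, 7] [16])) (.viol
    3 4 [2, 16, 12, 13] [8, 9, 10, 5])) (.branch 2 (.branch 11 (.viol 10 11 [9, 8, 3, 2] [16, 13,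
    12]) (.viol 10 11 [5, 6, 7, 12] [16])) (.viol 4 5 [3, 2, 16, 9, 10] [13, 12, 7, 6]))) (.branch
    2 (.branch 12 (.branch 13 (.viol 7 12 [16, 10, 11] [8, 3, 4, 13]) (.viol 7 12 [16, 4, 13] [8,
    9, 10, 11])) (.viol 7 12 [6, 5, 4, 3, 2, 11] [16])) (.viol 3 8 [4, 5, 10, 9] [2, 16, 7])))
    (.branch 13 (.branch 2 (.branch 11 (.viol 10 11 [5, 4, 3, 2] [9, 16, 7, 12]) (.viol 7 12 [6, 5,
    4, 13] [8, 9, 16, 2, 11])) (.viol 3 8 [4, 5, 6, 7] [2, 16, 9])) (.split 9 8 10 (.split 13 4 12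
    (.iso 0 [0, 16, 9, 8, 3, 4, 13, 12, 7, 6, 5, 10, 11, 2]) (.viol 7 8 [6, 5, 4, 3] [12, 13, 16,
    9]) (.viol 3 8 [4, 13, 16, 9] [2, 11, 12, 7]) (.viol 3 8 [4, 19, 13, 16, 9] [2, 11, 12, 7]))
    (.viol 4 5 [3, 8, 7, 6] [13, 16, 9, 10]) (.viol 3 4 [2, 11, 10, 5] [8, 9, 16, 13]) (.viol 3 4
    [2, 11, 10, 5] [8, 17, 9, 16, 13])))) (.branch 7 (.branch 12 (.branch 13 (.viol 7 12 [6, 5, 4,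
    13] [8, 16, 2, 11]) (.viol 3 4 [2, 11, 10, 5] [8, 16, 13])) (.viol 7 8 [6, 5, 4, 3] [12, 16]))
    (.viol 7 8 [6, 5, 4, 3] [16]))) (.branch 2 (.branch 8 (.branch 9 (.branch 10 (.branch 11 (.viol
    10 11 [5, 6, 16, 13, 12] [9, 8, 3, 2]) (.viol 7 12 [6, 16, 10, 11] [8, 3, 4, 13])) (.viol 5 10
    [6, 16] [4, 3, 2, 11])) (.viol 5 10 [6, 16, 8, 9] [4, 13, 12, 11])) (.viol 3 4 [2, 11, 12, 13]
    [8, 16, 6, 5])) (.split 2 3 11 (.split 6 5 7 (.iso 0 [0, 16, 2, 3, 4, 5, 6, 7, 8, 9, 10, 11,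
    12, 13]) (.viol 2 3 [11, 10, 5, 4] [16, 6, 7, 8]) (.viol 2 3 [11, 12, 7, 8] [16, 6, 5, 4])
    (.viol 2 3 [11, 12, 7, 8] [16, 6, 19, 5, 4])) (.viol 5 10 [6, 16, 2, 11] [4, 3, 8, 9]) (.viol 4
    5 [3, 2, 16, 6] [13, 12, 11, 10]) (.viol 4 5 [3, 17, 2, 16, 6] [13, 12, 11, 10])))) (.branch 10
    (.branch 2 (.branch 11 (.branch 8 (.branch 9 (.viol 10 11 [5, 16, 13, 12] [9, 8, 3, 2]) (.viol
    5 10 [4, 13, 12, 11] [16, 8, 9])) (.viol 3 4 [2, 11, 12, 13] [8, 16, 5])) (.viol 5 10 [6, 7, 8,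
    9] [16, 2, 11])) (.viol 3 4 [2, 16, 5] [8, 7, 12, 13])) (.viol 5 10 [6, 7, 12, 11] [16])))
    (.branch 5 (.branch 8 (.branch 2 (.branch 9 (.branch 6 (.branch 7 (.viol 4 5 [3, 8, 7, 6] [16,
    11, 10]) (.viol 3 8 [4, 16, 6, 7] [2, 11, 10, 9])) (.viol 3 8 [4, 16, 6, 7] [2, 11, 10, 9]))
    (.viol 3 4 [2, 11, 12, 13] [8, 9, 16])) (.viol 3 4 [2, 16] [8, 7, 6, 5])) (.viol 3 4 [2, 11,
    12, 13] [8, 16])) (.viol 4 5 [3, 2, 11, 12, 7, 6] [16]))) (.branch 4 (.branch 5 (.branch 8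
    (.branch 6 (.branch 7 (.branch 9 (.branch 10 (.viol 3 4 [16, 12, 13] [8, 9, 10, 5]) (.viol 4 5
    [3, 16, 9, 10] [13, 12, 7, 6])) (.viol 3 8 [4, 5, 6, 7] [16, 9])) (.viol 3 8 [2, 11, 10, 9]
    [16, 6, 7])) (.viol 3 4 [2, 11, 12, 13] [16, 6, 5])) (.viol 3 8 [4, 5, 6, 7] [16])) (.viol 3 4
    [2, 11, 12, 13] [16, 5])) (.viol 3 4 [2, 11, 12, 7, 6, 5] [16]))

theorem hea₁₂_blob :
    hea₁₂.blobCheck [hea₁₃.pat] hea₁₂BlobCert = true := by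
  decide +kernel

/-- A certificate for adding a point to `hea₁₃`. -/
def hea₁₃PointCert : Cert :=
  .branch 10 (.branch 4 (.branch 5 (.branch 6 (.branch 7 (.branch 1 (.branch 3 (.branch 12 (.branch
    11 (.branch 2 (.viol 5 10 [6, 1, 2, 11] [4, 13, 16, 8, 9]) (.branch 9 (.viol 2 3 [16, 13, 4]
    [1, 6, 7, 8]) (.viol 10 11 [5, 6, 7, 12] [9, 16, 3, 2]))) (.branch 13 (.viol 2 3 [1, 6, 5, 4]
    [11, 16, 9, 8]) (.viol 11 12 [10, 5, 6, 7] [16, 13]))) (.viol 10 11 [5, 6, 1, 2] [9, 16, 13,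
    12])) (.branch 9 (.viol 2 11 [3, 16, 13, 12] [1, 6, 5, 10]) (.viol 3 8 [2, 1, 6, 7] [16, 10,
    9]))) (.branch 3 (.branch 11 (.branch 8 (.branch 9 (.viol 2 11 [3, 8, 9, 10] [1, 16, 13, 12])
    (.branch 2 (.branch 12 (.branch 13 (.viol 5 6 [4, 13, 12, 7] [10, 9, 16, 2, 1]) (.split 1 2 6
    (.split 9 8 10 (.split 13 4 12 (.iso 0 [16, 1, 2, 3, 4, 5, 6, 7, 8, 9, 10, 11, 12, 13]) (.viol
    1 2 [6, 5, 4, 3] [16, 13, 12, 11]) (.viol 1 2 [6, 7, 12, 11] [16, 13, 4, 3]) (.viol 1 2 [6, 7,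
    12, 11] [16, 13, 21, 4, 3])) (.viol 1 2 [6, 7, 8, 3] [16, 9, 10, 11]) (.viol 1 2 [6, 5, 10, 11]
    [16, 9, 8, 3]) (.viol 1 2 [6, 7, 8, 3] [16, 9, 20, 10, 11])) (.viol 4 5 [3, 2, 11, 10] [13, 16,
    1, 6]) (.viol 3 4 [2, 1, 16, 13] [8, 7, 6, 5]) (.viol 3 4 [2, 17, 1, 16, 13] [8, 7, 6, 5])))
    (.viol 7 8 [6, 5, 4, 3] [12, 16, 9])) (.viol 10 11 [5, 6, 7, 12] [9, 16, 3, 2]))) (.viol 2 3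
    [1, 16, 8] [11, 10, 5, 4])) (.viol 2 11 [3, 4, 5, 10] [1, 16])) (.viol 2 3 [1, 16] [11, 10, 5,
    4]))) (.branch 1 (.branch 2 (.branch 9 (.viol 5 6 [4, 13, 16, 8, 7] [10, 11, 2, 1]) (.viol 5 6
    [4, 3, 2, 1] [10, 9, 16, 12, 7])) (.viol 2 3 [16, 7, 8] [11, 10, 5, 4])) (.viol 2 3 [1, 16, 7,
    8] [11, 10, 5, 4]))) (.branch 9 (.branch 3 (.branch 11 (.viol 2 3 [1, 6, 16, 13, 4] [11, 10, 9,
    8]) (.viol 2 11 [3, 8, 9, 10] [1, 6, 16])) (.viol 2 3 [1, 6, 16] [11, 10, 9, 8])) (.branch 13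
    (.viol 5 6 [4, 13, 12, 7] [10, 9, 16]) (.viol 6 16 [7, 12, 13] [5, 10, 9])))) (.branch 8
    (.branch 13 (.branch 12 (.branch 9 (.viol 5 6 [4, 13, 12, 7] [16, 2, 1]) (.viol 5 10 [6, 7, 12,
    11] [16, 9])) (.viol 7 12 [6, 5, 16] [8, 3, 2, 11])) (.viol 4 5 [3, 8, 7, 6] [13, 16])) (.viol
    3 8 [4, 5, 16] [2, 11, 12, 7]))) (.branch 1 (.branch 7 (.branch 11 (.viol 3 4 [2, 1, 6, 5] [8,
    9, 16]) (.viol 2 3 [1, 6, 7, 8] [11, 16, 13, 4])) (.viol 3 4 [2, 11, 10, 5] [8, 7, 16]))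
    (.branch 9 (.viol 3 4 [2, 1, 16] [8, 9, 10, 5]) (.viol 4 16 [5, 6, 1] [3, 8, 9])))) (.branch 1
    (.branch 3 (.branch 7 (.viol 3 8 [4, 13, 16, 10, 9] [2, 1, 6, 7]) (.viol 5 6 [4, 3, 2, 1] [10,
    16, 7])) (.viol 2 3 [1, 6, 7, 8] [11, 10, 16])) (.branch 13 (.viol 5 10 [6, 1, 16] [4, 13, 12,
    11]) (.viol 10 16 [5, 6, 1] [11, 12, 13])))

theorem hea₁₃_point :
    hea₁₃.pointCheck [hea₁₄.pat] hea₁₃PointCert = true := by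
  decide +kernel

/-- A certificate for adding a blob to `hea₁₃`. -/
def hea₁₃BlobCert : Cert :=
  .branch 3 (.branch 5 (.branch 7 (.branch 2 (.branch 4 (.branch 1 (.branch 6 (.branch 11 (.branch
    8 (.branch 9 (.viol 6 7 [5, 10, 16, 13, 12] [1, 2, 3, 8]) (.viol 3 4 [2, 1, 6, 5] [8, 9, 16,
    12, 13])) (.viol 3 4 [2, 1, 6, 5] [8, 16, 12, 13])) (.branch 10 (.branch 12 (.branch 13 (.viol
    2 3 [1, 6, 5, 4] [11, 16, 9, 8]) (.viol 11 12 [10, 9, 8, 7] [16, 4, 13])) (.viol 11 12 [10, 5,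
    6, 7] [16])) (.viol 10 11 [5, 6, 7, 12] [16]))) (.branch 8 (.branch 9 (.branch 10 (.branch 11
    (.viol 2 11 [3, 8, 9, 10] [1, 6, 16, 13, 12]) (.viol 7 12 [6, 16, 10, 11] [8, 3, 4, 13]))
    (.viol 2 11 [3, 4, 13, 12] [1, 6, 16, 9, 10])) (.viol 5 10 [6, 16, 8, 9] [4, 13, 12, 11]))
    (.viol 6 7 [5, 10, 11, 12] [16, 3, 8]))) (.branch 8 (.branch 9 (.branch 10 (.branch 11 (.viol 3
    4 [2, 1, 16, 12, 13] [8, 9, 10, 5]) (.viol 7 12 [6, 1, 16, 10, 11] [8, 3, 4, 13])) (.viol 2 11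
    [3, 8, 7, 12] [1, 16, 5, 10])) (.viol 5 10 [6, 1, 16, 8, 9] [4, 13, 12, 11])) (.viol 6 7 [5,
    10, 11, 12] [1, 16, 3, 8]))) (.branch 1 (.branch 6 (.branch 8 (.branch 9 (.viol 4 5 [3, 8, 7,
    6] [16, 11, 10]) (.viol 5 10 [6, 1, 2, 11] [4, 16, 8, 9])) (.viol 3 4 [2, 1, 6, 5] [8, 16]))
    (.viol 4 5 [3, 8, 9, 10] [16, 1, 6])) (.viol 2 3 [1, 16, 4] [11, 12, 7, 8]))) (.branch 4
    (.branch 8 (.branch 11 (.branch 9 (.branch 10 (.viol 3 4 [2, 16, 12, 13] [8, 9, 10, 5]) (.viol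
    2 11 [16, 5, 10] [3, 8, 7, 12])) (.viol 10 11 [5, 4, 13, 12] [9, 16, 1, 2])) (.viol 2 11 [16]
    [3, 4, 5, 6, 7, 12])) (.viol 2 3 [16, 7, 8] [11, 10, 5, 4])) (.viol 10 11 [5, 4, 16, 1, 2] [9,
    8, 7, 12]))) (.branch 1 (.branch 6 (.branch 8 (.branch 12 (.branch 2 (.branch 9 (.branch 4
    (.branch 13 (.viol 7 12 [16, 10, 11] [8, 3, 4, 13]) (.viol 7 12 [6, 1, 2, 11] [16, 4, 13]))
    (.viol 3 8 [4, 16, 6, 7] [2, 11, 10, 9])) (.viol 11 12 [10, 9, 16, 6, 7] [2, 3, 4, 13])) (.viol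
    2 3 [16, 7, 8] [11, 10, 5, 4])) (.viol 7 12 [6, 5, 4, 3, 2, 11] [16])) (.viol 7 8 [6, 5, 4, 3]
    [16])) (.viol 6 7 [5, 4, 3, 2, 11, 12] [16])) (.viol 2 3 [1, 16, 7, 8] [11, 10, 5, 4])))
    (.branch 1 (.branch 4 (.branch 6 (.branch 7 (.branch 10 (.branch 2 (.branch 11 (.branch 8
    (.branch 9 (.viol 6 7 [5, 16, 13, 12] [1, 2, 3, 8]) (.viol 5 10 [6, 1, 2, 11] [16, 8, 9]))
    (.viol 3 4 [2, 11, 12, 13] [8, 16, 5])) (.viol 5 10 [6, 7, 8, 9] [16, 2, 11])) (.viol 10 11 [5,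
    16, 1, 2] [9, 8, 7, 12])) (.viol 5 10 [6, 7, 12, 11] [16])) (.viol 5 6 [4, 3, 2, 1] [16, 7]))
    (.viol 5 6 [4, 3, 2, 1] [16])) (.viol 4 5 [3, 2, 1, 6] [16])) (.viol 2 3 [1, 16, 5, 4] [11, 12,
    7, 8]))) (.branch 1 (.branch 2 (.branch 4 (.branch 5 (.branch 8 (.branch 11 (.branch 6 (.branch
    7 (.branch 9 (.branch 10 (.viol 3 4 [2, 1, 6, 5] [16, 12, 13]) (.viol 2 11 [3, 16, 9, 10] [1,
    6, 7, 12])) (.viol 2 11 [3, 16, 9, 10] [1, 6, 7, 12])) (.viol 3 8 [2, 11, 10, 9] [16, 6, 7]))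
    (.viol 4 5 [3, 16, 1, 6] [13, 12, 11, 10])) (.viol 2 3 [1, 6, 7, 8] [11, 16])) (.viol 3 8 [4,
    5, 6, 7] [16])) (.viol 3 4 [2, 11, 12, 13] [16, 5])) (.viol 3 4 [2, 1, 6, 7, 12, 13] [16]))
    (.viol 2 3 [16] [1, 6, 7, 12, 13, 4])) (.viol 2 3 [1, 16] [11, 12, 7, 8]))

theorem hea₁₃_blob :
    hea₁₃.blobCheck [hea₁₄.pat] hea₁₃BlobCert = true := by
  decide +kernel

/-- A certificate for adding a point to `hea₁₄`. -/
def hea₁₄PointCert : Cert :=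
  .branch 0 (.branch 1 (.branch 2 (.branch 6 (.branch 4 (.branch 8 (.branch 10 (.branch 3 (.branch
    5 (.viol 0 9 [13, 12, 16] [1, 6, 5, 10]) (.viol 0 1 [9, 8, 3, 2] [13, 12, 16, 5, 6])) (.viol 0
    1 [9, 10, 5, 6] [13, 12, 16, 3, 2])) (.branch 3 (.branch 7 (.viol 0 9 [13, 16, 10] [1, 6, 7,
    8]) (.viol 0 1 [9, 10, 16, 7, 6] [13, 4, 3, 2])) (.viol 0 1 [9, 10, 16, 3, 2] [13, 12, 7, 6])))
    (.branch 5 (.branch 11 (.viol 0 9 [13, 16, 8] [1, 6, 5, 10]) (.viol 0 1 [9, 8, 16, 11, 2] [13,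
    4, 5, 6])) (.viol 0 1 [9, 8, 16, 5, 6] [13, 12, 11, 2]))) (.branch 7 (.branch 9 (.viol 0 1 [9,
    8, 7, 6] [13, 4, 16, 11, 2]) (.viol 0 9 [13, 4, 16] [1, 6, 7, 8])) (.viol 0 1 [9, 10, 11, 2]
    [13, 4, 16, 7, 6]))) (.branch 3 (.branch 9 (.branch 11 (.viol 0 1 [9, 10, 11, 2] [13, 16, 6])
    (.viol 0 9 [13, 4, 3, 8] [1, 6, 16, 11, 10])) (.viol 0 1 [9, 16, 6] [13, 12, 11, 2])) (.viol 0
    9 [13, 12, 11, 10] [1, 6, 16, 3, 8]))) (.branch 5 (.branch 7 (.branch 9 (.viol 0 1 [9, 10, 5,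
    6] [13, 16, 2]) (.viol 0 1 [9, 16, 2] [13, 12, 7, 6])) (.viol 0 9 [13, 4, 5, 10] [1, 2, 16, 7,
    8])) (.viol 0 9 [13, 12, 7, 8] [1, 2, 16, 5, 10]))) (.branch 4 (.branch 8 (.branch 10 (.viol 0
    1 [9, 10, 5, 6] [13, 12, 16]) (.viol 0 1 [9, 10, 16] [13, 12, 7, 6])) (.viol 0 1 [9, 8, 16]
    [13, 12, 11, 2])) (.viol 0 1 [9, 10, 11, 2] [13, 4, 16]))) (.branch 3 (.branch 5 (.branch 7
    (.viol 0 1 [9, 8, 7, 6] [16, 11, 2]) (.viol 0 1 [9, 10, 11, 2] [16, 7, 6])) (.viol 0 1 [9, 8,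
    3, 2] [16, 5, 6])) (.viol 0 1 [9, 10, 5, 6] [16, 3, 2]))

theorem hea₁₄_point :
    hea₁₄.pointCheck [] hea₁₄PointCert = true := by
  decide +kernel

/-- A certificate for adding a blob to `hea₁₄`. -/
def hea₁₄BlobCert : Cert :=
  .branch 0 (.branch 1 (.branch 2 (.branch 3 (.branch 4 (.branch 6 (.branch 7 (.branch 10 (.branch
    5 (.branch 11 (.branch 8 (.branch 9 (.viol 12 13 [7, 6, 5, 4] [16]) (.viol 3 4 [2, 1, 6, 5] [8,
    9, 16, 12, 13])) (.branch 9 (.viol 3 4 [2, 1, 6, 5] [8, 16, 12, 13]) (.viol 8 9 [7, 6, 5, 4,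
    13, 0] [16]))) (.branch 12 (.branch 13 (.viol 2 3 [1, 6, 5, 4] [11, 16, 9, 8]) (.viol 3 4 [2,
    11, 16, 0, 13] [8, 7, 6, 5])) (.viol 11 12 [10, 5, 6, 7] [16]))) (.branch 11 (.branch 8
    (.branch 9 (.viol 6 7 [5, 16, 13, 12] [1, 2, 3, 8]) (.viol 3 8 [4, 5, 16, 0, 9] [2, 11, 12,
    7])) (.viol 6 7 [5, 16, 3, 8] [1, 0, 13, 12])) (.viol 5 10 [6, 7, 8, 9] [16, 2, 11]))) (.branch
    5 (.branch 8 (.branch 9 (.branch 11 (.viol 6 7 [5, 10, 16, 13, 12] [1, 2, 3, 8]) (.viol 10 11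
    [5, 6, 7, 12] [16])) (.viol 9 10 [16] [8, 7, 6, 5])) (.viol 2 11 [3, 8, 16, 5, 10] [1, 0, 13,
    12])) (.viol 5 10 [6, 7, 12, 13, 0, 9] [16]))) (.branch 5 (.branch 8 (.branch 9 (.branch 12
    (.branch 13 (.viol 1 2 [6, 7, 16, 10, 11] [0, 13, 4, 3]) (.viol 3 4 [2, 11, 10, 5] [8, 7, 16,
    0, 13])) (.viol 7 12 [6, 5, 4, 3, 2, 11] [16])) (.viol 5 10 [6, 7, 16, 0, 9] [4, 3, 2, 11]))
    (.viol 7 8 [6, 5, 4, 3] [16])) (.viol 9 10 [8, 7, 16, 4, 5] [0, 1, 2, 11]))) (.branch 5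
    (.branch 7 (.branch 8 (.branch 9 (.branch 10 (.branch 11 (.viol 2 11 [3, 8, 9, 10] [1, 6, 16,
    13, 12]) (.viol 5 10 [6, 16, 2, 11] [4, 13, 0, 9])) (.viol 2 11 [3, 4, 13, 12] [1, 6, 16, 9,
    10])) (.viol 5 10 [6, 16, 0, 9] [4, 3, 2, 11])) (.viol 0 9 [13, 12, 11, 10] [1, 6, 16, 3, 8]))
    (.viol 6 7 [5, 4, 3, 2, 11, 12] [16])) (.viol 5 6 [4, 3, 2, 1] [16]))) (.branch 5 (.branch 6
    (.branch 13 (.branch 7 (.branch 8 (.branch 9 (.branch 10 (.viol 4 13 [5, 6, 1, 0] [16, 11, 12])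
    (.viol 2 11 [3, 4, 16, 9, 10] [1, 6, 7, 12])) (.viol 3 8 [4, 16, 0, 9] [2, 11, 12, 7])) (.viol
    0 9 [13, 4, 16, 7, 8] [1, 2, 11, 10])) (.viol 3 8 [4, 16, 6, 7] [2, 11, 10, 9])) (.viol 4 13
    [5, 6, 7, 12] [16])) (.viol 4 5 [3, 8, 9, 10] [16, 1, 6])) (.viol 4 5 [3, 2, 1, 6] [16])))
    (.branch 4 (.branch 5 (.branch 8 (.branch 9 (.branch 6 (.branch 7 (.branch 10 (.branch 11
    (.viol 3 4 [2, 1, 6, 5] [16, 12, 13]) (.viol 7 12 [6, 1, 0, 13] [8, 3, 16, 10, 11])) (.viol 2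
    11 [3, 16, 5, 10] [1, 0, 13, 12])) (.viol 3 8 [4, 13, 0, 9] [16, 6, 7])) (.viol 4 5 [3, 16, 1,
    6] [13, 12, 11, 10])) (.viol 3 8 [4, 5, 6, 7] [16, 0, 9])) (.viol 3 8 [4, 5, 6, 7] [16]))
    (.viol 7 8 [6, 5, 16, 2, 3] [12, 13, 0, 9])) (.viol 3 4 [2, 1, 6, 7, 12, 13] [16]))) (.branch 3
    (.branch 4 (.branch 11 (.branch 5 (.branch 6 (.branch 7 (.branch 8 (.branch 9 (.branch 10
    (.viol 3 4 [2, 16, 12, 13] [8, 9, 10, 5]) (.viol 0 9 [13, 12, 7, 8] [1, 2, 16, 5, 10])) (.viol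
    3 8 [4, 5, 6, 7] [2, 16, 0, 9])) (.viol 0 9 [13, 4, 5, 10] [1, 2, 16, 7, 8])) (.viol 3 8 [4,
    13, 0, 9] [2, 16, 6, 7])) (.viol 1 2 [6, 16] [0, 9, 10, 11])) (.viol 1 6 [2, 16, 4, 5] [0, 9,
    8, 7])) (.viol 2 11 [16] [3, 4, 5, 6, 7, 12])) (.viol 10 11 [5, 4, 16, 1, 2] [9, 8, 7, 12]))
    (.viol 2 3 [16] [1, 6, 7, 12, 13, 4]))) (.branch 2 (.branch 3 (.branch 5 (.branch 6 (.branch 4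
    (.branch 7 (.branch 8 (.branch 9 (.branch 10 (.branch 11 (.viol 3 4 [2, 1, 16, 12, 13] [8, 9,
    10, 5]) (.viol 1 2 [6, 7, 8, 3] [16, 10, 11])) (.viol 0 9 [13, 12, 7, 8] [1, 16, 5, 10]))
    (.viol 5 10 [6, 1, 16, 8, 9] [4, 13, 12, 11])) (.viol 0 9 [13, 12, 11, 10] [1, 16, 3, 8]))
    (.viol 0 9 [13, 4, 5, 10] [1, 16, 7, 8])) (.viol 0 13 [9, 10, 11, 12] [1, 16, 3, 4])) (.viol 1
    6 [2, 3, 4, 5] [16])) (.viol 1 6 [2, 11, 12, 7] [16, 4, 5])) (.viol 5 6 [4, 3, 16, 0, 1] [10,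
    11, 12, 7])) (.viol 1 2 [6, 7, 12, 13, 4, 3] [16]))) (.branch 1 (.branch 2 (.branch 4 (.branch
    9 (.branch 13 (.branch 3 (.branch 6 (.branch 5 (.branch 8 (.branch 7 (.branch 10 (.viol 0 13
    [9, 8, 3, 4] [16, 11, 12]) (.viol 0 9 [13, 12, 7, 8] [16, 5, 10])) (.viol 0 1 [9, 10, 11, 2]
    [16, 7, 6])) (.viol 0 9 [13, 12, 11, 10] [16, 3, 8])) (.viol 1 6 [2, 11, 12, 7] [0, 16, 4, 5]))
    (.viol 0 1 [9, 8, 3, 2] [16, 5, 6])) (.viol 0 1 [9, 10, 5, 6] [16, 3, 2])) (.viol 0 13 [9, 10,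
    5, 6, 7, 12] [16])) (.viol 0 9 [13, 12, 7, 6, 5, 10] [16])) (.viol 0 13 [9, 10, 11, 12] [16, 3,
    4])) (.viol 0 1 [9, 10, 5, 6] [16, 2])) (.viol 0 1 [9, 10, 5, 6] [16]))

theorem hea₁₄_blob :
    hea₁₄.blobCheck [] hea₁₄BlobCert = true := by
  decide +kernel

namespace Canon

/-- The nodes in `T` lie at one node or on one arc. -/
def Loc (C : Canon) (T : Set ℕ) : Prop :=
  (∃ i ∈ C.nodes, T ⊆ {i}) ∨ ∃ a ∈ C.arcs, T ⊆ {a.1, a.2.1, a.2.2}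

/-- The properties of a canonical pattern needed for extending its models; the list `o` is an
ordering of its nodes. -/
structure Good (C : Canon) (o : List ℕ) : Prop where
  lt : ∀ k ∈ C.nodes, k < 16
  two : ∀ i ∈ C.nodes, ∃ k ∈ C.nodes, k ≠ i
  arc_mem : ∀ a ∈ C.arcs, a.1 ∈ C.nodes ∧ a.2.1 ∈ C.nodes ∧ a.2.2 ∈ C.nodes
  arc_pt : ∀ a ∈ C.arcs, C.pat.isPt a.2.1 = true ∧ C.pat.isPt a.2.2 = true
  arc_ne : ∀ a ∈ C.arcs, a.2.1 ≠ a.2.2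
  arc_unique : ∀ a ∈ C.arcs, ∀ b ∈ C.arcs, a.1 = b.1 → a = b
  arc_adj : ∀ a ∈ C.arcs, ∀ k ∈ C.nodes, k ≠ a.1 →
    (C.pat.adj a.1 k = true ↔ k = a.2.1 ∨ k = a.2.2)
  arc_nadj : ∀ a ∈ C.arcs, C.pat.adj a.2.1 a.2.2 = false
  sub_order : ∀ k ∈ C.nodes, k ∈ o
  order_sub : ∀ k ∈ o, k ∈ C.nodes
  order_conn : ∀ a ∈ C.arcs, C.pat.conn (o.filter fun k => k != a.1 && k != a.2.2) = true
  deg : ∀ a ∈ C.arcs, ∃ z ∈ C.nodes, C.pat.isPt z = true ∧ z ≠ a.2.1 ∧ z ≠ a.2.2 ∧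
    ∃ k ∈ C.nodes, ∃ l ∈ C.nodes, ∃ m ∈ C.nodes, k ≠ z ∧ l ≠ z ∧ m ≠ z ∧
      k ≠ a.1 ∧ l ≠ a.1 ∧ m ≠ a.1 ∧ k ≠ l ∧ l ≠ m ∧ k ≠ m ∧ k ≠ a.2.1 ∧ k ≠ a.2.2 ∧
      C.pat.adj z k = true ∧ C.pat.adj z l = true ∧ C.pat.adj z m = true
  conf_spec : ∀ p ∈ C.nodes, ∀ k ∈ C.nodes, (C.conf.getD p 0).testBit k = true →
    p ≠ k ∧ C.pat.isPt p = true ∧ C.pat.isPt k = true ∧ (C.pat.adj p k = true ∨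
      ∃ m ∈ C.nodes, C.pat.isPt m = true ∧ m ≠ p ∧ m ≠ k ∧ C.pat.adj p m = true ∧
        C.pat.adj m k = true)

theorem Loc.mono {C : Canon} {S T : Set ℕ} (h : C.Loc T) (hST : S ⊆ T) : C.Loc S := by
  rcases h with ⟨i, hi, h⟩ | ⟨a, ha, h⟩
  · exact Or.inl ⟨i, hi, hST.trans h⟩
  · exact Or.inr ⟨a, ha, hST.trans h⟩

theorem sub_iff {N M : ℕ} : sub N M = true ↔ ∀ k, N.testBit k = true → M.testBit k = true := by
  unfold sub
  rw [Nat.beq_eq]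
  constructor
  · intro h k hk
    rw [← h, Nat.testBit_or, hk, Bool.true_or]
  · intro h
    refine Nat.eq_of_testBit_eq fun k => ?_
    rw [Nat.testBit_or]
    cases hN : N.testBit k
    · simp
    · simp [h k hN]

theorem testBit_one_shiftLeft (i k : ℕ) : (1 <<< i).testBit k = true ↔ k = i := by
  rw [Nat.one_shiftLeft, Nat.testBit_two_pow]
  simp [eq_comm]

theorem isLocal_iff {C : Canon} {e N : ℕ} : C.isLocal e N = true ↔
    C.Loc {k | N.testBit k = true ∧ e.testBit k = false} := by
  simp only [isLocal, Bool.or_eq_true, List.any_eq_true, sub_iff, Nat.testBit_or,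
    testBit_one_shiftLeft, Loc, Set.subset_def, Set.mem_ofPred_eq, Set.mem_insert_iff,
    Set.mem_singleton_iff]
  refine or_congr (exists_congr fun i => and_congr_right fun _ => forall_congr' fun k => ?_)
    (exists_congr fun i => and_congr_right fun _ => forall_congr' fun k => ?_)
  · cases e.testBit k <;> simp
  · cases e.testBit k <;> simp

theorem enum_sound {bad : ℕ → ℕ → Bool} {leaf : ℕ → Bool} {T : Set ℕ}
    (hbad : ∀ p N, p ∈ T → (∀ k, N.testBit k = true → k ∈ T) → bad p N = false) :
    ∀ (l : List ℕ) (N : ℕ), (∀ k, N.testBit k = true → k ∈ T) → enum bad leaf l N = true →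
      ∃ M, leaf M = true ∧ ∀ k, M.testBit k = true ↔ N.testBit k = true ∨ (k ∈ l ∧ k ∈ T) := by
  intro l
  induction l with
  | nil =>
    intro N hN h
    exact ⟨N, h, by simp⟩
  | cons p l ih =>
    intro N hN h
    simp only [enum, Bool.and_eq_true, Bool.or_eq_true] at h
    by_cases hp : p ∈ T
    · have h2 := h.2.resolve_left (by simp [hbad p N hp hN])
      obtain ⟨M, hM, hMN⟩ := ih _ (by
        intro k hk
        rw [Nat.testBit_or, Bool.or_eq_true, testBit_one_shiftLeft] at hk
        rcases hk with hk | rfl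
        · exact hN k hk
        · exact hp) h2
      refine ⟨M, hM, fun k => ?_⟩
      rw [hMN, Nat.testBit_or, Bool.or_eq_true, testBit_one_shiftLeft, List.mem_cons]
      constructor
      · rintro ((h3 | rfl) | h3)
        · exact Or.inl h3
        · exact Or.inr ⟨Or.inl rfl, hp⟩
        · exact Or.inr ⟨Or.inr h3.1, h3.2⟩
      · rintro (h3 | ⟨rfl | h3, h4⟩)
        · exact Or.inl (Or.inl h3)
        · exact Or.inl (Or.inr rfl)
        · exact Or.inr ⟨h3, h4⟩
    · obtain ⟨M, hM, hMN⟩ := ih _ hN h.1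
      refine ⟨M, hM, fun k => ?_⟩
      rw [hMN, List.mem_cons]
      constructor
      · rintro (h3 | h3)
        · exact Or.inl h3
        · exact Or.inr ⟨Or.inr h3.1, h3.2⟩
      · rintro (h3 | ⟨rfl | h3, h4⟩)
        · exact Or.inl h3
        · exact absurd h4 hp
        · exact Or.inr ⟨h3, h4⟩

/-- The result of a successful check for an additional node with neighbourhood `T`. -/
theorem check_of_leaf {C : Canon} {tgts : List Pat} {cert : Cert} {pt : Bool} {T : Set ℕ}
    (hT : ¬ C.Loc T) {M : ℕ} (hM : C.leaf tgts cert pt M = true)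
    (hMT : ∀ k, M.testBit k = true ↔ k ∈ T) :
    cert.check tgts 16 (C.pat.addNode 16 pt M) (C.arcs.filter fun a => M.testBit a.1) 17 =
      true := by
  unfold leaf at hM
  rw [Bool.or_eq_true, isLocal_iff] at hM
  refine hM.resolve_left fun h => hT (h.mono fun k hk => ?_)
  simp [(hMT k).2 hk]

theorem pointCheck_sound {C : Canon} {tgts : List Pat} {cert : Cert} {T : Set ℕ}
    (h : C.pointCheck tgts cert = true) (hT : ¬ C.Loc T) (hTn : ∀ k ∈ T, k ∈ C.nodes)
    (hconf : ∀ p ∈ T, ∀ k ∈ T, (C.conf.getD p 0).testBit k = false) :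
    ∃ M, (∀ k, M.testBit k = true ↔ k ∈ T) ∧ cert.check tgts 16 (C.pat.addNode 16 true M)
      (C.arcs.filter fun a => M.testBit a.1) 17 = true := by
  obtain ⟨M, hM, hMT⟩ := enum_sound (T := T) (by
    intro p N hp hN
    rw [Bool.not_eq_false', Nat.beq_eq]
    refine Nat.eq_of_testBit_eq fun k => ?_
    rw [Nat.testBit_and, Nat.zero_testBit]
    cases hk : N.testBit k
    · simp
    · rw [hconf p hp k (hN k hk), Bool.false_and]) _ 0 (by simp) h
  have hMT' : ∀ k, M.testBit k = true ↔ k ∈ T := fun k => by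
    rw [hMT]
    simp only [Nat.zero_testBit, Bool.false_eq_true, false_or]
    exact ⟨fun h => h.2, fun h => ⟨hTn k h, h⟩⟩
  exact ⟨M, hMT', check_of_leaf hT hM hMT'⟩

theorem blobCheck_sound {C : Canon} {tgts : List Pat} {cert : Cert} {T : Set ℕ}
    (h : C.blobCheck tgts cert = true) (hT : ¬ C.Loc T) (hTn : ∀ k ∈ T, k ∈ C.nodes)
    {i j : ℕ} (hi : i ∈ T) (hj : j ∈ T) (hij : i ≠ j) (hTi : C.Loc (T \ {i}))
    (hTj : C.Loc (T \ {j})) :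
    ∃ M, (∀ k, M.testBit k = true ↔ k ∈ T) ∧ cert.check tgts 16 (C.pat.addNode 16 false M)
      (C.arcs.filter fun a => M.testBit a.1) 17 = true := by
  wlog hlt : i < j generalizing i j
  · exact this hj hi hij.symm hTj hTi (by omega)
  unfold blobCheck at h
  simp only [List.all_eq_true, Bool.or_eq_true] at h
  have h' := (h i (hTn i hi) j (hTn j hj)).resolve_left (by rw [Nat.ble_eq]; omega)
  have hstart : ∀ k, (1 <<< i ||| 1 <<< j).testBit k = true ↔ k = i ∨ k = j := fun k => by
    rw [Nat.testBit_or, Bool.or_eq_true, testBit_one_shiftLeft, testBit_one_shiftLeft]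
  obtain ⟨M, hM, hMT⟩ := enum_sound (T := T) (by
    intro p N hp hN
    have key : ∀ e ∈ T, C.Loc (T \ {e}) → C.isLocal (1 <<< e) (N ||| 1 <<< p) = true := by
      intro e he hTe
      rw [isLocal_iff]
      refine hTe.mono ?_
      rintro k ⟨h1, h2⟩
      rw [Nat.testBit_or, Bool.or_eq_true, testBit_one_shiftLeft] at h1
      refine ⟨?_, fun h3 => ?_⟩
      · rcases h1 with h1 | rfl
        · exact hN k h1
        · exact hp
      · rw [(testBit_one_shiftLeft e k).2 h3] at h2
        exact absurd h2 (by simp)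
    rw [key i hi hTi, key j hj hTj]
    rfl) _ _ (by
      intro k hk
      rcases (hstart k).1 hk with rfl | rfl
      · exact hi
      · exact hj) h'
  have hMT' : ∀ k, M.testBit k = true ↔ k ∈ T := fun k => by
    rw [hMT, hstart]
    simp only [natBeq_eq, List.mem_filter, Bool.and_eq_true, Bool.not_eq_true',
      beq_eq_false_iff_ne]
    constructor
    · rintro ((rfl | rfl) | h)
      · exact hi
      · exact hj
      · exact h.2
    · intro hk
      by_cases h1 : k = i
      · exact Or.inl (Or.inl h1)
      by_cases h2 : k = j
      · exact Or.inl (Or.inr h2)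
      exact Or.inr ⟨⟨hTn k hk, h1, h2⟩, hk⟩
  exact ⟨M, hMT', check_of_leaf hT hM hMT'⟩

end Canon

theorem pet₈_good : pet₈.Good [7, 2, 6, 5, 8, 3, 9, 4] := by
  constructor <;> decide +kernel

theorem pet₉_good : pet₉.Good [5, 6, 8, 9, 7, 4, 1, 3, 2] := by
  constructor <;> decide +kernel

theorem pet₁₀_good : pet₁₀.Good pet₁₀.nodes := by
  constructor <;> decide +kernel

theorem hea₁₁_good : hea₁₁.Good [9, 8, 11, 10, 7, 12, 13, 3, 6, 5, 4] := by
  constructor <;> decide +kernel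

theorem hea₁₂_good : hea₁₂.Good [12, 6, 11, 10, 7, 5, 13, 9, 4, 8, 3, 2] := by
  constructor <;> decide +kernel

theorem hea₁₃_good : hea₁₃.Good [11, 12, 7, 8, 9, 10, 2, 13, 1, 3, 4, 5, 6] := by
  constructor <;> decide +kernel

theorem hea₁₄_good : hea₁₄.Good hea₁₄.nodes := by
  constructor <;> decide +kernel

/-- No set realizing a node other than a point can be replaced by a smaller one. -/
def Tight {V : Type} (G : SimpleGraph V) (F : Pat) (f : ℕ → Set V) : Prop :=
  ∀ k ∈ F.nodes, F.isPt k = false → ∀ D, ConnSet G D →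
    (∀ j ∈ F.nodes, j ≠ k → Disjoint D (f j) ∧ (Touches G D (f j) ↔ Touches G (f k) (f j))) →
    (f k).ncard ≤ D.ncard

section Tight

variable {V : Type} {G : SimpleGraph V} {F : Pat} {f : ℕ → Set V}

theorem Model.update (h : Model G F f) {k : ℕ} (hk : k ∈ F.nodes) (hp : F.isPt k = false)
    {D : Set V} (hD : ConnSet G D) (hDj : ∀ j ∈ F.nodes, j ≠ k →
      Disjoint D (f j) ∧ (Touches G D (f j) ↔ Touches G (f k) (f j))) :
    Model G F (Function.update f k D) := by
  refine ⟨fun i hi => ?_, fun i hi j hj hij => ?_, fun i hi hpi => ?_, fun i hi j hj hij => ?_⟩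
  · by_cases hik : i = k
    · subst hik
      rwa [Function.update_self]
    · rw [Function.update_of_ne hik]
      exact h.conn i hi
  · by_cases hik : i = k
    · subst hik
      rw [Function.update_self, Function.update_of_ne hij.symm]
      exact (hDj j hj hij.symm).1
    · rw [Function.update_of_ne hik]
      by_cases hjk : j = k
      · subst hjk
        rw [Function.update_self]
        exact (hDj i hi hij).1.symm
      · rw [Function.update_of_ne hjk]
        exact h.disj i hi j hj hij
  · have hik : i ≠ k := by
      rintro rfl
      simp [hp] at hpi
    rw [Function.update_of_ne hik]
    exact h.pt i hi hpi
  · by_cases hik : i = k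
    · subst hik
      rw [Function.update_self, Function.update_of_ne hij.symm, (hDj j hj hij.symm).2]
      exact h.adj i hi j hj hij
    · rw [Function.update_of_ne hik]
      by_cases hjk : j = k
      · subst hjk
        rw [Function.update_self, touches_comm, (hDj i hi hij).2, touches_comm]
        exact h.adj i hi j hj hij
      · rw [Function.update_of_ne hjk]
        exact h.adj i hi j hj hij

theorem Model.exists_tight [Finite V] (h : Model G F f) : ∃ g, Model G F g ∧ Tight G F g := by
  obtain ⟨g, hg, hmin⟩ := (measure fun g : ℕ → Set V =>
    ∑ i ∈ F.nodes.toFinset, (g i).ncard).wf.has_min {g | Model G F g} ⟨f, h⟩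
  refine ⟨g, hg, fun k hk hp D hD hDj => ?_⟩
  by_contra! hlt
  refine hmin _ (hg.update hk hp hD hDj) ?_
  refine Finset.sum_lt_sum (M := ℕ) (fun i _ => ?_) ⟨k, List.mem_toFinset.2 hk, ?_⟩
  · by_cases hik : i = k
    · subst hik
      rw [Function.update_self]
      exact hlt.le
    · rw [Function.update_of_ne hik]
  · rwa [Function.update_self]

theorem Model.addNode (h : Model G F f) {q M : ℕ} (hq : q ∉ F.nodes) {pt : Bool} {Q : Set V}
    (hQ : ConnSet G Q) (hQd : ∀ k ∈ F.nodes, Disjoint Q (f k))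
    (hpt : pt = true → Q.Subsingleton)
    (hM : ∀ k ∈ F.nodes, M.testBit k = true ↔ Touches G Q (f k)) :
    Model G (F.addNode q pt M) (Function.update f q Q) := by
  have hne : ∀ k ∈ F.nodes, k ≠ q := fun k hk hkq => hq (hkq ▸ hk)
  have hmem : ∀ k ∈ (F.addNode q pt M).nodes, k = q ∨ k ∈ F.nodes := by
    simp [Pat.addNode]
  refine ⟨fun i hi => ?_, fun i hi j hj hij => ?_, fun i hi hpi => ?_, fun i hi j hj hij => ?_⟩
  · rcases hmem i hi with rfl | hi'
    · rwa [Function.update_self]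
    · rw [Function.update_of_ne (hne i hi')]
      exact h.conn i hi'
  · rcases hmem i hi with rfl | hi' <;> rcases hmem j hj with rfl | hj'
    · exact absurd rfl hij
    · rw [Function.update_self, Function.update_of_ne hij.symm]
      exact hQd j hj'
    · rw [Function.update_self, Function.update_of_ne hij]
      exact (hQd i hi').symm
    · rw [Function.update_of_ne (hne i hi'), Function.update_of_ne (hne j hj')]
      exact h.disj i hi' j hj' hij
  · rcases hmem i hi with rfl | hi'
    · rw [Function.update_self]
      exact hpt (by simpa [Pat.addNode, natBeq_eq] using hpi)
    · rw [Function.update_of_ne (hne i hi')]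
      exact h.pt i hi' (by simpa [Pat.addNode, natBeq_eq, hne i hi'] using hpi)
  · rcases hmem i hi with rfl | hi' <;> rcases hmem j hj with rfl | hj'
    · exact absurd rfl hij
    · rw [Function.update_self, Function.update_of_ne hij.symm, ← hM j hj']
      simp [Pat.addNode, natBeq_eq]
    · rw [Function.update_self, Function.update_of_ne hij, touches_comm, ← hM i hi']
      simp [Pat.addNode, natBeq_eq, hij]
    · rw [Function.update_of_ne (hne i hi'), Function.update_of_ne (hne j hj'),
        ← h.adj i hi' j hj' hij]
      simp [Pat.addNode, natBeq_eq, hne i hi', hne j hj']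

end Tight

namespace Canon

theorem isPt_iff {C : Canon} {k : ℕ} : C.pat.isPt k = true ↔ ∀ a ∈ C.arcs, a.1 ≠ k := by
  simp [pat, natBeq_eq]

theorem isPt_eq_false {C : Canon} {a : ℕ × ℕ × ℕ} (ha : a ∈ C.arcs) :
    C.pat.isPt a.1 = false := by
  rw [Bool.eq_false_iff, Ne, isPt_iff]
  exact fun h => h a ha rfl

theorem isPt_or {C : Canon} (k : ℕ) : C.pat.isPt k = true ∨ ∃ a ∈ C.arcs, a.1 = k := by
  by_contra! h
  exact h.1 (isPt_iff.2 h.2)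

section

variable {V : Type} {G : SimpleGraph V} {C : Canon} {o : List ℕ} {f : ℕ → Set V}

theorem Good.ne (hG : C.Good o) {a : ℕ × ℕ × ℕ} (ha : a ∈ C.arcs) :
    a.2.1 ≠ a.1 ∧ a.2.2 ≠ a.1 :=
  ⟨(isPt_iff.1 (hG.arc_pt a ha).1 a ha).symm, (isPt_iff.1 (hG.arc_pt a ha).2 a ha).symm⟩

theorem Good.touches_iff (hG : C.Good o) (h : Model G C.pat f) {a : ℕ × ℕ × ℕ}
    (ha : a ∈ C.arcs) {k : ℕ} (hk : k ∈ C.nodes) (hka : k ≠ a.1) :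
    Touches G (f a.1) (f k) ↔ k = a.2.1 ∨ k = a.2.2 := by
  rw [← h.adj a.1 (hG.arc_mem a ha).1 k hk hka.symm, hG.arc_adj a ha k hk hka]

theorem Good.exists_ends (hG : C.Good o) (h : Model G C.pat f) {a : ℕ × ℕ × ℕ}
    (ha : a ∈ C.arcs) : ∃ x y, f a.2.1 = {x} ∧ f a.2.2 = {y} := by
  obtain ⟨x, hx⟩ := h.exists_eq_singleton (hG.arc_mem a ha).2.1 (hG.arc_pt a ha).1
  obtain ⟨y, hy⟩ := h.exists_eq_singleton (hG.arc_mem a ha).2.2 (hG.arc_pt a ha).2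
  exact ⟨x, y, hx, hy⟩

/-- A set that could replace the set realizing an arc is not smaller than it. -/
theorem Good.ncard_le (hG : C.Good o) (h : Model G C.pat f) (ht : Tight G C.pat f)
    {a : ℕ × ℕ × ℕ} (ha : a ∈ C.arcs) {D : Set V} (hD : ConnSet G D)
    (hDa : ∀ x ∈ D, x ∈ f a.1 ∨ ((∀ k ∈ C.nodes, x ∉ f k) ∧
      ∀ k ∈ C.nodes, Touches G {x} (f k) → k = a.1 ∨ k = a.2.1 ∨ k = a.2.2))
    (hs : Touches G D (f a.2.1)) (ht' : Touches G D (f a.2.2)) :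
    (f a.1).ncard ≤ D.ncard := by
  refine ht a.1 (hG.arc_mem a ha).1 (isPt_eq_false ha) D hD fun j hj hja => ⟨?_, ?_⟩
  · rw [Set.disjoint_left]
    intro x hx hxj
    rcases hDa x hx with h1 | h1
    · exact Set.disjoint_left.1 (h.disj _ (hG.arc_mem a ha).1 j hj hja.symm) h1 hxj
    · exact h1.1 j hj hxj
  · rw [hG.touches_iff h ha hj hja]
    constructor
    · rintro ⟨x, hx, y, hy, hxy⟩
      rcases hDa x hx with h1 | h1
      · exact (hG.touches_iff h ha hj hja).1 ⟨x, h1, y, hy, hxy⟩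
      · exact (h1.2 j hj ⟨x, rfl, y, hy, hxy⟩).resolve_left hja
    · rintro (rfl | rfl)
      · exact hs
      · exact ht'

theorem Good.exists_isArc (hG : C.Good o) [Finite V] (h : Model G C.pat f)
    (ht : Tight G C.pat f) {a : ℕ × ℕ × ℕ} (ha : a ∈ C.arcs) {x y : V} (hx : f a.2.1 = {x})
    (hy : f a.2.2 = {y}) : ∃ n p, IsArc G (f a.1) x y n p := by
  obtain ⟨m1, m2, m3⟩ := hG.arc_mem a ha
  obtain ⟨n1, n2⟩ := hG.ne ha
  have hst := h.disj _ m2 _ m3 (hG.arc_ne a ha)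
  have hxd := h.disj _ m2 _ m1 n1
  have hyd := h.disj _ m3 _ m1 n2
  have hxt := (hG.touches_iff h ha m2 n1).2 (Or.inl rfl)
  have hyt := (hG.touches_iff h ha m3 n2).2 (Or.inr rfl)
  rw [hx, hy, Set.disjoint_singleton] at hst
  rw [hx, Set.disjoint_singleton_left] at hxd
  rw [hy, Set.disjoint_singleton_left] at hyd
  rw [hx] at hxt
  rw [hy] at hyt
  obtain ⟨D, hDs, n, p, hp⟩ := (h.conn _ m1).exists_isArc hxd hyd hst hxt.symm hyt.symm
  have hle := hG.ncard_le h ht ha hp.connSet (fun v hv => Or.inl (hDs hv))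
    (by rw [hx]
        exact ⟨p 1, hp.mem le_rfl hp.pos, x, rfl, ((hp.adj_start_iff le_rfl hp.pos).2 rfl).symm⟩)
    (by rw [hy]
        exact ⟨p n, hp.mem hp.pos le_rfl, y, rfl, ((hp.adj_last_iff hp.pos le_rfl).2 rfl).symm⟩)
  rw [← Set.eq_of_subset_of_ncard_le hDs hle (Set.toFinite _)]
  exact ⟨n, p, hp⟩

/-- A vertex outside of a tight model attached to it locally has at most one neighbour in it. -/
theorem Good.attach_unique (hG : C.Good o) [Finite V]
    (hTF : ∀ a b c, G.Adj a b → G.Adj b c → ¬ G.Adj a c) (hSF : ¬ HasSquare G)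
    (h : Model G C.pat f) (ht : Tight G C.pat f) {x : V} (hx : ∀ k ∈ C.nodes, x ∉ f k)
    (hloc : C.Loc {k | k ∈ C.nodes ∧ Touches G {x} (f k)}) {i j : ℕ} {u v : V}
    (hi : i ∈ C.nodes) (hj : j ∈ C.nodes) (hu : u ∈ f i) (hv : v ∈ f j) (hxu : G.Adj x u)
    (hxv : G.Adj x v) : u = v := by
  have key : ∀ a ∈ C.arcs, (∀ k ∈ C.nodes, Touches G {x} (f k) →
      k = a.1 ∨ k = a.2.1 ∨ k = a.2.2) → u = v := by
    intro a ha hT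
    obtain ⟨y, z, hy, hz⟩ := hG.exists_ends h ha
    obtain ⟨n, p, hp⟩ := hG.exists_isArc h ht ha hy hz
    have hpos : ∀ k ∈ C.nodes, ∀ w ∈ f k, G.Adj x w → ∃ m, m ≤ n + 1 ∧ p m = w := by
      intro k hk w hw hxw
      rcases hT k hk ⟨x, rfl, w, hw, hxw⟩ with rfl | rfl | rfl
      · obtain ⟨m, -, h2, h3⟩ := (hp.mem_iff w).1 hw
        exact ⟨m, by omega, h3⟩
      · rw [hy] at hw
        exact ⟨0, by omega, hp.zero.trans hw.symm⟩
      · rw [hz] at hw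
        exact ⟨n + 1, le_rfl, hp.last.trans hw.symm⟩
    have hlt : ∀ k l, k < l → l ≤ n + 1 → G.Adj x (p k) → ¬ G.Adj x (p l) := by
      intro k l hkl hl hxk hxl
      have h1 : l ≠ k + 1 := by
        rintro rfl
        exact hTF _ _ _ hxk (hp.step k (by omega)) hxl
      have h2 : l ≠ k + 2 := by
        rintro rfl
        have s1 := hp.step k (by omega)
        have s2 := hp.step (k + 1) (by omega)
        refine hSF ⟨x, p k, p (k + 1), p (k + 2), hxk, s1, s2, hxl.symm, hTF _ _ _ hxk s1,
          hTF _ _ _ s1 s2, ?_, fun h3 => ?_⟩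
        · rintro rfl
          exact hx _ (hG.arc_mem a ha).1 (hp.mem (by omega) (by omega))
        · have := hp.inj _ _ (by omega) (by omega) h3
          omega
      obtain ⟨S, hS, hxS, hSs, hSy⟩ := hp.exists_connSet_start (ConnSet.singleton x)
        (j := k) (by omega) ⟨p k, ⟨k, ⟨by omega, le_rfl⟩, rfl⟩, x, rfl, hxk.symm⟩
      obtain ⟨S', hS', hSS', hSs', hSz⟩ := hp.reverse.exists_connSet_start hS
        (j := n + 1 - l) (by omega) ⟨p l, ⟨n + 1 - l, ⟨by omega, le_rfl⟩, by
          simp only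
          congr 1
          omega⟩, x, hxS rfl, hxl.symm⟩
      have hsub : S' ⊆ {x} ∪ (p '' Set.Icc 1 k ∪ p '' Set.Icc l n) := by
        intro w hw
        rcases hSs' hw with hw | ⟨m, ⟨hm1, hm2⟩, rfl⟩
        · rcases hSs hw with hw | hw
          · exact Or.inl hw
          · exact Or.inr (Or.inl hw)
        · exact Or.inr (Or.inr ⟨n + 1 - m, ⟨by omega, by omega⟩, rfl⟩)
      have hle := hG.ncard_le h ht ha hS' (fun w hw => by
        rcases hsub hw with rfl | ⟨m, ⟨hm1, hm2⟩, rfl⟩ | ⟨m, ⟨hm1, hm2⟩, rfl⟩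
        · exact Or.inr ⟨hx, hT⟩
        · exact Or.inl (hp.mem hm1 (by omega))
        · exact Or.inl (hp.mem (by omega) hm2))
        (by rw [hy]; exact (hSy.mono subset_rfl hSS').symm) (by rw [hz]; exact hSz.symm)
      have h3 := Set.ncard_le_ncard hsub (Set.toFinite _)
      have h4 := Set.ncard_union_le {x} (p '' Set.Icc 1 k ∪ p '' Set.Icc l n)
      have h5 := Set.ncard_union_le (p '' Set.Icc 1 k) (p '' Set.Icc l n)
      have h6 := IsMinTheta.ncard_image_le p 1 k
      have h7 := IsMinTheta.ncard_image_le p l n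
      rw [Set.ncard_singleton] at h4
      rw [hp.ncard_eq] at hle
      omega
    obtain ⟨k, hk, rfl⟩ := hpos i hi u hu hxu
    obtain ⟨l, hl, rfl⟩ := hpos j hj v hv hxv
    rcases lt_trichotomy k l with h1 | rfl | h1
    · exact (hlt k l h1 hl hxu hxv).elim
    · rfl
    · exact (hlt l k h1 hk hxv hxu).elim
  rcases hloc with ⟨k, hk, hT⟩ | ⟨a, ha, hT⟩
  · rcases isPt_or (C := C) k with hkp | ⟨a, ha, rfl⟩
    · have h1 : i = k := hT ⟨hi, x, rfl, u, hu, hxu⟩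
      have h2 : j = k := hT ⟨hj, x, rfl, v, hv, hxv⟩
      subst h1 h2
      exact h.pt _ hi hkp hu hv
    · exact key a ha fun m hm hTm => Or.inl (hT ⟨hm, hTm⟩)
  · exact key a ha fun m hm hTm => hT ⟨hm, hTm⟩

end

end Canon

namespace Canon

variable {V : Type} {G : SimpleGraph V} {C : Canon} {o : List ℕ} {f : ℕ → Set V}

/-- The vertices outside of a model are not all attached locally. -/
theorem Good.exists_not_loc (hG : C.Good o) [Finite V] (hT : TwoConnected G)
    (hC : ¬ HasProper2Cutset G) (h : Model G C.pat f) {w : V} (hw : ∀ k ∈ C.nodes, w ∉ f k) :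
    ∃ Q, ConnSet G Q ∧ (∀ x ∈ Q, ∀ k ∈ C.nodes, x ∉ f k) ∧
      ¬ C.Loc {k | k ∈ C.nodes ∧ Touches G Q (f k)} := by
  by_contra! hloc
  obtain ⟨K, hK, hwK, hKO, hKcl⟩ :=
    exists_component (G := G) (O := {x | ∀ k ∈ C.nodes, x ∉ f k}) hw
  have key : ∀ a ∈ C.arcs, (∀ k ∈ C.nodes, Touches G K (f k) →
      k = a.1 ∨ k = a.2.1 ∨ k = a.2.2) → False := by
    intro a ha hKT
    obtain ⟨m1, m2, m3⟩ := hG.arc_mem a ha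
    obtain ⟨n1, n2⟩ := hG.ne ha
    obtain ⟨x, y, hx, hy⟩ := hG.exists_ends h ha
    let X : Set V := f a.1 ∪ {v | (∀ k ∈ C.nodes, v ∉ f k) ∧ ∀ K', ConnSet G K' → v ∈ K' →
      (∀ u ∈ K', ∀ k ∈ C.nodes, u ∉ f k) →
        ∀ k ∈ C.nodes, Touches G K' (f k) → k = a.1 ∨ k = a.2.1 ∨ k = a.2.2}
    have hwX : w ∈ X := by
      refine Or.inr ⟨hw, fun K' hK' hwK' hK'O k hk hkT => hKT k hk (hkT.mono ?_ subset_rfl)⟩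
      refine hK'.subset_of_closed K ⟨w, hwK', hwK⟩ fun u _ huK v hv huv => ?_
      exact hKcl u huK v (hK'O v hv) huv
    have hXk : ∀ k ∈ C.nodes, k ≠ a.1 → ∀ v ∈ f k, v ∉ X := by
      rintro k hk hka v hv (h1 | h1)
      · exact Set.disjoint_left.1 (h.disj k hk _ m1 hka) hv h1
      · exact h1.1 k hk hv
    have hxX : x ∉ X := hXk _ m2 n1 x (hx ▸ rfl)
    have hyX : y ∉ X := hXk _ m3 n2 y (hy ▸ rfl)
    have hxy : x ≠ y := h.ne_of_eq m2 m3 (hG.arc_ne a ha) hx hy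
    have hcl : ∀ u ∈ X, ∀ v, G.Adj u v → v ∈ X ∨ v = x ∨ v = y := by
      intro u hu v huv
      have hend : ∀ k ∈ C.nodes, v ∈ f k → k = a.1 ∨ k = a.2.1 ∨ k = a.2.2 →
          v ∈ X ∨ v = x ∨ v = y := by
        rintro k hk hv (rfl | rfl | rfl)
        · exact Or.inl (Or.inl hv)
        · rw [hx] at hv
          exact Or.inr (Or.inl hv)
        · rw [hy] at hv
          exact Or.inr (Or.inr hv)
      by_cases hv : ∀ k ∈ C.nodes, v ∉ f k
      · refine Or.inl (Or.inr ⟨hv, fun K' hK' hvK' hK'O k hk hkT => ?_⟩)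
        rcases hu with hu | hu
        · have ha' : a.1 ∈ {k | k ∈ C.nodes ∧ Touches G K' (f k)} :=
            ⟨m1, v, hvK', u, hu, huv.symm⟩
          rcases hloc K' hK' hK'O with ⟨i, hi, hTi⟩ | ⟨b, hb, hTb⟩
          · have h1 := hTi ha'
            have h2 : k ∈ ({i} : Set ℕ) := hTi ⟨hk, hkT⟩
            exact Or.inl (h2.trans h1.symm)
          · have h1 := hTb ha'
            have hab : a = b := by
              rcases h1 with h1 | h1 | h1
              · exact hG.arc_unique a ha b hb h1
              · exact absurd h1 (isPt_iff.1 (hG.arc_pt b hb).1 a ha)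
              · exact absurd h1 (isPt_iff.1 (hG.arc_pt b hb).2 a ha)
            subst hab
            exact hTb ⟨hk, hkT⟩
        · refine hu.2 (insert u K') (hK'.insert ⟨u, rfl, v, hvK', huv⟩) (Set.mem_insert _ _)
            ?_ k hk (hkT.mono (Set.subset_insert _ _) subset_rfl)
          rintro b (rfl | hb)
          · exact hu.1
          · exact hK'O b hb
      · push Not at hv
        obtain ⟨k, hk, hv⟩ := hv
        refine hend k hk hv ?_
        rcases hu with hu | hu
        · by_cases hka : k = a.1
          · exact Or.inl hka
          · exact Or.inr ((hG.touches_iff h ha hk hka).1 ⟨u, hu, v, hv, huv⟩)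
        · refine hu.2 {u} (ConnSet.singleton u) rfl ?_ k hk ⟨u, rfl, v, hv, huv⟩
          rintro _ rfl
          exact hu.1
    obtain ⟨d, hd⟩ := (h.conn _ m1).nonempty
    obtain ⟨z, hz, hzp, hzs, hzt, k, hk, l, hl, m, hm, hkz, hlz, hmz, hka, hla, hma, hkl, hlm,
      hkm, hks, hkt, zk, zl, zm⟩ := hG.deg a ha
    obtain ⟨v, hv⟩ := h.exists_eq_singleton hz hzp
    have hza : z ≠ a.1 := fun h1 => by
      rw [h1, isPt_eq_false ha] at hzp
      exact absurd hzp (by simp)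
    let Y : Set V := {v | v ∉ X ∧ v ≠ x ∧ v ≠ y}
    have hne : ∀ k ∈ C.nodes, k ≠ a.2.1 → k ≠ a.2.2 → ∀ u ∈ f k, u ≠ x ∧ u ≠ y := by
      intro k hk hks hkt u hu
      refine ⟨?_, ?_⟩
      · rintro rfl
        exact Set.disjoint_left.1 (h.disj k hk _ m2 hks) hu (hx ▸ rfl)
      · rintro rfl
        exact Set.disjoint_left.1 (h.disj k hk _ m3 hkt) hu (hy ▸ rfl)
    have hvY : v ∈ Y := ⟨hXk z hz hza v (hv ▸ rfl), hne z hz hzs hzt v (hv ▸ rfl)⟩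
    have hnb : ∀ k ∈ C.nodes, k ≠ z → k ≠ a.1 → C.pat.adj z k = true →
        ∃ u ∈ f k, G.Adj v u ∧ u ∉ X := by
      intro k hk hkz hka hzk
      obtain ⟨v', hv', u, hu, hvu⟩ := (h.adj z hz k hk hkz.symm).1 hzk
      rw [hv] at hv'
      subst hv'
      exact ⟨u, hu, hvu, hXk k hk hka u hu⟩
    obtain ⟨u₁, hu₁, va₁, hX₁⟩ := hnb k hk hkz hka zk
    obtain ⟨u₂, hu₂, va₂, hX₂⟩ := hnb l hl hlz hla zl
    obtain ⟨u₃, hu₃, va₃, hX₃⟩ := hnb m hm hmz hma zm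
    have d₁₂ : u₁ ≠ u₂ := (h.disj k hk l hl hkl).ne_of_mem hu₁ hu₂
    have d₂₃ : u₂ ≠ u₃ := (h.disj l hl m hm hlm).ne_of_mem hu₂ hu₃
    have d₁₃ : u₁ ≠ u₃ := (h.disj k hk m hm hkm).ne_of_mem hu₁ hu₃
    have hX2 : 2 ≤ X.ncard := by
      rw [← Set.ncard_pair (show d ≠ w from fun h1 => hw _ m1 (h1 ▸ hd))]
      exact Set.ncard_le_ncard (Set.insert_subset (Or.inl hd) (Set.singleton_subset_iff.2 hwX))
        (Set.toFinite _)
    have hY2 : 2 ≤ Y.ncard := by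
      rw [← Set.ncard_pair va₁.ne]
      exact Set.ncard_le_ncard (Set.insert_subset hvY (Set.singleton_subset_iff.2
        ⟨hX₁, hne k hk hks hkt u₁ hu₁⟩)) (Set.toFinite _)
    have hxyn : ¬ G.Adj x y := by
      rw [← h.adj_of_eq m2 m3 (hG.arc_ne a ha) hx hy, hG.arc_nadj a ha]
      simp
    rcases hT.exists_isArc_or hC hxy hxyn (X := X) (Y := Y)
      (fun v => by
        by_cases h1 : v ∈ X
        · exact Or.inl h1
        by_cases h2 : v = x
        · exact Or.inr (Or.inr (Or.inl h2))
        by_cases h3 : v = y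
        · exact Or.inr (Or.inr (Or.inr h3))
        exact Or.inr (Or.inl ⟨h1, h2, h3⟩))
      (Set.disjoint_left.2 fun v hv1 hv2 => hv2.1 hv1) hxX (fun h1 => h1.2.1 rfl) hyX
      (fun h1 => h1.2.2 rfl) hX2 hY2 (fun u hu v hv huv => by
        rcases hcl u hu v huv with h1 | h1 | h1
        · exact hv.1 h1
        · exact hv.2.1 h1
        · exact hv.2.2 h1) with ⟨n, q, hq⟩ | ⟨n, q, hq⟩
    · obtain ⟨j, hj1, hjn, rfl⟩ := (hq.mem_iff w).1 hwX
      have hd1 : ∀ e ∈ C.nodes, ∀ b, f e = {b} → Touches G (f a.1) (f e) →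
          ∃ i, 1 ≤ i ∧ i ≤ n ∧ q i ∈ f a.1 ∧ G.Adj b (q i) := by
        rintro e - b hb ⟨u, hu, b', hb', hub⟩
        rw [hb] at hb'
        subst hb'
        obtain ⟨i, h1, h2, rfl⟩ := (hq.mem_iff u).1 (Or.inl hu)
        exact ⟨i, h1, h2, hu, hub.symm⟩
      obtain ⟨i1, h1, h2, h3, h4⟩ := hd1 _ m2 x hx ((hG.touches_iff h ha m2 n1).2 (Or.inl rfl))
      obtain ⟨i2, h1', h2', h3', h4'⟩ :=
        hd1 _ m3 y hy ((hG.touches_iff h ha m3 n2).2 (Or.inr rfl))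
      rw [hq.adj_start_iff h1 h2] at h4
      rw [hq.adj_last_iff h1' h2'] at h4'
      subst h4 h4'
      have hj1' : j ≠ 1 := by
        rintro rfl
        exact hw _ m1 h3
      obtain ⟨b, hb, ⟨i, hi1, hij, rfl⟩, c, hc, hcj, hbc⟩ := (h.conn _ m1).exists_adj
        (X := {b | ∃ i, 1 ≤ i ∧ i < j ∧ q i = b}) h3 ⟨1, le_rfl, by omega, rfl⟩ h3' (by
          rintro ⟨i, hi1, hij, hi⟩
          have := hq.inj _ _ (by omega) (by omega) hi
          omega)
      obtain ⟨i', hi1', hin', rfl⟩ := (hq.mem_iff c).1 (Or.inl hc)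
      have := (hq.adj_iff hi1 (by omega) (by omega)).1 hbc
      have hij' : ¬ i' < j := fun h5 => hcj ⟨i', hi1', h5, rfl⟩
      have : i' = j := by omega
      subst this
      exact hw _ m1 hc
    · obtain ⟨i, hi1, hin, rfl⟩ := (hq.mem_iff v).1 hvY
      have hpos : ∀ u, G.Adj (q i) u → u ∉ X → u = q (i + 1) ∨ u = q (i - 1) := by
        intro u hu huX
        have : ∃ j, j ≤ n + 1 ∧ q j = u := by
          by_cases h1 : u = x
          · exact ⟨0, by omega, hq.zero.trans h1.symm⟩
          by_cases h2 : u = y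
          · exact ⟨n + 1, le_rfl, hq.last.trans h2.symm⟩
          obtain ⟨j, -, h3, h4⟩ := (hq.mem_iff u).1 ⟨huX, h1, h2⟩
          exact ⟨j, by omega, h4⟩
        obtain ⟨j, hj, rfl⟩ := this
        rcases (hq.adj_iff hi1 hin hj).1 hu with rfl | rfl
        · exact Or.inl rfl
        · exact Or.inr rfl
      rcases hpos _ va₁ hX₁ with e1 | e1 <;> rcases hpos _ va₂ hX₂ with e2 | e2 <;>
        rcases hpos _ va₃ hX₃ with e3 | e3 <;> simp_all
  have hLoc := hloc K hK hKO
  rcases hLoc with ⟨i, hi, hTi⟩ | ⟨a, ha, hTa⟩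
  · rcases isPt_or (C := C) i with hip | ⟨a, ha, rfl⟩
    · obtain ⟨v, hv⟩ := h.exists_eq_singleton hi hip
      obtain ⟨k, hk, hki⟩ := hG.two i hi
      obtain ⟨u, hu⟩ := (h.conn k hk).nonempty
      have huv : u ≠ v := (h.disj k hk i hi hki).ne_of_mem hu (hv ▸ rfl)
      have := hT.eq_compl hwK (v := v) (fun h1 => hKO h1 i hi (hv ▸ rfl)) (by
        intro x hx y hxy hyv
        refine hKcl x hx y (fun l hl hyl => hyv ?_) hxy
        have : l = i := hTi ⟨hl, x, hx, y, hyl, hxy⟩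
        subst this
        rwa [hv] at hyl) huv
      exact hKO this k hk hu
    · exact key a ha fun k hk hkT => Or.inl (hTi ⟨hk, hkT⟩)
  · exact key a ha fun k hk hkT => hTa ⟨hk, hkT⟩

/-- A vertex outside of a tight model that is not attached locally has at most one neighbour on
each arc. -/
theorem Good.arc_unique_of_not_loc (hG : C.Good o) [Finite V] (hU : SplitFree G)
    (h : Model G C.pat f) (ht : Tight G C.pat f) {q : V} (hq : ∀ k ∈ C.nodes, q ∉ f k)
    (hloc : ¬ C.Loc {k | k ∈ C.nodes ∧ Touches G {q} (f k)}) {a : ℕ × ℕ × ℕ}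
    (ha : a ∈ C.arcs) {u v : V} (hu : u ∈ f a.1) (hv : v ∈ f a.1) (hqu : G.Adj q u)
    (hqv : G.Adj q v) : u = v := by
  obtain ⟨m1, m2, m3⟩ := hG.arc_mem a ha
  obtain ⟨n1, n2⟩ := hG.ne ha
  obtain ⟨x, y, hx, hy⟩ := hG.exists_ends h ha
  obtain ⟨n, p, hp⟩ := hG.exists_isArc h ht ha hx hy
  obtain ⟨z, hz, hqz, hz1, hz2, hz3⟩ : ∃ z ∈ C.nodes, Touches G {q} (f z) ∧ z ≠ a.1 ∧
      z ≠ a.2.1 ∧ z ≠ a.2.2 := by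
    by_contra! hno
    refine hloc (Or.inr ⟨a, ha, ?_⟩)
    rintro k ⟨hk, hkT⟩
    by_contra hka
    simp only [Set.mem_insert_iff, Set.mem_singleton_iff, not_or] at hka
    exact hka.2.2 (hno k hk hkT hka.1 hka.2.1)
  have key : ∀ i j, 1 ≤ i → i < j → j ≤ n → G.Adj q (p i) → ¬ G.Adj q (p j) := by
    intro i j hi hij hj hqi hqj
    have hord : ∀ k, k ∈ (o.filter fun k => k != a.1 && k != a.2.2) ↔
        k ∈ C.nodes ∧ k ≠ a.1 ∧ k ≠ a.2.2 := by
      intro k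
      simp only [List.mem_filter, Bool.and_eq_true, bne_iff_ne]
      exact and_congr_left fun _ => ⟨hG.order_sub k, hG.sub_order k⟩
    let R : Set V := {w | ∃ k ∈ o.filter fun k => k != a.1 && k != a.2.2, w ∈ f k}
    have hR : ConnSet G R :=
      h.connSet_iUnion _ (fun k hk => ((hord k).1 hk).1) (hG.order_conn a ha)
    have hxR : x ∈ R := ⟨a.2.1, (hord _).2 ⟨m2, n1, hG.arc_ne a ha⟩, hx ▸ rfl⟩
    have hRn : ∀ k, 1 ≤ k → k ≤ n → p k ∉ R := by
      rintro k hk1 hk2 ⟨l, hl, hkl⟩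
      exact Set.disjoint_left.1 (h.disj _ m1 l ((hord l).1 hl).1 ((hord l).1 hl).2.1.symm)
        (hp.mem hk1 hk2) hkl
    have hqp : ∀ k, 1 ≤ k → k ≤ n → q ≠ p k := by
      rintro k hk1 hk2 rfl
      exact hq _ m1 (hp.mem hk1 hk2)
    have hB : ConnSet G (R ∪ p '' Set.Icc 0 (i - 1)) :=
      hR.union_of_mem (hp.connSet_image (by omega) (by omega)) hxR
        ⟨0, ⟨le_rfl, by omega⟩, hp.zero⟩
    have hpx : ∀ k, p k ∈ p '' Set.Icc 0 (i - 1) → 1 ≤ k → k ≤ n → k ≤ i - 1 := by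
      rintro k ⟨l, ⟨hl1, hl2⟩, hlk⟩ hk1 hk2
      have := hp.inj _ _ (by omega) (by omega) hlk
      omega
    have := hU q (p i) (p '' Set.Icc (i + 1) j) (R ∪ p '' Set.Icc 0 (i - 1)) hqi
      (hp.connSet_image (by omega) (by omega)) hB
      (by rintro ⟨k, ⟨hk1, hk2⟩, hk⟩
          exact hqp k (by omega) (by omega) hk.symm)
      (by rintro ⟨k, ⟨hk1, hk2⟩, hk⟩
          have := hp.inj _ _ (by omega) (by omega) hk
          omega)
      (by rintro (⟨k, hk, hqk⟩ | ⟨k, ⟨hk1, hk2⟩, hk⟩)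
          · exact hq k ((hord k).1 hk).1 hqk
          · rcases Nat.eq_zero_or_pos k with rfl | hk0
            · rw [hp.zero] at hk
              exact hq _ m2 (by rw [hx, hk]; rfl)
            · exact hqp k hk0 (by omega) hk.symm)
      (by rintro (h1 | h1)
          · exact hRn i hi (by omega) h1
          · have := hpx i h1 hi (by omega)
            omega)
      (by rw [Set.disjoint_left]
          rintro _ ⟨k, ⟨hk1, hk2⟩, rfl⟩ (h1 | h1)
          · exact hRn k (by omega) (by omega) h1
          · have := hpx k h1 (by omega) (by omega)
            omega)
      ⟨q, rfl, p j, ⟨j, ⟨by omega, le_rfl⟩, rfl⟩, hqj⟩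
      ⟨p i, rfl, p (i + 1), ⟨i + 1, ⟨le_rfl, by omega⟩, rfl⟩, hp.step i (by omega)⟩
      (hqz.mono subset_rfl fun w hw => Or.inl ⟨z, (hord z).2 ⟨hz, hz1, hz3⟩, hw⟩)
      ⟨p i, rfl, p (i - 1), Or.inr ⟨i - 1, ⟨by omega, le_rfl⟩, rfl⟩,
        (hp.adj_iff hi (by omega) (by omega)).2 (by omega)⟩
    obtain ⟨_, ⟨k, ⟨hk1, hk2⟩, rfl⟩, w, hw | ⟨l, ⟨hl1, hl2⟩, rfl⟩, hkw⟩ := this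
    · obtain ⟨l, hl, hwl⟩ := hw
      obtain ⟨hl1, hl2, hl3⟩ := (hord l).1 hl
      rcases (hG.touches_iff h ha hl1 hl2).1 ⟨p k, hp.mem (by omega) (by omega), w, hwl, hkw⟩
        with rfl | rfl
      · rw [hx] at hwl
        subst hwl
        have := (hp.adj_start_iff (by omega) (by omega)).1 hkw.symm
        omega
      · exact hl3 rfl
    · have := (hp.adj_iff (by omega) (by omega) (by omega)).1 hkw
      omega
  obtain ⟨i, hi1, hin, rfl⟩ := (hp.mem_iff u).1 hu
  obtain ⟨j, hj1, hjn, rfl⟩ := (hp.mem_iff v).1 hv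
  rcases lt_trichotomy i j with h1 | rfl | h1
  · exact (key i j hi1 h1 hjn hqu hqv).elim
  · rfl
  · exact (key j i hj1 h1 hin hqv hqu).elim

end Canon

namespace Canon

variable {V : Type} {G : SimpleGraph V} {C : Canon} {o : List ℕ} {f : ℕ → Set V}

/-- A successful certificate check transforms a model extended by `Q` into a larger model. -/
theorem Good.exists_model_of_check (hG : C.Good o) [Finite V]
    (hTF : ∀ a b c, G.Adj a b → G.Adj b c → ¬ G.Adj a c) (hSF : ¬ HasSquare G)
    (hU : SplitFree G) {tgts : List Pat} {c : Cert} (h : Model G C.pat f)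
    (ht : Tight G C.pat f) {Q : Set V} (hQ : ConnSet G Q)
    (hQO : ∀ x ∈ Q, ∀ k ∈ C.nodes, x ∉ f k) {pt : Bool} (hpt : pt = true → Q.Subsingleton) {M : ℕ}
    (hM : ∀ k, M.testBit k = true ↔ k ∈ {k | k ∈ C.nodes ∧ Touches G Q (f k)})
    (hc : c.check tgts 16 (C.pat.addNode 16 pt M) (C.arcs.filter fun a => M.testBit a.1) 17 = true)
    (hu : ∀ a ∈ C.arcs, Touches G Q (f a.1) → ∀ x ∈ f a.1, ∀ y ∈ f a.1, Touches G {x} Q →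
      Touches G {y} Q → x = y) :
    ∃ H ∈ tgts, ∃ g, Model G H g := by
  have hn : ∀ k ∈ C.nodes, k ≠ 16 := fun k hk => (hG.lt k hk).ne
  have hM' : Model G (C.pat.addNode 16 pt M) (Function.update f 16 Q) :=
    h.addNode (fun h1 => hn 16 h1 rfl) hQ
      (fun k hk => Set.disjoint_left.2 fun x hx => hQO x hx k hk) hpt
      fun k hk => (hM k).trans ⟨fun h1 => h1.2, fun h1 => ⟨hk, h1⟩⟩
  have hup : ∀ k ∈ C.nodes, Function.update f 16 Q k = f k := fun k hk =>
    Function.update_of_ne (hn k hk) _ _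
  have hptk : ∀ k ∈ C.nodes, (C.pat.addNode 16 pt M).isPt k = C.pat.isPt k := fun k hk => by
    simp [Pat.addNode, natBeq_eq, beq_eq_false_iff_ne.2 (hn k hk)]
  have hmem : ∀ k, k ∈ (C.pat.addNode 16 pt M).nodes ↔ k = 16 ∨ k ∈ C.nodes := fun k => by
    simp [Pat.addNode, pat]
  refine c.sound hTF hSF hU _ _ 17 _ hM' (fun a ha => ?_) (fun k hk => ?_) hc
  · obtain ⟨ha, haM⟩ := List.mem_filter.1 ha
    obtain ⟨m1, m2, m3⟩ := hG.arc_mem a ha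
    obtain ⟨x, y, hx, hy⟩ := hG.exists_ends h ha
    obtain ⟨n, p, hp⟩ := hG.exists_isArc h ht ha hx hy
    have hT := ((hM _).1 haM).2
    refine ⟨⟨(hmem _).2 (Or.inr m1), (hmem _).2 (Or.inr m2), (hmem _).2 (Or.inr m3),
      (hmem _).2 (Or.inl rfl)⟩, ⟨?_, ?_, ?_⟩, ⟨hn _ m1, hn _ m2, hn _ m3⟩,
      ⟨x, y, n, p, ?_, ?_, ?_⟩, ?_, ?_, ?_⟩
    · rw [hptk _ m1, isPt_eq_false ha]
    · rw [hptk _ m2, (hG.arc_pt a ha).1]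
    · rw [hptk _ m3, (hG.arc_pt a ha).2]
    · rw [hup _ m2, hx]
    · rw [hup _ m3, hy]
    · rwa [hup _ m1]
    · rw [hup _ m1, Function.update_self]
      exact hT.symm
    · rw [hup _ m1, Function.update_self]
      exact hu a ha hT
    · intro k hk hka hkT
      rcases (hmem k).1 hk with rfl | hk
      · exact Or.inr (Or.inr rfl)
      · rw [hup _ m1, hup _ hk] at hkT
        exact ((hG.touches_iff h ha hk hka).1 hkT).imp_right Or.inl
  · rcases (hmem k).1 hk with rfl | hk
    · omega
    · have := hG.lt k hk
      omega

/-- A model either extends to a model of a target pattern or can be chosen to cover the graph. -/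
theorem Good.extend (hG : C.Good o) [Finite V] (hT : TwoConnected G) (hC : ¬ HasProper2Cutset G)
    (hTF : ∀ a b c, G.Adj a b → G.Adj b c → ¬ G.Adj a c) (hSF : ¬ HasSquare G)
    (hU : SplitFree G) {tgts : List Pat} {c₁ c₂ : Cert} (h₁ : C.pointCheck tgts c₁ = true)
    (h₂ : C.blobCheck tgts c₂ = true) (h : ∃ f, Model G C.pat f) :
    (∃ f, Model G C.pat f ∧ (∀ v, ∃ k ∈ C.nodes, v ∈ f k) ∧ ∀ a ∈ C.arcs, ArcNode G f a) ∨
      ∃ H ∈ tgts, ∃ g, Model G H g := by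
  obtain ⟨f, h⟩ := h
  obtain ⟨f, h, ht⟩ := h.exists_tight
  by_cases hcov : ∀ v, ∃ k ∈ C.nodes, v ∈ f k
  · refine Or.inl ⟨f, h, hcov, fun a ha => ?_⟩
    obtain ⟨x, y, hx, hy⟩ := hG.exists_ends h ha
    obtain ⟨n, p, hp⟩ := hG.exists_isArc h ht ha hx hy
    exact ⟨x, y, n, p, hx, hy, hp⟩
  push Not at hcov
  obtain ⟨w, hw⟩ := hcov
  right
  obtain ⟨Q, ⟨hQ, hQO, hQL⟩, hmin⟩ := Set.Finite.exists_minimalFor Set.ncard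
    {Q : Set V | ConnSet G Q ∧ (∀ x ∈ Q, ∀ k ∈ C.nodes, x ∉ f k) ∧
      ¬ C.Loc {k | k ∈ C.nodes ∧ Touches G Q (f k)}} (Set.toFinite _)
    (hG.exists_not_loc hT hC h hw)
  by_cases hsub : Q.Subsingleton
  · obtain ⟨q, hq⟩ := hQ.nonempty
    obtain rfl := hsub.eq_singleton_of_mem hq
    have hqO := hQO q rfl
    have hadj : ∀ k ∈ C.nodes, C.pat.isPt k = true → Touches G {q} (f k) →
        ∃ x, f k = {x} ∧ G.Adj q x := by
      intro k hk hp hk'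
      obtain ⟨x, hx⟩ := h.exists_eq_singleton hk hp
      rw [hx, touches_singleton_singleton] at hk'
      exact ⟨x, hx, hk'⟩
    obtain ⟨M, hM, hc⟩ := pointCheck_sound h₁ hQL (fun k hk => hk.1) (by
      rintro p ⟨hp, hpT⟩ k ⟨hk, hkT⟩
      by_contra hconf
      obtain ⟨hpk, pp, pk, hcase⟩ := hG.conf_spec p hp k hk (by simpa using hconf)
      obtain ⟨x, hx, hqx⟩ := hadj p hp pp hpT
      obtain ⟨y, hy, hqy⟩ := hadj k hk pk hkT
      rcases hcase with hadj' | ⟨m, hm, pm, hmp, hmk, hpm, hmk'⟩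
      · exact hTF _ _ _ hqx ((h.adj_of_eq hp hk hpk hx hy).1 hadj') hqy
      · obtain ⟨z, hz⟩ := h.exists_eq_singleton hm pm
        have hxz := (h.adj_of_eq hp hm hmp.symm hx hz).1 hpm
        have hzy := (h.adj_of_eq hm hk hmk hz hy).1 hmk'
        refine hSF ⟨q, x, z, y, hqx, hxz, hzy, hqy.symm, hTF _ _ _ hqx hxz, hTF _ _ _ hxz hzy,
          ?_, h.ne_of_eq hp hk hpk hx hy⟩
        rintro rfl
        exact hqO m hm (hz ▸ rfl))
    refine hG.exists_model_of_check hTF hSF hU h ht hQ hQO (fun _ => hsub) hM hc ?_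
    intro a ha _ x hx y hy hxq hyq
    rw [touches_singleton_singleton] at hxq hyq
    exact hG.arc_unique_of_not_loc hU h ht hqO hQL ha hx hy hxq.symm hyq.symm
  · obtain ⟨r, hr, r', hr', hne⟩ : ∃ r ∈ Q, ∃ r' ∈ Q, r' ≠ r := by
      by_contra! hcon
      exact hsub fun a ha b hb => hcon b hb a ha
    obtain ⟨x, hx, y, hy, hxy, hQx, hQy⟩ := hQ.exists_two_diff_singleton hr hr' hne
    have hloc : ∀ Q' ⊂ Q, ConnSet G Q' → C.Loc {k | k ∈ C.nodes ∧ Touches G Q' (f k)} := by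
      intro Q' hQ' hconn
      by_contra hL
      have h1 := hmin ⟨hconn, fun x hx => hQO x (hQ'.1 hx), hL⟩
      have h2 := Set.ncard_lt_ncard hQ' (Set.toFinite _)
      exact absurd (h1 h2.le) (by omega)
    have key : ∀ x ∈ Q, ∀ y ∈ Q, x ≠ y → ConnSet G (Q \ {x}) → ∃ i ∈ C.nodes, ∃ u ∈ f i,
        G.Adj x u ∧ (∀ z ∈ Q, ∀ v ∈ f i, G.Adj z v → v = u ∧ z = x) ∧
        C.Loc ({k | k ∈ C.nodes ∧ Touches G Q (f k)} \ {i}) := by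
      intro x hx y hy hxy hQx
      have hLx := hloc (Q \ {x}) ⟨Set.sdiff_subset, fun h1 => (h1 hx).2 rfl⟩ hQx
      have hLs := hloc {x} ⟨Set.singleton_subset_iff.2 hx, fun h1 => hxy (h1 hy).symm⟩
        (ConnSet.singleton x)
      have huq : ∀ i ∈ C.nodes, ∀ j ∈ C.nodes, ∀ u ∈ f i, ∀ v ∈ f j, G.Adj x u → G.Adj x v →
          u = v := fun i hi j hj u hu v hv =>
        hG.attach_unique hTF hSF h ht (hQO x hx) hLs hi hj hu hv
      obtain ⟨i, ⟨hi, z, hz, u, hu, hzu⟩, hix⟩ := Set.not_subset.1 fun h1 => hQL (hLx.mono h1)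
      have hzx : ∀ z ∈ Q, ∀ v ∈ f i, G.Adj z v → z = x := fun z hz v hv hzv => by
        by_contra hne
        exact hix ⟨hi, z, ⟨hz, hne⟩, v, hv, hzv⟩
      obtain rfl := hzx z hz u hu hzu
      refine ⟨i, hi, u, hu, hzu, fun w hw v hv hwv => ?_, hLx.mono ?_⟩
      · obtain rfl := hzx w hw v hv hwv
        exact ⟨huq i hi i hi v hv u hu hwv hzu, rfl⟩
      · rintro k ⟨⟨hk, w, hw, v, hv, hwv⟩, hki⟩
        refine ⟨hk, w, ⟨hw, ?_⟩, v, hv, hwv⟩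
        rintro rfl
        obtain rfl := huq k hk i hi v hv u hu hwv hzu
        exact Set.disjoint_left.1 (h.disj k hk i hi hki) hv hu
    obtain ⟨i, hi, u, hu, hxu, hiu, hLi⟩ := key x hx y hy hxy hQx
    obtain ⟨j, hj, v, hv, hyv, hjv, hLj⟩ := key y hy x hx hxy.symm hQy
    have hij : i ≠ j := by
      rintro rfl
      exact hxy (hjv x hx u hu hxu).2
    have hiT : i ∈ {k | k ∈ C.nodes ∧ Touches G Q (f k)} := ⟨hi, x, hx, u, hu, hxu⟩
    have hjT : j ∈ {k | k ∈ C.nodes ∧ Touches G Q (f k)} := ⟨hj, y, hy, v, hv, hyv⟩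
    obtain ⟨M, hM, hc⟩ := blobCheck_sound h₂ hQL (fun k hk => hk.1) hiT hjT hij hLi hLj
    refine hG.exists_model_of_check hTF hSF hU h ht hQ hQO (by simp) hM hc ?_
    have honly : ∀ a ∈ C.arcs, Touches G Q (f a.1) → a.1 = i ∨ a.1 = j := by
      intro a ha haT
      by_contra! hne
      have haT' : a.1 ∈ {k | k ∈ C.nodes ∧ Touches G Q (f k)} := ⟨(hG.arc_mem a ha).1, haT⟩
      have hsubs : ∀ i j, j ∈ {k | k ∈ C.nodes ∧ Touches G Q (f k)} → j ≠ i → a.1 ≠ i → a.1 ≠ j →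
          C.Loc ({k | k ∈ C.nodes ∧ Touches G Q (f k)} \ {i}) →
          {k | k ∈ C.nodes ∧ Touches G Q (f k)} \ {i} ⊆ {a.1, a.2.1, a.2.2} := by
        rintro i j hjT hji hai haj (⟨l, -, hl⟩ | ⟨b, hb, hsb⟩)
        · exact absurd ((hl ⟨haT', hai⟩ : a.1 = l).trans (hl ⟨hjT, hji⟩ : j = l).symm) haj
        · rcases hsb ⟨haT', hai⟩ with h1 | h1 | h1
          · obtain rfl := hG.arc_unique a ha b hb h1
            exact hsb
          · exact absurd h1 (isPt_iff.1 (hG.arc_pt b hb).1 a ha)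
          · exact absurd h1 (isPt_iff.1 (hG.arc_pt b hb).2 a ha)
      refine hQL (Or.inr ⟨a, ha, fun k hk => ?_⟩)
      by_cases hki : k = i
      · exact hsubs j i hiT hij hne.2 hne.1 hLj ⟨hk, fun h1 => hij (hki.symm.trans h1)⟩
      · exact hsubs i j hjT hij.symm hne.1 hne.2 hLi ⟨hk, hki⟩
    rintro a ha haT b hb c hc ⟨_, rfl, z, hz, hbz⟩ ⟨_, rfl, z', hz', hcz⟩
    rcases honly a ha haT with h1 | h1
    · rw [h1] at hb hc
      exact (hiu z hz _ hb hbz.symm).1.trans (hiu z' hz' _ hc hcz.symm).1.symm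
    · rw [h1] at hb hc
      exact (hjv z hz _ hb hbz.symm).1.trans (hjv z' hz' _ hc hcz.symm).1.symm

end Canon

section Subdivision

/-- The map `c` contracts connected pieces of `G` consisting of vertices of degree two, to give the
graph `H`. -/
structure IsContraction {W : Type} (H : SimpleGraph W) {V : Type} (G : SimpleGraph V)
    (c : V → W) : Prop where
  surj : Function.Surjective c
  hom : ∀ v v', G.Adj v v' → c v ≠ c v' → H.Adj (c v) (c v')
  lift : ∀ w w', H.Adj w w' → ∃ v v', c v = w ∧ c v' = w' ∧ G.Adj v v'
  conn : ∀ w, ConnSet G (c ⁻¹' {w})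
  two : ∀ v v', v ≠ v' → c v = c v' → ∃ a b, a ≠ b ∧ ∀ z, G.Adj v z ↔ z = a ∨ z = b
  ends : ∀ v v', v ≠ v' → c v = c v' → ∃ w w', w ≠ w' ∧ H.Adj (c v) w ∧ H.Adj (c v) w'

/-- Delete the vertex `y` and add the edge `xq`. -/
def bypass {V : Type} (G : SimpleGraph V) (y : V) {x q : V} (hxq : x ≠ q) :
    SimpleGraph {v : V // v ≠ y} where
  Adj a b := G.Adj a b ∨ (a.1 = x ∧ b.1 = q) ∨ (a.1 = q ∧ b.1 = x)
  symm := ⟨by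
    rintro a b (h | h | h)
    · exact Or.inl h.symm
    · exact Or.inr (Or.inr h.symm)
    · exact Or.inr (Or.inl h.symm)⟩
  loopless := ⟨by
    rintro a (h | h | h)
    · exact G.loopless.irrefl _ h
    · exact hxq (h.1.symm.trans h.2)
    · exact hxq (h.2.symm.trans h.1)⟩

variable {V : Type} {G : SimpleGraph V} {x y q : V}

theorem bypass_adj (hxq : x ≠ q) {a b : {v : V // v ≠ y}} :
    (bypass G y hxq).Adj a b ↔ G.Adj a b ∨ (a.1 = x ∧ b.1 = q) ∨ (a.1 = q ∧ b.1 = x) :=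
  Iff.rfl

/-- Subdividing the new edge restores the graph. -/
theorem nonempty_iso_subdivideEdge (hxy : x ≠ y) (hqy : q ≠ y) (hxq : x ≠ q)
    (hnxq : ¬ G.Adj x q) (hy : ∀ z, G.Adj y z ↔ z = x ∨ z = q) :
    Nonempty (G ≃g SubdivideEdge (bypass G y hxq) ⟨x, hxy⟩ ⟨q, hqy⟩) := by
  classical
  let e : {v : V // v ≠ y} ⊕ Unit ≃ V :=
    { toFun := Sum.elim Subtype.val fun _ => y
      invFun := fun v => if h : v = y then Sum.inr () else Sum.inl ⟨v, h⟩
      left_inv := by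
        rintro (⟨v, hv⟩ | _)
        · simp [hv]
        · simp
      right_inv := by
        intro v
        by_cases h : v = y
        · simp [h]
        · simp [h] }
  refine ⟨RelIso.symm ⟨e, ?_⟩⟩
  rintro (a | _) (b | _)
  · have h1 := bypass_adj (G := G) (y := y) hxq (a := a) (b := b)
    simp only [e, Equiv.coe_fn_mk, Sum.elim_inl, SubdivideEdge, SimpleGraph.fromRel_adj, h1,
      (bypass G y hxq).adj_comm b a, Sym2.eq_iff, Subtype.ext_iff, ne_eq,
      Sum.inl.injEq]
    constructor
    · intro h
      refine ⟨fun h2 => h.ne h2, Or.inl ⟨Or.inl h, ?_⟩⟩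
      rintro (⟨h2, h3⟩ | ⟨h2, h3⟩)
      · rw [h2, h3] at h
        exact hnxq h
      · rw [h2, h3] at h
        exact hnxq h.symm
    · tauto
  · have h1 := hy a
    simp only [e, Equiv.coe_fn_mk, Sum.elim_inl, Sum.elim_inr, SubdivideEdge,
      SimpleGraph.fromRel_adj, G.adj_comm a y, h1, Subtype.ext_iff, ne_eq]
    simp
  · have h1 := hy b
    simp only [e, Equiv.coe_fn_mk, Sum.elim_inl, Sum.elim_inr, SubdivideEdge,
      SimpleGraph.fromRel_adj, h1, Subtype.ext_iff, ne_eq]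
    simp
  · simp [e, SubdivideEdge]

theorem IsContraction.bypass {W : Type} {H : SimpleGraph W} {c : V → W}
    (h : IsContraction H G c) (hxy : x ≠ y) (hqy : q ≠ y) (hxq : x ≠ q) {p : V} (hpq : p ≠ q)
    (hc : c x = c y) (hx : ∀ z, G.Adj x z ↔ z = p ∨ z = y)
    (hy : ∀ z, G.Adj y z ↔ z = x ∨ z = q) :
    IsContraction H (bypass G y hxq) fun v => c v.1 := by
  have hnxq : ¬ G.Adj x q := by
    rw [hx]
    tauto
  have hyq : G.Adj y q := (hy q).2 (Or.inr rfl)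
  have hpy : p ≠ y := by
    rintro rfl
    have h1 := (hx p).2 (Or.inl rfl)
    obtain ⟨a, b, hab, ha⟩ := h.two x p h1.ne hc
    exact hab (((hx a).1 ((ha a).2 (Or.inl rfl))).elim id id |>.trans
      (((hx b).1 ((ha b).2 (Or.inr rfl))).elim id id).symm)
  have hadj := fun a b => bypass_adj (G := G) (y := y) hxq (a := a) (b := b)
  refine ⟨fun w => ?_, fun v v' hv hne => ?_, fun w w' hw => ?_, fun w => ⟨?_, fun X hX hcl => ?_⟩,
    fun v v' hne hv => ?_, fun v v' hne hv => h.ends v v' (fun e => hne (Subtype.ext e)) hv⟩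
  · obtain ⟨v, rfl⟩ := h.surj w
    by_cases hv : v = y
    · exact ⟨⟨x, hxy⟩, hv ▸ hc⟩
    · exact ⟨⟨v, hv⟩, rfl⟩
  · rcases (hadj _ _).1 hv with h1 | ⟨h1, h2⟩ | ⟨h1, h2⟩
    · exact h.hom _ _ h1 hne
    · simp only [h1, h2, hc] at hne ⊢
      exact h.hom _ _ hyq hne
    · simp only [h1, h2, hc] at hne ⊢
      exact h.hom _ _ hyq.symm hne
  · obtain ⟨v, v', rfl, rfl, hv⟩ := h.lift w w' hw
    by_cases h1 : v = y
    · subst h1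
      rcases (hy v').1 hv with rfl | rfl
      · exact absurd (hc ▸ hw) (H.loopless.irrefl _)
      · exact ⟨⟨x, hxy⟩, ⟨v', hqy⟩, hc, rfl, (hadj _ _).2 (Or.inr (Or.inl ⟨rfl, rfl⟩))⟩
    by_cases h2 : v' = y
    · subst h2
      rcases (hy v).1 hv.symm with rfl | rfl
      · exact absurd (hc ▸ hw) (H.loopless.irrefl _)
      · exact ⟨⟨v, hqy⟩, ⟨x, hxy⟩, rfl, hc, (hadj _ _).2 (Or.inr (Or.inr ⟨rfl, rfl⟩))⟩
    exact ⟨⟨v, h1⟩, ⟨v', h2⟩, rfl, rfl, (hadj _ _).2 (Or.inl hv)⟩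
  · obtain ⟨v, hv⟩ := (h.conn w).nonempty
    by_cases h1 : v = y
    · exact ⟨⟨x, hxy⟩, hc.trans (h1 ▸ hv)⟩
    · exact ⟨⟨v, h1⟩, hv⟩
  · have key := (h.conn w).subset_of_closed
      {v | (∃ hv : v ≠ y, ⟨v, hv⟩ ∈ X) ∨ v = y ∧ ⟨x, hxy⟩ ∈ X} (by
        obtain ⟨v, hv, hvX⟩ := hX
        exact ⟨v, hv, Or.inl ⟨v.2, hvX⟩⟩) (by
        rintro a ha (⟨hay, haX⟩ | ⟨rfl, hxX⟩) b hb hab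
        · by_cases hby : b = y
          · subst hby
            rcases (hy a).1 hab.symm with rfl | rfl
            · exact Or.inr ⟨rfl, haX⟩
            · exact Or.inr ⟨rfl, hcl ⟨a, hay⟩ ha haX ⟨x, hxy⟩ (hc.trans hb)
                ((hadj _ _).2 (Or.inr (Or.inr ⟨rfl, rfl⟩)))⟩
          · exact Or.inl ⟨hby, hcl ⟨a, hay⟩ ha haX ⟨b, hby⟩ hb ((hadj _ _).2 (Or.inl hab))⟩
        · rcases (hy b).1 hab with rfl | rfl
          · exact Or.inl ⟨hxy, hxX⟩
          · exact Or.inl ⟨hqy, hcl ⟨x, hxy⟩ (hc.trans ha) hxX ⟨b, hqy⟩ hb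
                ((hadj _ _).2 (Or.inr (Or.inl ⟨rfl, rfl⟩)))⟩)
    intro v hv
    rcases key hv with ⟨_, h1⟩ | ⟨h1, -⟩
    · exact h1
    · exact absurd h1 v.2
  · obtain ⟨a, b, hab, hN⟩ := h.two v v' (fun e => hne (Subtype.ext e)) hv
    obtain ⟨v, hvy⟩ := v
    simp only at hN hv
    by_cases hvx : v = x
    · subst hvx
      refine ⟨⟨p, hpy⟩, ⟨q, hqy⟩, fun e => hpq (Subtype.ext_iff.1 e), fun ⟨z, hz⟩ => ?_⟩
      rw [hadj, hx]
      simp only [Subtype.ext_iff, true_and]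
      tauto
    by_cases hvq : v = q
    · subst hvq
      obtain ⟨b, hby, hbx, hN⟩ : ∃ b, b ≠ y ∧ b ≠ x ∧ ∀ z, G.Adj v z ↔ z = y ∨ z = b := by
        rcases (hN y).1 hyq.symm with rfl | rfl
        · exact ⟨b, hab.symm, fun e => hnxq ((hN x).2 (Or.inr e.symm)).symm, hN⟩
        · exact ⟨a, hab, fun e => hnxq ((hN x).2 (Or.inl e.symm)).symm,
            fun z => (hN z).trans or_comm⟩
      refine ⟨⟨b, hby⟩, ⟨x, hxy⟩, fun e => hbx (Subtype.ext_iff.1 e), fun ⟨z, hz⟩ => ?_⟩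
      rw [hadj, hN]
      simp only [Subtype.ext_iff, true_and]
      tauto
    have hny : ¬ G.Adj v y := fun h1 => by
      have := (hy v).1 h1.symm
      tauto
    refine ⟨⟨a, ?_⟩, ⟨b, ?_⟩, fun e => hab (Subtype.ext_iff.1 e), fun ⟨z, hz⟩ => ?_⟩
    · rintro rfl
      exact hny ((hN a).2 (Or.inl rfl))
    · rintro rfl
      exact hny ((hN b).2 (Or.inr rfl))
    · rw [hadj, hN]
      simp only [Subtype.ext_iff]
      tauto

theorem IsContraction.isSubdivisionOf {W : Type} {H : SimpleGraph W} [Finite V] {c : V → W}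
    (h : IsContraction H G c) : IsSubdivisionOf H G := by
  induction hn : Nat.card V using Nat.strong_induction_on generalizing V with
  | _ n ih =>
    by_cases hinj : Function.Injective c
    · refine IsSubdivisionOf.refl H G ⟨Equiv.ofBijective c ⟨hinj, h.surj⟩, ?_⟩
      intro a b
      change H.Adj (c a) (c b) ↔ G.Adj a b
      constructor
      · intro hab
        obtain ⟨v, v', hv, hv', hadj⟩ := h.lift _ _ hab
        rwa [← hinj hv, ← hinj hv']
      · intro hab
        exact h.hom a b hab fun e => hab.ne (hinj e)
    · simp only [Function.Injective, not_forall] at hinj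
      obtain ⟨x, y, hxy, hne⟩ := hinj
      obtain ⟨x', hx', hxx, y, hy', hyx, hadj⟩ := (h.conn (c x)).exists_adj (X := {x}) rfl rfl
        (y := y) hxy.symm (fun e => hne e.symm)
      obtain rfl : x' = x := hxx
      have hc : c x' = c y := hy'.symm
      have hxy := hadj.ne
      have hother : ∀ a b, G.Adj a b → (∃ s t, s ≠ t ∧ ∀ z, G.Adj a z ↔ z = s ∨ z = t) →
          ∃ s, s ≠ b ∧ ∀ z, G.Adj a z ↔ z = s ∨ z = b := by
        rintro a b hab ⟨s, t, hst, hN⟩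
        rcases (hN b).1 hab with rfl | rfl
        · exact ⟨t, hst.symm, fun z => (hN z).trans or_comm⟩
        · exact ⟨s, hst, hN⟩
      obtain ⟨p, hpy, hNx⟩ := hother x' y hadj (h.two _ _ hxy hc)
      obtain ⟨q, hqx, hNy⟩ := hother y x' hadj.symm (h.two _ _ hxy.symm hc.symm)
      have hNy' : ∀ z, G.Adj y z ↔ z = x' ∨ z = q := fun z => (hNy z).trans or_comm
      have hqy : q ≠ y := ((hNy q).2 (Or.inl rfl)).ne'
      have hpq : p ≠ q := by
        rintro rfl
        have hsub : c ⁻¹' {c x'} ⊆ {x', y, p} := by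
          refine (h.conn (c x')).subset_of_closed _ ⟨x', rfl, Or.inl rfl⟩ ?_
          rintro a ha (rfl | rfl | rfl) b hb hab
          · rcases (hNx b).1 hab with rfl | rfl <;> simp
          · rcases (hNy b).1 hab with rfl | rfl <;> simp
          · obtain ⟨s, hs, hN⟩ := hother a x' ((hNx a).2 (Or.inl rfl)).symm
              (h.two _ _ hqx ha)
            rcases (hN y).1 ((hNy a).2 (Or.inl rfl)).symm with rfl | rfl
            · rcases (hN b).1 hab with rfl | rfl <;> simp
            · exact absurd rfl hxy
        have hout : ∀ w, H.Adj (c x') w → w = c p := by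
          intro w hw
          obtain ⟨a, b, ha, rfl, hab⟩ := h.lift _ _ hw
          have hbF : c b ≠ c x' := hw.ne'
          rcases hsub ha with rfl | rfl | rfl
          · rcases (hNx b).1 hab with rfl | rfl
            · rfl
            · exact absurd hc.symm hbF
          · rcases (hNy b).1 hab with rfl | rfl
            · rfl
            · exact absurd rfl hbF
          · obtain ⟨s, hs, hN⟩ := hother a x' ((hNx a).2 (Or.inl rfl)).symm
              (h.two _ _ hqx ha)
            rcases (hN y).1 ((hNy a).2 (Or.inl rfl)).symm with rfl | rfl
            · rcases (hN b).1 hab with rfl | rfl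
              · exact absurd hc.symm hbF
              · exact absurd rfl hbF
            · exact absurd rfl hxy
        obtain ⟨w, w', hww, hw, hw'⟩ := h.ends _ _ hxy hc
        exact hww ((hout w hw).trans (hout w' hw').symm)
      have hcon := h.bypass hxy hqy hqx.symm hpq hc hNx hNy'
      obtain ⟨e⟩ := nonempty_iso_subdivideEdge hxy hqy hqx.symm
        (by rw [hNx]; tauto) hNy'
      refine IsSubdivisionOf.step H _ ⟨x', hxy⟩ ⟨q, hqy⟩
        ((bypass_adj _).2 (Or.inr (Or.inl ⟨rfl, rfl⟩))) (Or.inl ?_)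
        (ih (Nat.card {v : V // v ≠ y}) ?_ hcon rfl) G e
      · rw [← Set.ncard_pair (a := (⟨p, hpy⟩ : {v : V // v ≠ y})) (b := ⟨q, hqy⟩)
          (fun e => hpq (Subtype.ext_iff.1 e))]
        congr 1
        ext ⟨z, hz⟩
        rw [SimpleGraph.mem_neighborSet, bypass_adj, hNx]
        simp only [Set.mem_insert_iff, Set.mem_singleton_iff, Subtype.ext_iff, true_and]
        tauto
      · rw [← hn]
        exact Finite.card_subtype_lt (x := y) (by simp)

end Subdivision

/-- A model covering the graph in which all nodes that are not points are arcs exhibits the graph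
as a 2-extension. -/
theorem Canon.Good.isTwoExtensionOf {V : Type} {G : SimpleGraph V} [Finite V] {C : Canon}
    {o : List ℕ} {f : ℕ → Set V} (hG : C.Good o) (h : Model G C.pat f)
    (hcov : ∀ v, ∃ k ∈ C.nodes, v ∈ f k) (harc : ∀ a ∈ C.arcs, ArcNode G f a) {W : Type}
    {H : SimpleGraph W} (φ : ℕ → W)
    (hφ : ∀ i ∈ C.nodes, ∀ j ∈ C.nodes, i ≠ j →
      φ i ≠ φ j ∧ (H.Adj (φ i) (φ j) ↔ C.pat.adj i j = true)) :
    IsTwoExtensionOf H G := by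
  choose κ hκ hκf using hcov
  have hinj : ∀ i ∈ C.nodes, ∀ j ∈ C.nodes, φ i = φ j → i = j := fun i hi j hj e =>
    by_contra fun hij => (hφ i hi j hj hij).1 e
  have hκk : ∀ v, ∀ k ∈ C.nodes, v ∈ f k → κ v = k := fun v k hk hv => by
    by_contra hne
    exact Set.disjoint_left.1 (h.disj _ (hκ v) k hk hne) (hκf v) hv
  let S : Set W := {w | ∀ k ∈ C.nodes, φ k ≠ w}
  have hS : ∀ k ∈ C.nodes, φ k ∈ Sᶜ := fun k hk h1 => h1 k hk rfl
  have hS' : ∀ w : ↥Sᶜ, ∃ k, ∃ hk : k ∈ C.nodes, w = ⟨φ k, hS k hk⟩ := by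
    rintro ⟨w, hw⟩
    simp only [S, Set.mem_compl_iff, Set.mem_ofPred_eq, not_forall, not_not] at hw
    obtain ⟨k, hk, rfl⟩ := hw
    exact ⟨k, hk, rfl⟩
  let c : V → ↥Sᶜ := fun v => ⟨φ (κ v), hS _ (hκ v)⟩
  have hc : ∀ v k (hk : k ∈ C.nodes), c v = ⟨φ k, hS k hk⟩ ↔ v ∈ f k := by
    intro v k hk
    refine ⟨fun e => ?_, fun hv => ?_⟩
    · rw [← hinj _ (hκ v) k hk (Subtype.ext_iff.1 e)]
      exact hκf v
    · simp [c, hκk v k hk hv]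
  have hadj : ∀ i (hi : i ∈ C.nodes) j (hj : j ∈ C.nodes), i ≠ j →
      ((H.induce Sᶜ).Adj ⟨φ i, hS i hi⟩ ⟨φ j, hS j hj⟩ ↔ Touches G (f i) (f j)) := by
    intro i hi j hj hij
    rw [← h.adj i hi j hj hij, ← (hφ i hi j hj hij).2]
    rfl
  have hfib : ∀ v v', v ≠ v' → c v = c v' → ∃ a ∈ C.arcs, v ∈ f a.1 := by
    intro v v' hne e
    rcases Canon.isPt_or (C := C) (κ v) with hp | ⟨a, ha, hav⟩
    · exact absurd (h.pt _ (hκ v) hp (hκf v) ((hc v' _ (hκ v)).1 e.symm)) hne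
    · exact ⟨a, ha, hav ▸ hκf v⟩
  refine ⟨S, IsContraction.isSubdivisionOf (c := c) ⟨fun w => ?_, fun v v' hv hne => ?_,
    fun w w' hw => ?_, fun w => ?_, fun v v' hne e => ?_, fun v v' hne e => ?_⟩⟩
  · obtain ⟨k, hk, rfl⟩ := hS' w
    obtain ⟨v, hv⟩ := (h.conn k hk).nonempty
    exact ⟨v, (hc v k hk).2 hv⟩
  · refine (hadj _ (hκ v) _ (hκ v') fun e => hne ?_).2 ⟨v, hκf v, v', hκf v', hv⟩
    simp [c, e]
  · obtain ⟨k, hk, rfl⟩ := hS' w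
    obtain ⟨l, hl, rfl⟩ := hS' w'
    obtain ⟨v, hv, v', hv', hadj'⟩ := (hadj k hk l hl (by rintro rfl; exact hw.ne rfl)).1 hw
    exact ⟨v, v', (hc v k hk).2 hv, (hc v' l hl).2 hv', hadj'⟩
  · obtain ⟨k, hk, rfl⟩ := hS' w
    have : c ⁻¹' {⟨φ k, hS k hk⟩} = f k := Set.ext fun v => hc v k hk
    rw [this]
    exact h.conn k hk
  · obtain ⟨a, ha, hv⟩ := hfib v v' hne e
    obtain ⟨m1, m2, m3⟩ := hG.arc_mem a ha
    obtain ⟨x, y, n, p, hx, hy, hp⟩ := harc a ha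
    obtain ⟨i, hi1, hin, rfl⟩ := (hp.mem_iff v).1 hv
    refine ⟨p (i + 1), p (i - 1), fun e => ?_, fun z => ⟨fun hz => ?_, ?_⟩⟩
    · have := hp.inj _ _ (by omega) (by omega) e
      omega
    · have : ∃ j, j ≤ n + 1 ∧ p j = z := by
        by_cases hza : κ z = a.1
        · obtain ⟨j, -, hj, hjz⟩ := (hp.mem_iff z).1 (hza ▸ hκf z)
          exact ⟨j, by omega, hjz⟩
        · have hzf := hκf z
          rcases (hG.touches_iff h ha (hκ z) hza).1 ⟨_, hv, z, hzf, hz⟩ with h1 | h1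
          · rw [h1, hx] at hzf
            exact ⟨0, by omega, hp.zero.trans hzf.symm⟩
          · rw [h1, hy] at hzf
            exact ⟨n + 1, le_rfl, hp.last.trans hzf.symm⟩
      obtain ⟨j, hj, rfl⟩ := this
      rcases (hp.adj_iff hi1 hin hj).1 hz with rfl | rfl
      · exact Or.inl rfl
      · exact Or.inr rfl
    · rintro (rfl | rfl)
      · exact hp.step i hin
      · exact (hp.adj_iff hi1 hin (by omega)).2 (by omega)
  · obtain ⟨a, ha, hv⟩ := hfib v v' hne e
    obtain ⟨m1, m2, m3⟩ := hG.arc_mem a ha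
    obtain ⟨n1, n2⟩ := hG.ne ha
    have hcv := (hc v _ m1).2 hv
    refine ⟨⟨_, hS _ m2⟩, ⟨_, hS _ m3⟩, fun e =>
      (hφ _ m2 _ m3 (hG.arc_ne a ha)).1 (Subtype.ext_iff.1 e), ?_, ?_⟩
    · rw [hcv, hadj _ m1 _ m2 n1.symm]
      exact (hG.touches_iff h ha m2 n1).2 (Or.inl rfl)
    · rw [hcv, hadj _ m1 _ m3 n2.symm]
      exact (hG.touches_iff h ha m3 n2).2 (Or.inr rfl)

instance : DecidableRel petersen.Adj
  | Sum.inl i, Sum.inl j => decidable_of_iff (i ≠ j ∧ (j = i + 1 ∨ i = j + 1)) (by simp [petersen])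
  | Sum.inr i, Sum.inr j => decidable_of_iff (i ≠ j ∧ (j = i + 2 ∨ i = j + 2)) (by simp [petersen])
  | Sum.inl i, Sum.inr j => decidable_of_iff (i = j) (by simp [petersen])
  | Sum.inr i, Sum.inl j => decidable_of_iff (j = i) (by simp [petersen])

instance : DecidableRel heawood.Adj := by
  unfold heawood
  infer_instance

/-- The vertex of the Petersen graph with the given label. -/
def petersenVertex (k : ℕ) : Fin 5 ⊕ Fin 5 :=
  if k < 5 then Sum.inl (Fin.ofNat 5 k) else Sum.inr (Fin.ofNat 5 k)

namespace Canon

theorem pet₁₀_spec : ∀ i ∈ pet₁₀.nodes, ∀ j ∈ pet₁₀.nodes, i ≠ j →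
    petersenVertex i ≠ petersenVertex j ∧
      (petersen.Adj (petersenVertex i) (petersenVertex j) ↔ pet₁₀.pat.adj i j = true) := by
  decide +kernel

theorem hea₁₄_spec : ∀ i ∈ hea₁₄.nodes, ∀ j ∈ hea₁₄.nodes, i ≠ j →
    Fin.ofNat 14 i ≠ Fin.ofNat 14 j ∧
      (heawood.Adj (Fin.ofNat 14 i) (Fin.ofNat 14 j) ↔ hea₁₄.pat.adj i j = true) := by
  decide +kernel

end Canon

section Bicycle

variable {V : Type} {G : SimpleGraph V}

theorem IsArc.disjoint_image {D : Set V} {s t : V} {n : ℕ} {p : ℕ → V} (h : IsArc G D s t n p)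
    {a b c d : ℕ} (hbc : b < c) (hd : d ≤ n + 1) :
    Disjoint (p '' Set.Icc a b) (p '' Set.Icc c d) := by
  rw [Set.disjoint_left]
  rintro _ ⟨k, ⟨h1, h2⟩, rfl⟩ ⟨l, ⟨h3, h4⟩, h5⟩
  have := h.inj l k (by omega) (by omega) h5
  omega

theorem IsArc.touches_image_iff {D : Set V} {s t : V} {n : ℕ} {p : ℕ → V}
    (h : IsArc G D s t n p) (hst : G.Adj s t) {a b c d : ℕ} (hab : a ≤ b) (hbc : b < c)
    (hcd : c ≤ d) (hd : d ≤ n + 1) :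
    Touches G (p '' Set.Icc a b) (p '' Set.Icc c d) ↔ c = b + 1 ∨ (a = 0 ∧ d = n + 1) := by
  constructor
  · rintro ⟨_, ⟨k, ⟨h1, h2⟩, rfl⟩, _, ⟨l, ⟨h3, h4⟩, rfl⟩, h5⟩
    have := h.adj k l (by omega) (by omega) h5
    omega
  · rintro (rfl | ⟨rfl, rfl⟩)
    · exact ⟨_, ⟨b, ⟨hab, le_rfl⟩, rfl⟩, _, ⟨b + 1, ⟨le_rfl, hcd⟩, rfl⟩, h.step b (by omega)⟩
    · refine ⟨_, ⟨0, ⟨le_rfl, hab⟩, rfl⟩, _, ⟨n + 1, ⟨hcd, le_rfl⟩, rfl⟩, ?_⟩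
      rwa [h.zero, h.last]

/-- Two arcs joined by a single edge give a model of the smallest pattern. -/
theorem exists_model_pet₈ {u v : V} {A B : Set V} {n m : ℕ} {p q : ℕ → V} {i j : ℕ}
    (huv : G.Adj u v) (hp : IsArc G A u v n p) (hq : IsArc G B u v m q) (hAB : Disjoint A B)
    (hi : 2 ≤ i) (hin : i < n) (hj : 2 ≤ j) (hjm : j < m) (hij : G.Adj (p i) (q j))
    (hu : ∀ k l, 1 ≤ k → k ≤ n → 1 ≤ l → l ≤ m → G.Adj (p k) (q l) → k = i ∧ l = j) :
    ∃ f, Model G pet₈.pat f := by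
  have hd : ∀ {a b c d : ℕ}, 1 ≤ a → b ≤ n → 1 ≤ c → d ≤ m →
      Disjoint (p '' Set.Icc a b) (q '' Set.Icc c d) := by
    intro a b c d ha hb hc hd
    refine hAB.mono ?_ ?_
    · rintro _ ⟨k, ⟨h1, h2⟩, rfl⟩
      exact hp.mem (by omega) (by omega)
    · rintro _ ⟨k, ⟨h1, h2⟩, rfl⟩
      exact hq.mem (by omega) (by omega)
  have ht : ∀ {a b c d : ℕ}, 1 ≤ a → b ≤ n → 1 ≤ c → d ≤ m →
      (Touches G (p '' Set.Icc a b) (q '' Set.Icc c d) ↔ a ≤ i ∧ i ≤ b ∧ c ≤ j ∧ j ≤ d) := by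
    intro a b c d ha hb hc hd
    constructor
    · rintro ⟨_, ⟨k, ⟨h1, h2⟩, rfl⟩, _, ⟨l, ⟨h3, h4⟩, rfl⟩, h5⟩
      have := hu k l (by omega) (by omega) (by omega) (by omega) h5
      omega
    · rintro ⟨h1, h2, h3, h4⟩
      exact ⟨_, ⟨i, ⟨h1, h2⟩, rfl⟩, _, ⟨j, ⟨h3, h4⟩, rfl⟩, hij⟩
  let f : ℕ → Set V
    | 2 => p '' Set.Icc 1 (i - 1)
    | 3 => p '' Set.Icc 0 0
    | 4 => q '' Set.Icc 1 (j - 1)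
    | 5 => p '' Set.Icc (i + 1) n
    | 6 => q '' Set.Icc (j + 1) m
    | 7 => p '' Set.Icc i i
    | 8 => p '' Set.Icc (n + 1) (n + 1)
    | 9 => q '' Set.Icc j j
    | _ => ∅
  have f3 : f 3 = q '' Set.Icc 0 0 := by simp [f, hp.zero, hq.zero]
  have f8 : f 8 = q '' Set.Icc (m + 1) (m + 1) := by simp [f, hp.last, hq.last]
  obtain ⟨R, hR'⟩ : ∃ R : ℕ → ℕ → Prop, ∀ a b, R a b ↔ Disjoint (f a) (f b) ∧
      (pet₈.pat.adj a b = true ↔ Touches G (f a) (f b)) ∧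
      pet₈.pat.adj b a = pet₈.pat.adj a b := ⟨_, fun _ _ => Iff.rfl⟩
  have hRs : Std.Symm R := ⟨fun a b h => by
    rw [hR'] at h ⊢
    exact ⟨h.1.symm, by rw [h.2.2, h.2.1, touches_comm], h.2.2.symm⟩⟩
  have hpp : ∀ x y a b c d, f x = p '' Set.Icc a b → f y = p '' Set.Icc c d → a ≤ b → b < c →
      c ≤ d → d ≤ n + 1 → pet₈.pat.adj y x = pet₈.pat.adj x y →
      (pet₈.pat.adj x y = true ↔ c = b + 1 ∨ (a = 0 ∧ d = n + 1)) → R x y := by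
    intro x y a b c d hx hy h1 h2 h3 h4 h5 h6
    refine (hR' x y).2 ⟨?_, ?_, h5⟩
    · rw [hx, hy]
      exact hp.disjoint_image h2 h4
    · rw [h6, hx, hy, hp.touches_image_iff huv h1 h2 h3 h4]
  have hqq : ∀ x y a b c d, f x = q '' Set.Icc a b → f y = q '' Set.Icc c d → a ≤ b → b < c →
      c ≤ d → d ≤ m + 1 → pet₈.pat.adj y x = pet₈.pat.adj x y →
      (pet₈.pat.adj x y = true ↔ c = b + 1 ∨ (a = 0 ∧ d = m + 1)) → R x y := by
    intro x y a b c d hx hy h1 h2 h3 h4 h5 h6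
    refine (hR' x y).2 ⟨?_, ?_, h5⟩
    · rw [hx, hy]
      exact hq.disjoint_image h2 h4
    · rw [h6, hx, hy, hq.touches_image_iff huv h1 h2 h3 h4]
  have hpq : ∀ x y a b c d, f x = p '' Set.Icc a b → f y = q '' Set.Icc c d → 1 ≤ a → b ≤ n →
      1 ≤ c → d ≤ m → pet₈.pat.adj y x = pet₈.pat.adj x y →
      (pet₈.pat.adj x y = true ↔ a ≤ i ∧ i ≤ b ∧ c ≤ j ∧ j ≤ d) → R x y := by
    intro x y a b c d hx hy h1 h2 h3 h4 h5 h6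
    refine (hR' x y).2 ⟨?_, ?_, h5⟩
    · rw [hx, hy]
      exact hd h1 h2 h3 h4
    · rw [h6, hx, hy, ht h1 h2 h3 h4]
  have hR : [3, 2, 7, 5, 4, 9, 6, 8].Pairwise R := by
    have hb : ∀ {b : Bool} {P : Prop}, (if b then P else ¬ P) → (b = true ↔ P) := by
      intro b P h
      cases b <;> simpa using h
    simp only [List.pairwise_cons, List.mem_cons, List.not_mem_nil, or_false, forall_eq_or_imp,
      forall_eq, IsEmpty.forall_iff, implies_true, List.Pairwise.nil, and_true]
    refine ⟨⟨?_, ?_, ?_, ?_, ?_, ?_, ?_⟩, ⟨?_, ?_, ?_, ?_, ?_, ?_⟩, ⟨?_, ?_, ?_, ?_, ?_⟩,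
      ⟨?_, ?_, ?_, ?_⟩, ⟨?_, ?_, ?_⟩, ⟨?_, ?_⟩, ?_⟩
    all_goals first
      | refine hpp _ _ _ _ _ _ rfl rfl ?_ ?_ ?_ ?_ (by decide) (hb ?_)
      | refine hqq _ _ _ _ _ _ f3 rfl ?_ ?_ ?_ ?_ (by decide) (hb ?_)
      | refine hqq _ _ _ _ _ _ rfl f8 ?_ ?_ ?_ ?_ (by decide) (hb ?_)
      | refine hqq _ _ _ _ _ _ rfl rfl ?_ ?_ ?_ ?_ (by decide) (hb ?_)
      | refine hpq _ _ _ _ _ _ rfl rfl ?_ ?_ ?_ ?_ (by decide) (hb ?_)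
    all_goals first
      | omega
      | change _ = _ ∨ _; omega
      | change _ ∧ _; omega
      | change ¬ _; omega
  have hperm : ∀ k ∈ pet₈.nodes, k ∈ [3, 2, 7, 5, 4, 9, 6, 8] := by decide
  refine ⟨f, fun k hk => ?_, fun k hk l hl hkl =>
    ((hR' k l).1 (hR.forall (hperm k hk) (hperm l hl) hkl)).1, fun k hk hp' => ?_,
    fun k hk l hl hkl =>
    ((hR' k l).1 (hR.forall (hperm k hk) (hperm l hl) hkl)).2.1⟩
  · have := hperm k hk
    simp only [List.mem_cons, List.not_mem_nil, or_false] at this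
    rcases this with rfl | rfl | rfl | rfl | rfl | rfl | rfl | rfl
    all_goals first
      | exact hp.connSet_image (by omega) (by omega)
      | exact hq.connSet_image (by omega) (by omega)
  · have := hperm k hk
    simp only [List.mem_cons, List.not_mem_nil, or_false] at this
    rcases this with rfl | rfl | rfl | rfl | rfl | rfl | rfl | rfl
    all_goals first
      | exact absurd hp' (by decide)
      | simp [f]

end Bicycle

section Extensions

variable {V : Type} {G : SimpleGraph V} [Finite V]

theorem isTwoExtensionOf_heawood_of_model_hea₁₃ (hT : TwoConnected G) (hC : ¬ HasProper2Cutset G)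
    (hTF : ∀ a b c, G.Adj a b → G.Adj b c → ¬ G.Adj a c) (hSF : ¬ HasSquare G)
    (hU : SplitFree G) (h : ∃ f, Model G hea₁₃.pat f) : IsTwoExtensionOf heawood G := by
  rcases hea₁₃_good.extend hT hC hTF hSF hU hea₁₃_point hea₁₃_blob h with
    ⟨f, hf, hcov, harc⟩ | ⟨H, hH, h⟩
  · have hs : hea₁₃.nodes ⊆ hea₁₄.nodes := by decide
    exact hea₁₃_good.isTwoExtensionOf hf hcov harc _
      fun i hi j hj => Canon.hea₁₄_spec i (hs hi) j (hs hj)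
  rcases hea₁₄_good.extend hT hC hTF hSF hU hea₁₄_point hea₁₄_blob
    (List.mem_singleton.1 hH ▸ h) with ⟨f, hf, hcov, harc⟩ | ⟨H, hH, -⟩
  · exact hea₁₄_good.isTwoExtensionOf hf hcov harc _ Canon.hea₁₄_spec
  · simp at hH

theorem isTwoExtensionOf_heawood_of_model_hea₁₁ (hT : TwoConnected G) (hC : ¬ HasProper2Cutset G)
    (hTF : ∀ a b c, G.Adj a b → G.Adj b c → ¬ G.Adj a c) (hSF : ¬ HasSquare G)
    (hU : SplitFree G) (h : ∃ f, Model G hea₁₁.pat f) : IsTwoExtensionOf heawood G := by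
  rcases hea₁₁_good.extend hT hC hTF hSF hU hea₁₁_point hea₁₁_blob h with
    ⟨f, hf, hcov, harc⟩ | ⟨H, hH, h⟩
  · have hs : hea₁₁.nodes ⊆ hea₁₄.nodes := by decide
    exact hea₁₁_good.isTwoExtensionOf hf hcov harc _
      fun i hi j hj => Canon.hea₁₄_spec i (hs hi) j (hs hj)
  rcases hea₁₂_good.extend hT hC hTF hSF hU hea₁₂_point hea₁₂_blob
    (List.mem_singleton.1 hH ▸ h) with ⟨f, hf, hcov, harc⟩ | ⟨H, hH, h⟩
  · have hs : hea₁₂.nodes ⊆ hea₁₄.nodes := by decide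
    exact hea₁₂_good.isTwoExtensionOf hf hcov harc _
      fun i hi j hj => Canon.hea₁₄_spec i (hs hi) j (hs hj)
  · exact isTwoExtensionOf_heawood_of_model_hea₁₃ hT hC hTF hSF hU
      (List.mem_singleton.1 hH ▸ h)

theorem isTwoExtensionOf_of_model_pet₈ (hT : TwoConnected G) (hC : ¬ HasProper2Cutset G)
    (hTF : ∀ a b c, G.Adj a b → G.Adj b c → ¬ G.Adj a c) (hSF : ¬ HasSquare G)
    (hU : SplitFree G) (h : ∃ f, Model G pet₈.pat f) :
    IsTwoExtensionOf petersen G ∨ IsTwoExtensionOf heawood G := by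
  rcases pet₈_good.extend hT hC hTF hSF hU pet₈_point pet₈_blob h with
    ⟨f, hf, hcov, harc⟩ | ⟨H, hH, h⟩
  · have hs : pet₈.nodes ⊆ pet₁₀.nodes := by decide
    exact Or.inl <| pet₈_good.isTwoExtensionOf hf hcov harc _
      fun i hi j hj => Canon.pet₁₀_spec i (hs hi) j (hs hj)
  simp only [List.mem_cons, List.not_mem_nil, or_false] at hH
  rcases hH with rfl | rfl
  swap
  · exact Or.inr (isTwoExtensionOf_heawood_of_model_hea₁₁ hT hC hTF hSF hU h)
  rcases pet₉_good.extend hT hC hTF hSF hU pet₉_point pet₉_blob h with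
    ⟨f, hf, hcov, harc⟩ | ⟨H, hH, h⟩
  · have hs : pet₉.nodes ⊆ pet₁₀.nodes := by decide
    exact Or.inl <| pet₉_good.isTwoExtensionOf hf hcov harc _
      fun i hi j hj => Canon.pet₁₀_spec i (hs hi) j (hs hj)
  simp only [List.mem_cons, List.not_mem_nil, or_false] at hH
  rcases hH with rfl | rfl
  swap
  · exact Or.inr (isTwoExtensionOf_heawood_of_model_hea₁₃ hT hC hTF hSF hU h)
  rcases pet₁₀_good.extend hT hC hTF hSF hU pet₁₀_point pet₁₀_blob h with
    ⟨f, hf, hcov, harc⟩ | ⟨H, hH, -⟩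
  · exact Or.inl <| pet₁₀_good.isTwoExtensionOf hf hcov harc _ Canon.pet₁₀_spec
  · simp at hH

end Extensions

/-- Decomposition theorem for 2-connected {square,unichord}-free graphs. -/
theorem stmt10 {V : Type} [Fintype V] (G : SimpleGraph V) (h2c : TwoConnected G)
    (hsq : ¬ HasSquare G) (huf : UnichordFree G) :
    G = ⊤ ∨ Sparse G ∨ IsTwoExtensionOf petersen G ∨ IsTwoExtensionOf heawood G ∨
      HasProper2Cutset G := by
  have hU := huf.splitFree
  by_cases hTF : ∀ a b c, G.Adj a b → G.Adj b c → ¬ G.Adj a c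
  swap
  · push Not at hTF
    obtain ⟨a, b, c, hab, hbc, hac⟩ := hTF
    exact Or.inl (h2c.eq_top_of_triangle hU hab hbc hac)
  by_cases hS : Sparse G
  · exact Or.inr (Or.inl hS)
  by_cases hC : HasProper2Cutset G
  · exact Or.inr (Or.inr (Or.inr (Or.inr hC)))
  obtain ⟨u, v, A, B, n, m, p, q, i, j, huv, hp, hq, hAB, hi, hin, hj, hjm, hij, hu⟩ :=
    exists_bicycle h2c hC hTF hsq hU hS
  rcases isTwoExtensionOf_of_model_pet₈ h2c hC hTF hsq hU
    (exists_model_pet₈ huv hp hq hAB hi hin hj hjm hij hu) with h | h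
  · exact Or.inr (Or.inr (Or.inl h))
  · exact Or.inr (Or.inr (Or.inr (Or.inl h)))
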